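/- arXiv:1112.4288 — 2 statements merged into one kernel-verified Lean document; each statement's English description precedes it below -/
import Mathlib

section
/- There exists a dimensional constant γ(n) > 0 such that for every obstacle Ω, every admissible initial set E₀, every time step h > 0 and every i ∈ ℕ, the consecutive sets of the discrete flow satisfy: for every x ∈ ∂E^{(h)}_{i+1}, dist(x, ∂E^{(h)}_{i}) ≤ γ(n)·√h. -/
open MeasureTheory Metric Filter Set Bornology
open scoped ENNReal NNReal symmDiff Topology RealInnerProductSpace

noncomputable section

/-- `n`-dimensional Euclidean space. -/
abbrev Eucl (n : ℕ) : Type := EuclideanSpace ℝ (Fin n)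

/-- A set has `C¹` boundary: near each boundary point it is the sublevel set of a `C¹`
function with nonvanishing differential. -/
def HasC1Boundary {n : ℕ} (E : Set (Eucl n)) : Prop :=
  ∀ x ∈ frontier E, ∃ (U : Set (Eucl n)) (f : Eucl n → ℝ),
    IsOpen U ∧ x ∈ U ∧ ContDiff ℝ 1 f ∧ (∀ y ∈ U, fderiv ℝ f y ≠ 0) ∧
    E ∩ U = {y | y ∈ U ∧ f y ≤ 0}

/-- `E` has a `C^{1,1}` boundary near the point `x`: locally it is the sublevel set of a `C¹`
function, with Lipschitz differential, and nonvanishing differential. -/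
def C11At {n : ℕ} (E : Set (Eucl n)) (x : Eucl n) : Prop :=
  ∃ (U : Set (Eucl n)) (f : Eucl n → ℝ) (K : ℝ≥0),
    IsOpen U ∧ x ∈ U ∧ ContDiff ℝ 1 f ∧ LipschitzOnWith K (fderiv ℝ f) U ∧
    (∀ y ∈ U, fderiv ℝ f y ≠ 0) ∧ E ∩ U = {y | y ∈ U ∧ f y ≤ 0}

/-- A set has `C^{1,1}` boundary. -/
def HasC11Boundary {n : ℕ} (E : Set (Eucl n)) : Prop :=
  ∀ x ∈ frontier E, C11At E x

/-- The (relative) perimeter of `E` in the open set `O`, defined à la De Giorgi as the least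
`liminf` of the `(n-1)`-dimensional Hausdorff measures of the boundaries of smooth
approximations converging to `E` in `L¹(O)`. -/
def Pe {n : ℕ} (E O : Set (Eucl n)) : ℝ≥0∞ :=
  sInf { p : ℝ≥0∞ | ∃ Ej : ℕ → Set (Eucl n),
    (∀ j, HasC1Boundary (Ej j)) ∧
    Tendsto (fun j => volume (((Ej j) ∆ E) ∩ O)) atTop (nhds 0) ∧
    p = Filter.liminf (fun j => μH[(n : ℝ) - 1] (frontier (Ej j) ∩ O)) atTop }

/-- Total perimeter. -/
def PeT {n : ℕ} (E : Set (Eucl n)) : ℝ≥0∞ := Pe E Set.univ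

/-- A Caccioppoli set: measurable, with finite perimeter. -/
def IsCaccioppoli {n : ℕ} (E : Set (Eucl n)) : Prop :=
  MeasurableSet E ∧ PeT E < ⊤

/-- A minimizing hull: `E` minimizes perimeter with respect to all sets containing it which
coincide with `E` outside a bounded set. -/
def IsMinimizingHull {n : ℕ} (E : Set (Eucl n)) : Prop :=
  ∀ F : Set (Eucl n), MeasurableSet F → E ⊆ F → IsBounded (F \ E) → PeT E ≤ PeT F

/-- Signed distance from the boundary of `F` (negative inside, positive outside). -/
def sdist {n : ℕ} (F : Set (Eucl n)) (x : Eucl n) : ℝ :=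
  haveI := Classical.dec (x ∈ F)
  if x ∈ F then -infDist x (frontier F) else infDist x (frontier F)

/-- The Almgren–Taylor–Wang functional `G(E, h, F) = Pe(E) + h⁻¹ ∫_E d_{∂F}`. -/
def Gfun {n : ℕ} (h : ℝ) (F E : Set (Eucl n)) : EReal :=
  (PeT E : EReal) + (((h⁻¹ * ∫ x in E, sdist F x) : ℝ) : EReal)

/-- `E` is a minimizer of `G(·, h, F)` among Caccioppoli sets containing `Ω` a.e. -/
def IsGMin {n : ℕ} (Ω : Set (Eucl n)) (h : ℝ) (F E : Set (Eucl n)) : Prop :=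
  IsCaccioppoli E ∧ volume (Ω \ E) = 0 ∧
  ∀ E' : Set (Eucl n), IsCaccioppoli E' → volume (Ω \ E') = 0 →
    Gfun h F E ≤ Gfun h F E'

/-- `E` is the maximal minimizer of `G(·, h, F)`: it contains every other minimizer up to a
null set. -/
def IsMaxGMin {n : ℕ} (Ω : Set (Eucl n)) (h : ℝ) (F E : Set (Eucl n)) : Prop :=
  IsGMin Ω h F E ∧ ∀ E' : Set (Eucl n), IsGMin Ω h F E' → volume (E' \ E) = 0

/-- A discrete (in time) flow with obstacle `Ω`, initial set `E₀` and time step `h`. -/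
def IsDiscreteFlow {n : ℕ} (Ω E₀ : Set (Eucl n)) (h : ℝ) (E : ℕ → Set (Eucl n)) : Prop :=
  E 0 = E₀ ∧ ∀ i : ℕ, IsGMin Ω h (E i) (E (i + 1))

/-- The maximal discrete flow: each step is the maximal minimizer. -/
def IsMaxFlow {n : ℕ} (Ω E₀ : Set (Eucl n)) (h : ℝ) (E : ℕ → Set (Eucl n)) : Prop :=
  E 0 = E₀ ∧ ∀ i : ℕ, IsMaxGMin Ω h (E i) (E (i + 1))

/-- Normalized pointwise representative of a Caccioppoli set:
`x ∈ ∂E ↔ 0 < |B_r(x) ∩ E| < ω_n rⁿ` for all `r > 0`. -/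
def IsNormalized {n : ℕ} (E : Set (Eucl n)) : Prop :=
  ∀ x : Eucl n, x ∈ frontier E ↔
    ∀ r : ℝ, 0 < r → 0 < volume (E ∩ ball x r) ∧ volume (E ∩ ball x r) < volume (ball x r)

/-- Divergence of a vector field on Euclidean space. -/
def vdiv {n : ℕ} (V : Eucl n → Eucl n) (x : Eucl n) : ℝ :=
  ∑ i : Fin n, ⟪fderiv ℝ V x (EuclideanSpace.single i (1 : ℝ)),
    EuclideanSpace.single i (1 : ℝ)⟫

/-- The unit normal field of the level sets of `f`. -/
def unitNormalField {n : ℕ} (f : Eucl n → ℝ) (x : Eucl n) : Eucl n :=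
  ‖gradient f x‖⁻¹ • gradient f x

/-- `S` is, near each of its points, a smooth hypersurface with vanishing mean curvature
(the mean curvature being the divergence of the unit normal of a local level-set
representation). -/
def IsMinimalLocally {n : ℕ} (S : Set (Eucl n)) : Prop :=
  ∀ x ∈ S, ∃ (U : Set (Eucl n)) (f : Eucl n → ℝ),
    IsOpen U ∧ x ∈ U ∧ ContDiff ℝ (⊤ : ℕ∞) f ∧ (∀ y ∈ U, gradient f y ≠ 0) ∧
    S ∩ U = {y | y ∈ U ∧ f y = 0} ∧
    ∀ y ∈ S ∩ U, vdiv (unitNormalField f) y = 0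

/-- `S` is a compact smooth embedded minimal hypersurface with boundary `B`:
away from `B`, each point of `S` has a neighbourhood in which `S` is a smooth level set
whose unit normal field is divergence free (vanishing mean curvature). -/
def IsMinimalHypersurface {n : ℕ} (S B : Set (Eucl n)) : Prop :=
  IsCompact S ∧ IsClosed B ∧ B ⊆ S ∧
  ∀ x ∈ S \ B, ∃ (U : Set (Eucl n)) (f : Eucl n → ℝ),
    IsOpen U ∧ x ∈ U ∧ ContDiff ℝ (⊤ : ℕ∞) f ∧ (∀ y ∈ U, gradient f y ≠ 0) ∧
    S ∩ U = {y | y ∈ U ∧ f y = 0} ∧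
    ∀ y ∈ S ∩ U, vdiv (unitNormalField f) y = 0

/-- A global barrier: it contains every compact minimal hypersurface whose boundary it
contains. -/
def IsGlobalBarrier {n : ℕ} (Θ : Set (Eucl n)) : Prop :=
  ∀ S B : Set (Eucl n), IsMinimalHypersurface S B → B ⊆ Θ → S ⊆ Θ

/-- The mean-convex hull: the intersection of all global barriers containing `Ω`. -/
def mcHull {n : ℕ} (Ω : Set (Eucl n)) : Set (Eucl n) :=
  ⋂₀ { Θ : Set (Eucl n) | IsGlobalBarrier Θ ∧ Ω ⊆ Θ }

/-- A closed set with `C^{1,1}` boundary is mean-convex: the mean curvature vector points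
inward a.e., i.e. the divergence of the outer unit normal is nonnegative at every boundary
point where it is defined. -/
def IsMeanConvex {n : ℕ} (Ω : Set (Eucl n)) : Prop :=
  ∀ x ∈ frontier Ω, ∃ (U : Set (Eucl n)) (f : Eucl n → ℝ) (K : ℝ≥0),
    IsOpen U ∧ x ∈ U ∧ ContDiff ℝ 1 f ∧ LipschitzOnWith K (fderiv ℝ f) U ∧
    (∀ y ∈ U, gradient f y ≠ 0) ∧ Ω ∩ U = {y | y ∈ U ∧ f y ≤ 0} ∧
    ∀ y ∈ frontier Ω ∩ U, DifferentiableAt ℝ (unitNormalField f) y →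
      0 ≤ vdiv (unitNormalField f) y

/-- `‖A_{∂E}‖_{L^∞} ≤ M`: at every boundary point where the (outer unit normal) gradient of
the signed distance function is differentiable, the norm of its derivative (which realizes
the second fundamental form of `∂E`) is at most `M`. -/
def ANormLe {n : ℕ} (E : Set (Eucl n)) (M : ℝ) : Prop :=
  ∀ x ∈ frontier E, DifferentiableAt ℝ (gradient (sdist E)) x →
    ‖fderiv ℝ (gradient (sdist E)) x‖ ≤ M

/-- `X` is an outcome `𝓔(Ω)` of the obstacle mean curvature flow construction: the
intersection over `ε` of the asymptotic limits `E^ε_{max,∞} = ⋃_{h>0} ⋂_i E^{(h),ε}_{max,i}`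
of the maximal flows with obstacle `Ω_ε = {dist(·,Ω) ≤ ε}`, started from a fixed closed
convex set `E₀` compactly containing the `Ω_ε`. -/
def IsCalE {n : ℕ} (Ω X : Set (Eucl n)) : Prop :=
  ∃ (ε₀ : ℝ) (E₀ : Set (Eucl n)) (Fl : ℝ → ℝ → ℕ → Set (Eucl n)),
    0 < ε₀ ∧ IsClosed E₀ ∧ Convex ℝ E₀ ∧ IsBounded E₀ ∧
    (∀ ε ∈ Ioo (0 : ℝ) ε₀, HasC11Boundary (cthickening ε Ω) ∧
      cthickening ε Ω ⊆ interior E₀) ∧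
    (∀ ε ∈ Ioo (0 : ℝ) ε₀, ∀ h : ℝ, 0 < h → IsMaxFlow (cthickening ε Ω) E₀ h (Fl ε h)) ∧
    X = ⋂ ε ∈ Ioo (0 : ℝ) ε₀, ⋃ h ∈ Ioi (0 : ℝ), ⋂ i, Fl ε h i

theorem HasC1Boundary.isClosed {n : ℕ} {A : Set (Eucl n)} (hA : HasC1Boundary A) : IsClosed A := by
  rw [← frontier_subset_iff_isClosed]
  intro x hx
  obtain ⟨U, f, hU, hxU, hf, -, hAU⟩ := hA x hx
  have hle : f x ≤ 0 := by
    by_contra! hpos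
    have hmem : U ∩ {y | 0 < f y} ∈ 𝓝 x :=
      inter_mem (hU.mem_nhds hxU) (hf.continuous.continuousAt.eventually (lt_mem_nhds hpos))
    obtain ⟨y, ⟨hyU, hy⟩, hyA⟩ := mem_closure_iff_nhds.1 hx.1 _ hmem
    have : y ∈ A ∩ U := ⟨hyA, hyU⟩
    rw [hAU] at this
    exact absurd this.2 (not_le.2 hy)
  have : x ∈ A ∩ U := by rw [hAU]; exact ⟨hxU, hle⟩
  exact this.1

/-- Sets that are approximated by `C¹` sets of boundary measure at most `c` have perimeter at
most `c`. -/
theorem PeT_le_of_approx {n : ℕ} {E : Set (Eucl n)} {c : ℝ≥0∞}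
    (H : ∀ η : ℝ≥0∞, 0 < η → ∃ A : Set (Eucl n), HasC1Boundary A ∧ volume (A ∆ E) ≤ η ∧
      μH[(n : ℝ) - 1] (frontier A) ≤ c) : PeT E ≤ c := by
  have hη : ∀ j : ℕ, (0 : ℝ≥0∞) < ((j : ℝ≥0∞) + 1)⁻¹ := fun j => by simp
  choose A hA hAE hAc using fun j : ℕ => H _ (hη j)
  refine le_trans (b := liminf (fun j => μH[(n : ℝ) - 1] (frontier (A j) ∩ univ)) atTop)
    (sInf_le ⟨A, hA, ?_, rfl⟩) ?_
  · simp only [inter_univ]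
    refine tendsto_of_tendsto_of_tendsto_of_le_of_le tendsto_const_nhds ?_ (fun _ => bot_le) hAE
    have := (tendsto_add_atTop_iff_nat (f := fun j : ℕ => ((j : ℝ≥0∞))⁻¹) 1).2
      ENNReal.tendsto_inv_nat_nhds_zero
    simpa using this
  · simp only [inter_univ]
    exact liminf_le_of_le (by isBoundedDefault) fun b hb => by
      obtain ⟨j, hj⟩ := hb.exists
      exact hj.trans (hAc j)

theorem exists_approx_of_PeT_lt {n : ℕ} {E : Set (Eucl n)} {c : ℝ≥0∞} (h : PeT E < c)
    {η : ℝ≥0∞} (hη : 0 < η) : ∃ A : Set (Eucl n), HasC1Boundary A ∧ volume (A ∆ E) < η ∧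
      μH[(n : ℝ) - 1] (frontier A) < c := by
  obtain ⟨p, ⟨A, hA, hAE, rfl⟩, hp⟩ := sInf_lt_iff.1 h
  simp only [inter_univ] at hAE hp
  have h1 := frequently_lt_of_liminf_lt (by isBoundedDefault) hp
  have h2 : ∀ᶠ j in atTop, volume (A j ∆ E) < η := hAE.eventually (gt_mem_nhds hη)
  obtain ⟨j, hj1, hj2⟩ := (h1.and_eventually h2).exists
  exact ⟨A j, hA j, hj2, hj1⟩

theorem measure_symmDiff_triangle {n : ℕ} (A B C : Set (Eucl n)) :
    volume (A ∆ C) ≤ volume (A ∆ B) + volume (B ∆ C) :=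
  (measure_mono (symmDiff_triangle A B C)).trans (measure_union_le _ _)

/-- Lower semicontinuity of the perimeter. -/
theorem PeT_le_of_approx_PeT {n : ℕ} {E : Set (Eucl n)} {c : ℝ≥0∞}
    (H : ∀ η : ℝ≥0∞, 0 < η → ∃ A : Set (Eucl n), volume (A ∆ E) ≤ η ∧ PeT A ≤ c) :
    PeT E ≤ c := by
  refine le_of_forall_gt fun d hd => ?_
  obtain ⟨d', hcd', hd'⟩ := exists_between hd
  refine lt_of_le_of_lt (PeT_le_of_approx (c := d') fun η hη => ?_) hd'
  have hη2 : 0 < η / 2 := ENNReal.half_pos hη.ne'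
  obtain ⟨B, hB, hBc⟩ := H _ hη2
  obtain ⟨A, hA, hAB, hAc⟩ := exists_approx_of_PeT_lt (hBc.trans_lt hcd') hη2
  refine ⟨A, hA, (measure_symmDiff_triangle A B E).trans ?_, hAc.le⟩
  exact (add_le_add hAB.le hB).trans (ENNReal.add_halves η).le

theorem volume_eq_zero_of_hausdorff_ne_top {n : ℕ} {S : Set (Eucl n)}
    (h : μH[(n : ℝ) - 1] S ≠ ⊤) : volume S = 0 := by
  have h0 : μH[(n : ℝ)] S = 0 :=
    (Measure.hausdorffMeasure_zero_or_top (by linarith) S).resolve_right h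
  have hH : (μH[(Module.finrank ℝ (Eucl n) : ℝ)] : Measure (Eucl n)).IsAddHaarMeasure :=
    isAddHaarMeasure_hausdorffMeasure
  rw [finrank_euclideanSpace_fin] at hH
  exact Measure.absolutelyContinuous_isAddHaarMeasure volume (μH[(n : ℝ)]) h0

theorem hasFDerivAt_exists_neg {n : ℕ} {f : Eucl n → ℝ} {x : Eucl n}
    (hf : DifferentiableAt ℝ f x) (h0 : f x = 0) {v : Eucl n} (hv : fderiv ℝ f x v < 0) :
    ∀ᶠ t in 𝓝[>] (0 : ℝ), f (x + t • v) < 0 := by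
  have h1 : HasDerivAt (fun t : ℝ => f (x + t • v)) (fderiv ℝ f x v) 0 := by
    have hf' : HasFDerivAt f (fderiv ℝ f x) (x + (0 : ℝ) • v) := by simpa using hf.hasFDerivAt
    have h2 : HasDerivAt (fun t : ℝ => x + t • v) v 0 := by
      simpa using ((hasDerivAt_id (0 : ℝ)).smul_const v).const_add x
    exact hf'.comp_hasDerivAt (0 : ℝ) h2
  have h3 := h1.tendsto_slope
  have h4 : ∀ᶠ t in 𝓝[≠] (0 : ℝ), slope (fun t : ℝ => f (x + t • v)) 0 t < 0 :=
    h3.eventually (gt_mem_nhds hv)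
  have h5 := h4.filter_mono (nhdsWithin_mono 0 (fun t (ht : 0 < t) => ht.ne'))
  filter_upwards [h5, self_mem_nhdsWithin] with t ht htpos
  have htpos : (0 : ℝ) < t := htpos
  rw [slope_def_field] at ht
  simp only [zero_smul, add_zero, h0, sub_zero] at ht
  by_contra! hge
  exact absurd ht (not_lt.2 (div_nonneg hge htpos.le))

/-- The zero points of a submersive function are limits of points where it is positive. -/
theorem mem_closure_pos_of_fderiv_ne_zero {n : ℕ} {f : Eucl n → ℝ} {x : Eucl n}
    (hf : DifferentiableAt ℝ f x) (h0 : f x = 0) (hd : fderiv ℝ f x ≠ 0) {V : Set (Eucl n)}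
    (hV : V ∈ 𝓝 x) : ∃ y ∈ V, 0 < f y := by
  obtain ⟨v, hv⟩ : ∃ v, fderiv ℝ f x v ≠ 0 := by
    by_contra! h
    exact hd (ContinuousLinearMap.ext h)
  obtain ⟨v, hv⟩ : ∃ v, fderiv ℝ (fun y => - f y) x v < 0 := by
    rw [fderiv_fun_neg]
    rcases lt_or_gt_of_ne hv with h | h
    · exact ⟨-v, by simpa using h⟩
    · exact ⟨v, by simpa using h⟩
  have h1 := hasFDerivAt_exists_neg hf.neg (by simpa using h0) hv
  have h2 : Tendsto (fun t : ℝ => x + t • v) (𝓝[>] 0) (𝓝 x) := by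
    have : ContinuousAt (fun t : ℝ => x + t • v) 0 := by fun_prop
    have h3 := this.tendsto
    simp only [zero_smul, add_zero] at h3
    exact h3.mono_left nhdsWithin_le_nhds
  obtain ⟨t, ht1, ht2⟩ := (h1.and (h2 hV)).exists
  exact ⟨_, ht2, by simpa using ht1⟩

theorem HasC1Boundary.closure_compl {n : ℕ} {A : Set (Eucl n)} (hA : HasC1Boundary A) :
    HasC1Boundary (closure Aᶜ) := by
  intro x hx
  have hxA : x ∈ frontier A := by
    have := frontier_closure_subset hx
    rwa [frontier_compl] at this
  obtain ⟨U, f, hU, hxU, hf, hd, hAU⟩ := hA x hxA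
  refine ⟨U, fun y => - f y, hU, hxU, hf.neg, fun y hy => ?_, ?_⟩
  · rw [fderiv_fun_neg]; exact neg_ne_zero.2 (hd y hy)
  · ext y
    have key : ∀ z ∈ U, (z ∈ A ↔ f z ≤ 0) := fun z hz => by
      have : z ∈ A ∩ U ↔ z ∈ {y | y ∈ U ∧ f y ≤ 0} := by rw [hAU]
      simpa [hz] using this
    constructor
    · rintro ⟨hy, hyU⟩
      refine ⟨hyU, ?_⟩
      by_contra! hpos
      have hpos : f y < 0 := by linarith
      have hmem : U ∩ {z | f z < 0} ∈ 𝓝 y :=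
        inter_mem (hU.mem_nhds hyU) (hf.continuous.continuousAt.eventually (gt_mem_nhds hpos))
      obtain ⟨z, ⟨hzU, hz⟩, hzA⟩ := mem_closure_iff_nhds.1 hy _ hmem
      exact hzA ((key z hzU).2 (le_of_lt hz))
    · rintro ⟨hyU, hy⟩
      refine ⟨mem_closure_iff_nhds.2 fun V hV => ?_, hyU⟩
      have hy : 0 ≤ f y := by linarith
      rcases hy.lt_or_eq with h | h
      · exact ⟨y, mem_of_mem_nhds hV, fun hyA => absurd ((key y hyU).1 hyA) (not_le.2 h)⟩
      · obtain ⟨z, ⟨hzV, hzU⟩, hz⟩ := mem_closure_pos_of_fderiv_ne_zero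
          (hf.differentiable (by norm_num) y) h.symm (hd y hyU) (inter_mem hV (hU.mem_nhds hyU))
        exact ⟨z, hzV, fun hzA => absurd ((key z hzU).1 hzA) (not_le.2 hz)⟩

theorem PeT_compl_le {n : ℕ} (E : Set (Eucl n)) : PeT Eᶜ ≤ PeT E := by
  refine le_of_forall_gt fun d hd => ?_
  obtain ⟨d', hcd', hd'⟩ := exists_between hd
  refine lt_of_le_of_lt (PeT_le_of_approx (c := d') fun η hη => ?_) hd'
  obtain ⟨A, hA, hAE, hAc⟩ := exists_approx_of_PeT_lt hcd' hη
  have hsub : frontier (closure Aᶜ) ⊆ frontier A := by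
    rw [← frontier_compl A]; exact frontier_closure_subset
  refine ⟨closure Aᶜ, hA.closure_compl, ?_, (measure_mono hsub).trans hAc.le⟩
  have h0 : volume (frontier A) = 0 := volume_eq_zero_of_hausdorff_ne_top hAc.ne_top
  calc volume (closure Aᶜ ∆ Eᶜ) ≤ volume (closure Aᶜ ∆ Aᶜ) + volume (Aᶜ ∆ Eᶜ) :=
        measure_symmDiff_triangle _ _ _
    _ ≤ volume (frontier A) + volume (A ∆ E) := by
        refine add_le_add (measure_mono ?_) (le_of_eq ?_)
        · rw [Set.symmDiff_def]
          rintro y (⟨hy, hyA⟩ | ⟨hy, hyA⟩)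
          · rw [← frontier_compl]
            exact ⟨hy, fun hi => hyA (interior_subset hi)⟩
          · exact absurd (subset_closure hy) hyA
        · rw [compl_symmDiff_compl]
    _ ≤ η := by rw [h0, zero_add]; exact hAE.le

theorem PeT_compl {n : ℕ} (E : Set (Eucl n)) : PeT Eᶜ = PeT E :=
  le_antisymm (PeT_compl_le E) (by simpa using PeT_compl_le Eᶜ)

theorem volume_le_prod_ediam {n : ℕ} (T : Set (Eucl n)) :
    volume T ≤ ∏ i, Metric.ediam ((fun y : Eucl n => y i) '' T) := by
  set e := (MeasurableEquiv.toLp 2 (Fin n → ℝ)).symm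
  have h1 : volume T = volume (e '' T) := by
    have := (EuclideanSpace.volume_preserving_symm_measurableEquiv_toLp (Fin n)).measure_preimage_equiv
      (e '' T)
    rw [← this, Set.preimage_image_eq _ e.injective]
  rw [h1]
  refine (Real.volume_pi_le_prod_diam _).trans (le_of_eq ?_)
  refine Finset.prod_congr rfl fun i _ => ?_
  rw [Set.image_image]
  rfl

/-- The set swept out by translating `S` along a coordinate segment has volume controlled by the
`(n-1)`-dimensional measure of `S`. -/
theorem volume_sweep_le {n : ℕ} (S : Set (Eucl n)) (i : Fin n) {τ : ℝ} (hτ : 0 < τ) :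
    volume {y : Eucl n | ∃ t ∈ Icc (-τ) τ, y + t • EuclideanSpace.single i (1 : ℝ) ∈ S} ≤
      ENNReal.ofReal (3 * τ) * μH[(n : ℝ) - 1] S := by
  have hn : 1 ≤ n := by have := i.2; omega
  set W : Set (Eucl n) → Set (Eucl n) := fun S =>
    {y | ∃ t ∈ Icc (-τ) τ, y + t • EuclideanSpace.single i (1 : ℝ) ∈ S} with hW
  have h3 : ENNReal.ofReal (3 * τ) ≠ 0 := by simpa using hτ
  have h3' : ENNReal.ofReal (3 * τ) ≠ ⊤ := ENNReal.ofReal_ne_top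
  have key : ∀ T : Set (Eucl n), Metric.ediam T ≤ ENNReal.ofReal τ →
      volume (W T) ≤ ENNReal.ofReal (3 * τ) *
        ⨆ _ : T.Nonempty, Metric.ediam T ^ ((n : ℝ) - 1) := by
    intro T hT
    rcases T.eq_empty_or_nonempty with rfl | hne
    · simp [hW]
    simp only [hne, ciSup_unique]
    refine (volume_le_prod_ediam _).trans ?_
    rw [← Finset.mul_prod_erase _ _ (Finset.mem_univ i)]
    refine mul_le_mul' ?_ ?_
    · refine ediam_le ?_
      rintro _ ⟨y, ⟨t, ht, hy⟩, rfl⟩ _ ⟨z, ⟨s, hs, hz⟩, rfl⟩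
      have h1 : edist (y + t • EuclideanSpace.single i (1 : ℝ))
          (z + s • EuclideanSpace.single i (1 : ℝ)) ≤ ENNReal.ofReal τ :=
        (edist_le_ediam_of_mem hy hz).trans hT
      rw [edist_dist] at h1 ⊢
      have h2 := (ENNReal.ofReal_le_ofReal_iff hτ.le).1 h1
      refine ENNReal.ofReal_le_ofReal ?_
      rw [dist_eq_norm] at h2
      have h4 := (PiLp.norm_apply_le (y + t • EuclideanSpace.single i (1 : ℝ) -
        (z + s • EuclideanSpace.single i (1 : ℝ))) i).trans h2
      simp only [PiLp.sub_apply, PiLp.add_apply, PiLp.smul_apply, PiLp.single_apply,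
        if_true, smul_eq_mul, mul_one, Real.norm_eq_abs] at h4
      rw [Real.dist_eq]
      rw [abs_le] at h4 ⊢
      constructor <;> linarith [ht.1, ht.2, hs.1, hs.2]
    · calc ∏ j ∈ Finset.univ.erase i, Metric.ediam ((fun y : Eucl n => y j) '' W T)
          ≤ ∏ j ∈ Finset.univ.erase i, Metric.ediam T := by
            refine Finset.prod_le_prod' fun j hj => ?_
            have hji : j ≠ i := (Finset.mem_erase.1 hj).1
            refine ediam_le ?_
            rintro _ ⟨y, ⟨t, ht, hy⟩, rfl⟩ _ ⟨z, ⟨s, hs, hz⟩, rfl⟩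
            refine le_trans ?_ (edist_le_ediam_of_mem hy hz)
            rw [edist_dist, edist_dist]
            refine ENNReal.ofReal_le_ofReal ?_
            have h4 := (PiLp.norm_apply_le (y + t • EuclideanSpace.single i (1 : ℝ) -
              (z + s • EuclideanSpace.single i (1 : ℝ))) j)
            rw [dist_eq_norm, dist_eq_norm]
            simpa [hji] using h4
        _ = Metric.ediam T ^ (n - 1) := by simp
        _ = Metric.ediam T ^ ((n : ℝ) - 1) := by
            rw [← ENNReal.rpow_natCast, Nat.cast_sub hn, Nat.cast_one]
        _ ≤ _ := le_rfl
  rw [mul_comm, ← ENNReal.div_le_iff h3 h3', Measure.hausdorffMeasure_apply]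
  refine le_trans ?_ (le_iSup₂ (ENNReal.ofReal τ) (ENNReal.ofReal_pos.2 hτ))
  refine le_iInf₂ fun t ht => le_iInf fun hd => ?_
  rw [ENNReal.div_le_iff h3 h3', mul_comm, ← ENNReal.tsum_mul_left]
  calc volume (W S) ≤ volume (⋃ k, W (t k)) := by
        refine measure_mono ?_
        rintro y ⟨s, hs, hy⟩
        obtain ⟨k, hk⟩ := mem_iUnion.1 (ht hy)
        exact mem_iUnion.2 ⟨k, s, hs, hk⟩
    _ ≤ ∑' k, volume (W (t k)) := measure_iUnion_le _
    _ ≤ _ := ENNReal.tsum_le_tsum fun k => key _ (hd k)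

/-- Eilenberg's inequality: the slices of a set by the level sets of a Lipschitz function. -/
theorem exists_slice_bound {X : Type*} [MetricSpace X] [MeasurableSpace X] [BorelSpace X]
    {d : ℝ} (hd : 0 ≤ d) {S : Set X} {v : X → ℝ} {L : ℝ≥0} (hv : LipschitzOnWith L v S)
    (hS : μH[d + 1] S ≠ ⊤) :
    ∃ g : ℝ → ℝ≥0∞, Measurable g ∧ (∀ t, μH[d] (S ∩ v ⁻¹' {t}) ≤ g t) ∧
      ∫⁻ t, g t ≤ L * μH[d + 1] S := by
  have hcov : ∀ j : ℕ, ∃ T : ℕ → Set X, S ⊆ ⋃ k, T k ∧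
      (∀ k, ediam (T k) ≤ ((j : ℝ≥0∞) + 1)⁻¹) ∧
      ∑' k, ⨆ _ : (T k).Nonempty, ediam (T k) ^ (d + 1) < μH[d + 1] S + ((j : ℝ≥0∞) + 1)⁻¹ := by
    intro j
    have hj : (0 : ℝ≥0∞) < ((j : ℝ≥0∞) + 1)⁻¹ := by simp
    have h1 : μH[d + 1] S < μH[d + 1] S + ((j : ℝ≥0∞) + 1)⁻¹ :=
      ENNReal.lt_add_right hS hj.ne'
    nth_rw 1 [Measure.hausdorffMeasure_apply] at h1
    have h2 := lt_of_le_of_lt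
      (le_iSup₂ (f := fun r (_ : 0 < r) => ⨅ t : ℕ → Set X, ⨅ (_ : S ⊆ ⋃ n, t n),
        ⨅ (_ : ∀ n, ediam (t n) ≤ r), ∑' n, ⨆ _ : (t n).Nonempty, ediam (t n) ^ (d + 1))
        ((j : ℝ≥0∞) + 1)⁻¹ hj) h1
    simp only [iInf_lt_iff] at h2
    obtain ⟨T, hT, hT', h⟩ := h2
    exact ⟨T, hT, hT', h⟩
  choose T hTS hTd hTs using hcov
  set J : ℕ → ℕ → Set ℝ := fun j k => toMeasurable volume (v '' (T j k ∩ S)) with hJ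
  set g : ℕ → ℝ → ℝ≥0∞ := fun j t => ∑' k, (J j k).indicator (fun _ => ediam (T j k) ^ d) t with hg
  have hgm : ∀ j, Measurable (g j) := fun j =>
    Measurable.tsum fun k => measurable_const.indicator (measurableSet_toMeasurable _ _)
  have hlim0 : Tendsto (fun j : ℕ => ((j : ℝ≥0∞) + 1)⁻¹) atTop (𝓝 0) := by
    have := ENNReal.tendsto_inv_nat_nhds_zero.comp (tendsto_add_atTop_nat 1)
    exact this.congr fun j => by simp
  refine ⟨fun t => liminf (fun j => g j t) atTop, Measurable.liminf hgm, fun t => ?_, ?_⟩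
  · refine (Measure.hausdorffMeasure_le_liminf_tsum
      (ι := fun j => {k : ℕ // (T j k ∩ (S ∩ v ⁻¹' {t})).Nonempty}) d _ _ hlim0
      (fun j k => T j k) (.of_forall fun j k => hTd j k)
      (.of_forall fun j y hy => ?_)).trans ?_
    · obtain ⟨k, hk⟩ := mem_iUnion.1 (hTS j hy.1)
      exact mem_iUnion.2 ⟨⟨k, y, hk, hy⟩, hk⟩
    · refine liminf_le_liminf (.of_forall fun j => ?_)
      refine le_trans ?_ (ENNReal.tsum_comp_le_tsum_of_injective
        (f := (Subtype.val : {k : ℕ // (T j k ∩ (S ∩ v ⁻¹' {t})).Nonempty} → ℕ))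
        Subtype.val_injective _)
      refine ENNReal.tsum_le_tsum fun k => ?_
      obtain ⟨k, y, hy, hyS, hyt⟩ := k
      rw [indicator_of_mem]
      exact subset_toMeasurable _ _ ⟨y, ⟨hy, hyS⟩, hyt⟩
  · refine (lintegral_liminf_le hgm).trans ?_
    have hgj : ∀ j, ∫⁻ t, g j t ≤ L * (μH[d + 1] S + ((j : ℝ≥0∞) + 1)⁻¹) := by
      intro j
      rw [lintegral_tsum fun k =>
        (measurable_const.indicator (measurableSet_toMeasurable _ _)).aemeasurable]
      refine le_trans ?_ (mul_le_mul' le_rfl (hTs j).le)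
      rw [← ENNReal.tsum_mul_left]
      refine ENNReal.tsum_le_tsum fun k => ?_
      rw [lintegral_indicator (measurableSet_toMeasurable _ _), setLIntegral_const,
        measure_toMeasurable]
      rcases (T j k).eq_empty_or_nonempty with he | hne
      · simp [he]
      simp only [hne, ciSup_unique]
      have h1 : volume (v '' (T j k ∩ S)) ≤ L * ediam (T j k) := by
        refine (Real.volume_le_diam _).trans (ediam_le ?_)
        rintro _ ⟨y, ⟨hy, hyS⟩, rfl⟩ _ ⟨z, ⟨hz, hzS⟩, rfl⟩
        refine (hv hyS hzS).trans (mul_le_mul' le_rfl (edist_le_ediam_of_mem hy hz))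
      calc ediam (T j k) ^ d * volume (v '' (T j k ∩ S))
          ≤ ediam (T j k) ^ d * (L * ediam (T j k)) := mul_le_mul' le_rfl h1
        _ = L * ediam (T j k) ^ (d + 1) := by
            rw [ENNReal.rpow_add_of_nonneg _ _ hd zero_le_one, ENNReal.rpow_one]; ring
    refine (liminf_le_liminf (.of_forall hgj)).trans (le_of_eq ?_)
    refine Tendsto.liminf_eq ?_
    have h2 : Tendsto (fun j : ℕ => μH[d + 1] S + ((j : ℝ≥0∞) + 1)⁻¹) atTop
        (𝓝 (μH[d + 1] S + 0)) := tendsto_const_nhds.add hlim0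
    simpa using ENNReal.Tendsto.const_mul h2 (Or.inr ENNReal.coe_ne_top)

theorem exists_hausdorff_le_volume (n : ℕ) :
    ∃ C : ℝ≥0, ∀ S : Set (Eucl n), μH[(n : ℝ)] S ≤ C * volume S := by
  have hH : (μH[(Module.finrank ℝ (Eucl n) : ℝ)] : Measure (Eucl n)).IsAddHaarMeasure :=
    isAddHaarMeasure_hausdorffMeasure
  rw [finrank_euclideanSpace_fin] at hH
  refine ⟨Measure.addHaarScalarFactor μH[(n : ℝ)] (volume : Measure (Eucl n)), fun S => ?_⟩
  conv_lhs => rw [Measure.isAddLeftInvariant_eq_smul (μH[(n : ℝ)] : Measure (Eucl n)) volume]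
  exact le_rfl

/-- A constant comparing `n`-dimensional Hausdorff measure with Lebesgue measure. -/
def hausConst (n : ℕ) : ℝ≥0 := (exists_hausdorff_le_volume n).choose

theorem hausdorff_le_volume {n : ℕ} (S : Set (Eucl n)) :
    μH[(n : ℝ)] S ≤ hausConst n * volume S := (exists_hausdorff_le_volume n).choose_spec S

theorem exists_slice_bound_volume {n : ℕ} (hn : 1 ≤ n) {S : Set (Eucl n)} {v : Eucl n → ℝ}
    {L : ℝ≥0} (hv : LipschitzOnWith L v S) (hS : volume S ≠ ⊤) :
    ∃ g : ℝ → ℝ≥0∞, Measurable g ∧ (∀ t, μH[(n : ℝ) - 1] (S ∩ v ⁻¹' {t}) ≤ g t) ∧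
      ∫⁻ t, g t ≤ L * (hausConst n * volume S) := by
  have h1 : (0 : ℝ) ≤ (n : ℝ) - 1 := by
    have : (1 : ℝ) ≤ n := by exact_mod_cast hn
    linarith
  obtain ⟨g, hg, hgs, hgi⟩ := exists_slice_bound h1 hv (by
    rw [sub_add_cancel]
    exact ((hausdorff_le_volume S).trans_lt
      (ENNReal.mul_lt_top ENNReal.coe_lt_top hS.lt_top)).ne)
  refine ⟨g, hg, hgs, hgi.trans (mul_le_mul' le_rfl ?_)⟩
  rw [sub_add_cancel]
  exact hausdorff_le_volume S

theorem exists_frontier_on_line {n : ℕ} {T : Set (Eucl n)} (hT : IsBounded T) {x : Eucl n}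
    (hx : x ∈ T) (i : Fin n) :
    ∃ t : ℝ, x + t • EuclideanSpace.single i (1 : ℝ) ∈ frontier T := by
  obtain ⟨R, hR⟩ := hT.subset_closedBall 0
  have hφ : Continuous fun t : ℝ => x + t • EuclideanSpace.single i (1 : ℝ) := by fun_prop
  have hne : (frontier ((fun t : ℝ => x + t • EuclideanSpace.single i (1 : ℝ)) ⁻¹' T)).Nonempty := by
    refine nonempty_frontier_iff.2 ⟨⟨0, by simpa using hx⟩, fun huniv => ?_⟩
    have h1 : x + (R + ‖x‖ + 1) • EuclideanSpace.single i (1 : ℝ) ∈ T :=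
      huniv.ge (mem_univ (R + ‖x‖ + 1))
    have h1 := hR h1
    have h0 := hR hx
    rw [mem_closedBall_zero_iff] at h1 h0
    have h2 : ‖(R + ‖x‖ + 1) • EuclideanSpace.single i (1 : ℝ)‖ ≤ R + ‖x‖ := by
      have := norm_sub_le (x + (R + ‖x‖ + 1) • EuclideanSpace.single i (1 : ℝ)) x
      rw [add_sub_cancel_left] at this
      linarith
    rw [norm_smul, PiLp.norm_single, norm_one, mul_one, Real.norm_eq_abs] at h2
    have := le_abs_self (R + ‖x‖ + 1)
    linarith
  obtain ⟨t, ht⟩ := hne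
  exact ⟨t, hφ.frontier_preimage_subset T ht⟩

open scoped Pointwise in
/-- A (non-sharp) isoperimetric inequality. -/
theorem isoperimetric {n : ℕ} (hn : 1 ≤ n) {T : Set (Eucl n)} (hTm : MeasurableSet T)
    (hT : IsBounded T) (h0 : 0 < volume T) :
    volume T ^ (n - 1) ≤ (3 * n : ℝ≥0∞) ^ n * μH[(n : ℝ) - 1] (frontier T) ^ n := by
  rcases hn.eq_or_lt with rfl | hn2
  · obtain ⟨x, hx⟩ := nonempty_of_measure_ne_zero h0.ne'
    obtain ⟨t, ht⟩ := exists_frontier_on_line hT hx 0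
    have h1 : (1 : ℝ≥0∞) ≤ μH[((1 : ℕ) : ℝ) - 1] (frontier T) := by
      refine le_trans (le_of_eq ?_) (measure_mono (singleton_subset_iff.2 ht))
      rw [Nat.cast_one, sub_self]
      exact (Measure.hausdorffMeasure_zero_singleton _).symm
    simp only [Nat.cast_one, tsub_self, pow_zero, mul_one, pow_one] at h1 ⊢
    calc (1 : ℝ≥0∞) = 1 * 1 := by simp
      _ ≤ 3 * _ := mul_le_mul' (by norm_num) h1
  set F : Fin n → Set (Eucl n) := fun i =>
    {y | ∃ t ∈ Icc (-1 : ℝ) 1, y + t • EuclideanSpace.single i (1 : ℝ) ∈ frontier T} with hF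
  have hFm : ∀ i, MeasurableSet (F i) := by
    intro i
    have hK : IsCompact ((fun t : ℝ => -(t • EuclideanSpace.single i (1 : ℝ) : Eucl n)) ''
        Icc (-1 : ℝ) 1) := isCompact_Icc.image (by fun_prop)
    have : F i = frontier T + ((fun t : ℝ => (-(t • EuclideanSpace.single i (1 : ℝ)) : Eucl n)) ''
        Icc (-1 : ℝ) 1 : Set (Eucl n)) := by
      ext y
      simp only [hF, mem_ofPred_eq, Set.mem_add, mem_image]
      constructor
      · rintro ⟨t, ht, h⟩
        exact ⟨_, h, _, ⟨t, ht, rfl⟩, by simp⟩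
      · rintro ⟨z, hz, _, ⟨t, ht, rfl⟩, rfl⟩
        exact ⟨t, ht, by simpa using hz⟩
    rw [this]
    exact (isClosed_frontier.add_right_of_isCompact hK).measurableSet
  have hmp := EuclideanSpace.volume_preserving_symm_measurableEquiv_toLp (Fin n)
  set e := (MeasurableEquiv.toLp 2 (Fin n → ℝ)) with he
  set f : (Fin n → ℝ) → ℝ≥0∞ := fun z => ∑ i, (e ⁻¹' F i).indicator 1 z with hf
  have hem : ∀ S : Set (Eucl n), volume (e ⁻¹' S) = volume S := fun S => by
    have := hmp.measure_preimage_equiv (e ⁻¹' S)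
    rw [← this, ← preimage_comp]
    congr 1
  have hfm : Measurable f := Finset.measurable_sum _ fun i _ =>
    measurable_one.indicator (e.measurable (hFm i))
  have hn1 : (1 : ℝ) < n := by exact_mod_cast hn2
  have hn0 : (0 : ℝ) < (n : ℝ) - 1 := by linarith
  have hconj : ((Fintype.card (Fin n) : ℝ)).HolderConjugate ((n : ℝ) / (n - 1)) := by
    rw [Fintype.card_fin]
    exact Real.HolderConjugate.conjExponent hn1
  have hmain := lintegral_prod_lintegral_pow_le (fun _ : Fin n => (volume : Measure ℝ)) hconj hfm
  have hlow : volume T ≤ ∫⁻ z : Fin n → ℝ, ∏ i, (∫⁻ s : ℝ, f (Function.update z i s)) ^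
      (1 / ((Fintype.card (Fin n) : ℝ) - 1)) := by
    rw [← hem T, ← lintegral_indicator_one (e.measurable hTm)]
    refine lintegral_mono fun z => ?_
    by_cases hz : z ∈ e ⁻¹' T
    · rw [indicator_of_mem hz, Pi.one_apply]
      refine Finset.one_le_prod' fun i _ => ?_
      refine ENNReal.one_le_rpow ?_ (by
        rw [Fintype.card_fin]; positivity)
      obtain ⟨t, ht⟩ := exists_frontier_on_line hT hz i
      have h1 : ∀ s ∈ Icc (z i + t - 1) (z i + t + 1), 1 ≤ f (Function.update z i s) := by
        intro s hs
        change 1 ≤ ∑ k, (e ⁻¹' F k).indicator 1 (Function.update z i s)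
        refine le_trans (le_of_eq ?_) (Finset.single_le_sum
          (f := fun k => (e ⁻¹' F k).indicator 1 (Function.update z i s))
          (fun _ _ => bot_le) (Finset.mem_univ i))
        rw [indicator_of_mem, Pi.one_apply]
        refine ⟨z i + t - s, ⟨by linarith [hs.2], by linarith [hs.1]⟩, ?_⟩
        convert ht using 1
        ext j
        by_cases hj : j = i
        · subst hj; simp [he]
        · simp [he, hj]
      calc (1 : ℝ≥0∞) ≤ volume (Icc (z i + t - 1) (z i + t + 1)) := by
            rw [Real.volume_Icc, ENNReal.one_le_ofReal]; linarith
        _ = ∫⁻ s in Icc (z i + t - 1) (z i + t + 1), 1 := by simp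
        _ ≤ ∫⁻ s in Icc (z i + t - 1) (z i + t + 1), f (Function.update z i s) :=
            setLIntegral_mono' measurableSet_Icc h1
        _ ≤ _ := setLIntegral_le_lintegral _ _
    · rw [indicator_of_notMem hz]; exact bot_le
  have hint : ∫⁻ z, f z ≤ 3 * n * μH[(n : ℝ) - 1] (frontier T) := by
    rw [hf, lintegral_finsetSum _ fun i _ => measurable_one.indicator (e.measurable (hFm i))]
    calc ∑ i, ∫⁻ z, (e ⁻¹' F i).indicator 1 z
        ≤ ∑ _i : Fin n, 3 * μH[(n : ℝ) - 1] (frontier T) := by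
          refine Finset.sum_le_sum fun i _ => ?_
          rw [lintegral_indicator_one (e.measurable (hFm i)), hem]
          have h := volume_sweep_le (frontier T) i one_pos
          rwa [mul_one, ENNReal.ofReal_ofNat] at h
      _ = _ := by simp; ring
  have hfin : volume T ≤ (3 * n * μH[(n : ℝ) - 1] (frontier T)) ^ ((n : ℝ) / (n - 1)) :=
    (hlow.trans hmain).trans (ENNReal.rpow_le_rpow hint (by positivity))
  calc volume T ^ (n - 1)
      ≤ ((3 * n * μH[(n : ℝ) - 1] (frontier T)) ^ ((n : ℝ) / (n - 1))) ^ (n - 1) := by gcongr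
    _ = (3 * n * μH[(n : ℝ) - 1] (frontier T)) ^ n := by
        rw [← ENNReal.rpow_natCast, ← ENNReal.rpow_mul, Nat.cast_sub hn, Nat.cast_one,
          div_mul_cancel₀ _ hn0.ne', ENNReal.rpow_natCast]
    _ = _ := by rw [mul_pow]

/-- Local description of a set with `C¹` boundary near an arbitrary point. -/
theorem HasC1Boundary.exists_local {n : ℕ} {A : Set (Eucl n)} (hA : HasC1Boundary A)
    (z : Eucl n) : ∃ (U : Set (Eucl n)) (f : Eucl n → ℝ), IsOpen U ∧ z ∈ U ∧ ContDiff ℝ 1 f ∧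
      ∀ y ∈ U, (y ∈ A ↔ f y ≤ 0) ∧ (f y = 0 → fderiv ℝ f y ≠ 0) := by
  by_cases hz : z ∈ frontier A
  · obtain ⟨U, f, hU, hzU, hf, hd, hAU⟩ := hA z hz
    refine ⟨U, f, hU, hzU, hf, fun y hy => ⟨?_, fun _ => hd y hy⟩⟩
    have : y ∈ A ∩ U ↔ y ∈ {y | y ∈ U ∧ f y ≤ 0} := by rw [hAU]
    simpa [hy] using this
  by_cases hzA : z ∈ A
  · refine ⟨interior A, fun _ => -1, isOpen_interior, ?_, contDiff_const, fun y hy =>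
      ⟨by simp [interior_subset hy], by simp⟩⟩
    by_contra h
    exact hz ⟨subset_closure hzA, h⟩
  · exact ⟨Aᶜ, fun _ => 1, hA.isClosed.isOpen_compl, hzA, contDiff_const, fun y hy =>
      ⟨iff_of_false hy (by norm_num), by simp⟩⟩

/-- A set with `C¹` boundary has a global defining function over any given ball. -/
theorem HasC1Boundary.exists_defining {n : ℕ} {A : Set (Eucl n)} (hA : HasC1Boundary A)
    (x : Eucl n) (R : ℝ) : ∃ f : Eucl n → ℝ, ContDiff ℝ 1 f ∧ HasCompactSupport f ∧
      ∀ y ∈ closedBall x R, (y ∈ A ↔ f y ≤ 0) ∧ (f y = 0 → fderiv ℝ f y ≠ 0) := by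
  choose U f hU hzU hf hfU using hA.exists_local
  have hb : ∀ z, ∃ b : ContDiffBump z, closedBall z b.rOut ⊆ U z := by
    intro z
    obtain ⟨r, hr, hrU⟩ := nhds_basis_closedBall.mem_iff.1 ((hU z).mem_nhds (hzU z))
    exact ⟨⟨r / 2, r, by linarith, by linarith⟩, hrU⟩
  choose b hbU using hb
  obtain ⟨t, -, ht⟩ := (isCompact_closedBall x R).elim_nhds_subcover
    (fun z => ball z (b z).rIn) (fun z _ => ball_mem_nhds z (b z).rIn_pos)
  have hmemU : ∀ z y, b z y ≠ 0 → y ∈ U z := by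
    intro z y h
    refine hbU z (ball_subset_closedBall ?_)
    rw [← (b z).support_eq]
    exact h
  refine ⟨fun y => ∑ z ∈ t, b z y * f z y,
    ContDiff.sum fun z _ => (b z).contDiff.mul (hf z), ?_, ?_⟩
  · have : ∀ z ∈ t, HasCompactSupport fun y => b z y * f z y := fun z _ =>
      (b z).hasCompactSupport.mul_right
    clear ht
    induction t using Finset.induction_on with
    | empty =>
      simp only [Finset.sum_empty]
      exact HasCompactSupport.zero
    | insert a s ha ih =>
      simp only [Finset.sum_insert ha]
      exact (this a (Finset.mem_insert_self _ _)).add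
        (ih fun z hz => this z (Finset.mem_insert_of_mem hz))
  intro y hy
  obtain ⟨z₀, hz₀, hyz₀⟩ : ∃ z ∈ t, b z y = 1 := by
    obtain ⟨z, hz, hyz⟩ := mem_iUnion₂.1 (ht hy)
    exact ⟨z, hz, (b z).one_of_mem_closedBall (ball_subset_closedBall hyz)⟩
  have hyU : y ∈ U z₀ := hmemU z₀ y (by rw [hyz₀]; exact one_ne_zero)
  have hneg : y ∈ A → ∀ z ∈ t, b z y * f z y ≤ 0 := by
    intro hyA z _
    by_cases h : b z y = 0
    · simp [h]
    · exact mul_nonpos_of_nonneg_of_nonpos (b z).nonneg (((hfU z y (hmemU z y h)).1).1 hyA)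
  have hiff : y ∈ A ↔ ∑ z ∈ t, b z y * f z y ≤ 0 := by
    refine ⟨fun hyA => Finset.sum_nonpos (hneg hyA), fun h => ?_⟩
    by_contra hyA
    refine h.not_gt (Finset.sum_pos' (fun z _ => ?_) ⟨z₀, hz₀, ?_⟩)
    · by_cases h : b z y = 0
      · simp [h]
      · refine mul_nonneg (b z).nonneg (le_of_lt ?_)
        rw [← not_le]
        exact fun h' => hyA (((hfU z y (hmemU z y h)).1).2 h')
    · rw [hyz₀, one_mul, ← not_le]
      exact fun h' => hyA ((hfU z₀ y hyU).1.2 h')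
  refine ⟨hiff, fun h0 => ?_⟩
  have hyA : y ∈ A := hiff.2 h0.le
  have hterm : ∀ z ∈ t, b z y * f z y = 0 := (Finset.sum_eq_zero_iff_of_nonpos (hneg hyA)).1 h0
  have hzero : ∀ z ∈ t, b z y ≠ 0 → f z y = 0 := fun z hz h =>
    (mul_eq_zero.1 (hterm z hz)).resolve_left h
  have hder : ∀ z ∈ t, HasFDerivAt (fun y => b z y * f z y) (b z y • fderiv ℝ (f z) y) y := by
    intro z hz
    have h1 := ((b z).contDiff (n := 1)).differentiable one_ne_zero y |>.hasFDerivAt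
    have h2 := (hf z).differentiable one_ne_zero y |>.hasFDerivAt
    have h3 := h1.mul h2
    refine h3.congr_fderiv ?_
    by_cases h : b z y = 0
    · have : fderiv ℝ (b z) y = 0 := by
        refine IsLocalMin.fderiv_eq_zero (.of_forall fun w => ?_)
        rw [h]; exact (b z).nonneg
      simp [h, this]
    · simp [hzero z hz h]
  have hsum := HasFDerivAt.fun_sum hder
  rw [hsum.fderiv]
  have hfz₀ : f z₀ y = 0 := hzero z₀ hz₀ (by rw [hyz₀]; exact one_ne_zero)
  obtain ⟨v, hv⟩ : ∃ v, fderiv ℝ (f z₀) y v < 0 := by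
    have hne := (hfU z₀ y hyU).2 hfz₀
    obtain ⟨v, hv⟩ : ∃ v, fderiv ℝ (f z₀) y v ≠ 0 := by
      by_contra! h
      exact hne (ContinuousLinearMap.ext h)
    rcases hv.lt_or_gt with h | h
    · exact ⟨v, h⟩
    · exact ⟨-v, by simpa using h⟩
  have hle : ∀ z ∈ t, b z y * fderiv ℝ (f z) y v ≤ 0 := by
    intro z hz
    by_cases h : b z y = 0
    · simp [h]
    refine mul_nonpos_of_nonneg_of_nonpos (b z).nonneg ?_
    by_contra! hpos
    have h1 := hasFDerivAt_exists_neg ((hf z).differentiable one_ne_zero y) (hzero z hz h)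
      (v := -v) (by simpa using hpos)
    have h2 := hasFDerivAt_exists_neg (f := fun y => - f z₀ y) (x := y) (v := -v)
      ((hf z₀).differentiable one_ne_zero y).neg (by simpa using hfz₀)
      (by rw [fderiv_fun_neg]; simpa using hv)
    have h3 : ∀ᶠ s in 𝓝[>] (0 : ℝ), y + s • -v ∈ U z ∩ U z₀ := by
      have hc : Tendsto (fun s : ℝ => y + s • -v) (𝓝[>] 0) (𝓝 (y + (0 : ℝ) • -v)) :=
        (Continuous.tendsto (by fun_prop) 0).mono_left nhdsWithin_le_nhds
      rw [zero_smul, add_zero] at hc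
      exact hc (inter_mem ((hU z).mem_nhds (hmemU z y h)) ((hU z₀).mem_nhds hyU))
    obtain ⟨s, ⟨hs1, hs2⟩, hs3, hs4⟩ := ((h1.and h2).and h3).exists
    have hin := (hfU z _ hs3).1.2 hs1.le
    have := (hfU z₀ _ hs4).1.1 hin
    linarith
  intro hcontra
  have hev : ∑ z ∈ t, b z y * fderiv ℝ (f z) y v = 0 := by
    have := DFunLike.congr_fun hcontra v
    simpa using this
  have := Finset.sum_lt_sum (s := t) (f := fun z => b z y * fderiv ℝ (f z) y v) (g := fun _ => 0)
    hle ⟨z₀, hz₀, by rw [hyz₀, one_mul]; exact hv⟩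
  rw [hev] at this
  simp at this

/-- `C¹` approximation of compactly supported functions by smooth functions. -/
theorem exists_smooth_approx_C1 {n : ℕ} {f : Eucl n → ℝ} (hf : ContDiff ℝ 1 f)
    (hfc : HasCompactSupport f) {σ : ℝ} (hσ : 0 < σ) :
    ∃ g : Eucl n → ℝ, ContDiff ℝ 2 g ∧ (∀ y, |g y - f y| ≤ σ) ∧
      ∀ y, ‖fderiv ℝ g y - fderiv ℝ f y‖ ≤ σ := by
  have hfd : Continuous (fderiv ℝ f) := hf.continuous_fderiv one_ne_zero
  have hu1 := hfc.uniformContinuous_of_continuous hf.continuous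
  have hu2 := (hfc.fderiv ℝ).uniformContinuous_of_continuous hfd
  obtain ⟨r₁, hr₁, h₁⟩ := Metric.uniformContinuous_iff.1 hu1 σ hσ
  obtain ⟨r₂, hr₂, h₂⟩ := Metric.uniformContinuous_iff.1 hu2 σ hσ
  set r := min r₁ r₂ with hr
  have hr0 : 0 < r := lt_min hr₁ hr₂
  let φ : ContDiffBump (0 : Eucl n) := ⟨r / 2, r, by linarith, by linarith⟩
  have hφr : φ.rOut = r := rfl
  set g := convolution (φ.normed volume) f (ContinuousLinearMap.lsmul ℝ ℝ) volume with hg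
  have hprec : (ContinuousLinearMap.precompR (Eucl n) (ContinuousLinearMap.lsmul ℝ ℝ) :
      ℝ →L[ℝ] (Eucl n →L[ℝ] ℝ) →L[ℝ] (Eucl n →L[ℝ] ℝ)) = ContinuousLinearMap.lsmul ℝ ℝ := by
    ext a B
    simp
  have hder : ∀ y, fderiv ℝ g y = convolution (φ.normed volume) (fderiv ℝ f)
      (ContinuousLinearMap.lsmul ℝ ℝ) volume y := fun y => by
    rw [← hprec]
    exact (hfc.hasFDerivAt_convolution_right (ContinuousLinearMap.lsmul ℝ ℝ)
      (φ.continuous_normed.locallyIntegrable) hf y).fderiv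
  refine ⟨g, ?_, fun y => ?_, fun y => ?_⟩
  · exact φ.hasCompactSupport_normed.contDiff_convolution_left (n := 2) _ φ.contDiff_normed
      hf.continuous.locallyIntegrable
  · rw [← Real.dist_eq]
    refine ContDiffBump.dist_normed_convolution_le hf.continuous.aestronglyMeasurable
      fun z hz => (h₁ ?_).le
    exact (mem_ball.1 hz).trans_le (min_le_left _ _)
  · rw [hder, ← dist_eq_norm]
    refine ContDiffBump.dist_normed_convolution_le hfd.aestronglyMeasurable
      fun z hz => (h₂ ?_).le
    exact (mem_ball.1 hz).trans_le (min_le_right _ _)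

/-- After adding a generic linear function, almost every level of a `C²` function is regular. -/
theorem ae_ae_regular_value {n : ℕ} {O : Set (Eucl n)} (hO : IsOpen O) {v : Eucl n → ℝ}
    (hv : ContDiffOn ℝ 2 v O) :
    ∀ᵐ p : Eucl n →L[ℝ] ℝ ∂Measure.addHaar, ∀ᵐ t : ℝ, ∀ y ∈ O, v y - p y = t →
      fderiv ℝ v y ≠ p := by
  set Φ : Eucl n → (Eucl n →L[ℝ] ℝ) × ℝ := fun y => (fderiv ℝ v y, v y - fderiv ℝ v y y) with hΦ
  have hΦC : ContDiffOn ℝ 1 Φ O := by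
    have h1 : ContDiffOn ℝ 1 (fderiv ℝ v) O := hv.fderiv_of_isOpen hO (by norm_num)
    have h2 : ContDiffOn ℝ 1 v O := hv.of_le (by norm_num)
    exact h1.prodMk (h2.sub (h1.clm_apply contDiffOn_id))
  have hdim : dimH (Φ '' O) ≤ n := by
    refine (dimH_image_le_of_locally_lipschitzOn fun y hy => ?_).trans
      ((dimH_mono (subset_univ O)).trans ?_)
    · obtain ⟨K, t, ht, hK⟩ := (hΦC.contDiffAt (hO.mem_nhds hy)).exists_lipschitzOnWith
      exact ⟨K, t, mem_nhdsWithin_of_mem_nhds ht, hK⟩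
    · rw [Real.dimH_univ_eq_finrank]; simp
  have hfr : Module.finrank ℝ ((Eucl n →L[ℝ] ℝ) × ℝ) = n + 1 := by
    rw [Module.finrank_prod, Module.finrank_self]
    congr 1
    rw [← (InnerProductSpace.toDual ℝ (Eucl n)).toLinearEquiv.finrank_eq]
    simp
  have hnull : μH[((n + 1 : ℕ) : ℝ≥0)] (Φ '' O) = 0 := by
    refine hausdorffMeasure_of_dimH_lt (hdim.trans_lt ?_)
    simpa using ENNReal.lt_add_right (ENNReal.natCast_ne_top n) one_ne_zero
  have hH : (μH[(Module.finrank ℝ ((Eucl n →L[ℝ] ℝ) × ℝ) : ℝ)] :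
      Measure ((Eucl n →L[ℝ] ℝ) × ℝ)).IsAddHaarMeasure := isAddHaarMeasure_hausdorffMeasure
  rw [hfr] at hH
  have hnull2 : ((Measure.addHaar : Measure (Eucl n →L[ℝ] ℝ)).prod (volume : Measure ℝ))
      (Φ '' O) = 0 :=
    Measure.absolutelyContinuous_isAddHaarMeasure _ (μH[((n + 1 : ℕ) : ℝ)]) (by simpa using hnull)
  have hae := measure_eq_zero_iff_ae_notMem.1 hnull2
  filter_upwards [Measure.ae_ae_of_ae_prod hae] with p hp
  filter_upwards [hp] with t ht y hy hyt hpy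
  refine ht ⟨y, hy, ?_⟩
  simp only [hΦ, hpy, hyt]

theorem mul_le_sub_of_le_fderiv {n : ℕ} {F : Eucl n → ℝ} {Q : Set (Eucl n)} (hQ : Convex ℝ Q)
    (hF : Differentiable ℝ F) {e : Eucl n} {σ c : ℝ}
    (h : ∀ z ∈ Q, c ≤ σ * fderiv ℝ F z e) {p : Eucl n} {t : ℝ} (ht : 0 ≤ t) (hp : p ∈ Q)
    (hpt : p + t • e ∈ Q) : c * t ≤ σ * (F (p + t • e) - F p) := by
  have hd : ∀ r : ℝ, HasDerivAt (fun r : ℝ => σ * F (p + r • e)) (σ * fderiv ℝ F (p + r • e) e) r := by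
    intro r
    have h2 : HasDerivAt (fun t : ℝ => p + t • e) e r := by
      simpa using ((hasDerivAt_id r).smul_const e).const_add p
    exact ((hF _).hasFDerivAt.comp_hasDerivAt r h2).const_mul σ
  have hmem : ∀ r ∈ Icc 0 t, p + r • e ∈ Q := by
    intro r hr
    rcases ht.eq_or_lt with rfl | ht0
    · have : r = 0 := le_antisymm hr.2 hr.1
      simpa [this] using hp
    have := hQ.add_smul_sub_mem hp hpt (t := r / t)
      ⟨div_nonneg hr.1 ht, (div_le_one ht0).2 hr.2⟩
    rwa [add_sub_cancel_left, smul_smul, div_mul_cancel₀ _ ht0.ne'] at this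
  have := (convex_Icc 0 t).mul_sub_le_image_sub_of_le_deriv (f := fun r : ℝ => σ * F (p + r • e))
    (fun r _ => (hd r).continuousAt.continuousWithinAt)
    (fun r _ => (hd r).differentiableAt.differentiableWithinAt) (C := c)
    (fun r hr => by rw [(hd r).deriv]; exact h _ (hmem r (interior_subset hr)))
    0 (left_mem_Icc.2 ht) t (right_mem_Icc.2 ht) ht
  simp only [zero_smul, add_zero, sub_zero] at this
  linarith

theorem mul_abs_le_abs_sub_of_le_fderiv {n : ℕ} {F : Eucl n → ℝ} {Q : Set (Eucl n)}
    (hQ : Convex ℝ Q) (hF : Differentiable ℝ F) {e : Eucl n} {σ c : ℝ} (hσ : |σ| = 1)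
    (h : ∀ z ∈ Q, c ≤ σ * fderiv ℝ F z e) {p : Eucl n} {t : ℝ} (hp : p ∈ Q)
    (hpt : p + t • e ∈ Q) : c * |t| ≤ |F (p + t • e) - F p| := by
  have habs : ∀ a : ℝ, σ * a ≤ |a| := fun a => by
    calc σ * a ≤ |σ * a| := le_abs_self _
      _ = |a| := by rw [abs_mul, hσ, one_mul]
  rcases le_total 0 t with ht | ht
  · rw [abs_of_nonneg ht]
    exact (mul_le_sub_of_le_fderiv hQ hF h ht hp hpt).trans (habs _)
  · rw [abs_of_nonpos ht, abs_sub_comm]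
    have := mul_le_sub_of_le_fderiv hQ hF h (neg_nonneg.2 ht) hpt (by simpa using hp)
    rw [neg_smul, add_neg_cancel_right] at this
    exact this.trans (habs _)

/-- If `f` is small at `y` and steep in the direction `e`, it vanishes nearby on the line
through `y` in the direction `e`. -/
theorem exists_zero_on_line {n : ℕ} {f : Eucl n → ℝ} (hf : Differentiable ℝ f) {e y : Eucl n}
    (he : ‖e‖ = 1) {σ c ρ τ : ℝ} (hσ : |σ| = 1) (hτ : 0 ≤ τ) (hτρ : τ < ρ)
    (h : ∀ z ∈ ball y ρ, c ≤ σ * fderiv ℝ f z e) (hy : |f y| ≤ c * τ) :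
    ∃ t ∈ Icc (-τ) τ, f (y + t • e) = 0 := by
  have hmem : ∀ t : ℝ, |t| ≤ τ → y + t • e ∈ ball y ρ := by
    intro t ht
    rw [mem_ball, dist_eq_norm, add_sub_cancel_left, norm_smul, he, mul_one, Real.norm_eq_abs]
    linarith
  have hyQ : y ∈ ball y ρ := mem_ball_self (hτ.trans_lt hτρ)
  have h1 := mul_le_sub_of_le_fderiv (convex_ball y ρ) hf h hτ hyQ (hmem τ (abs_of_nonneg hτ).le)
  have h2 := mul_le_sub_of_le_fderiv (convex_ball y ρ) hf h hτ (p := y + (-τ) • e)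
    (hmem (-τ) (by rw [abs_neg, abs_of_nonneg hτ])) (by simpa using hyQ)
  rw [neg_smul, neg_add_cancel_right] at h2
  have hσy : |σ * f y| ≤ c * τ := by rwa [abs_mul, hσ, one_mul]
  rw [abs_le] at hσy
  have hcont : ContinuousOn (fun t : ℝ => σ * f (y + t • e)) (Icc (-τ) τ) := by
    have := hf.continuous
    fun_prop
  have hivt := intermediate_value_Icc (by linarith : -τ ≤ τ) hcont
  obtain ⟨t, ht, h0⟩ := hivt (show (0 : ℝ) ∈ _ from ⟨by
    simp only [neg_smul]; linarith, by linarith⟩)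
  refine ⟨t, ht, (mul_eq_zero.1 h0).resolve_left fun h => ?_⟩
  rw [h] at hσ; simp at hσ

/-- Area comparison for graphs over the same coordinate hyperplane. -/
theorem hausdorff_graph_le {n : ℕ} {F : Eucl n → ℝ} (hF : Differentiable ℝ F) (i : Fin n)
    {z : Eucl n} {r c σ : ℝ} {L : ℝ≥0} (hc : 0 < c) (hσ : |σ| = 1)
    (hL : ∀ y ∈ ball z (4 * r), ‖fderiv ℝ F y‖ ≤ L)
    (h : ∀ y ∈ ball z (4 * r), c ≤ σ * fderiv ℝ F y (EuclideanSpace.single i 1))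
    {Γ T : Set (Eucl n)} (hΓ : Γ ⊆ ball z r) (hΓ0 : ∀ y ∈ Γ, F y = 0)
    (hT : ∀ y ∈ Γ, ∃ t : ℝ, y + t • EuclideanSpace.single i (1 : ℝ) ∈ T) :
    μH[(n : ℝ) - 1] Γ ≤ ((1 + L * (Real.toNNReal c)⁻¹ : ℝ≥0) : ℝ≥0∞) ^ ((n : ℝ) - 1) *
      μH[(n : ℝ) - 1] T := by
  have hn : (0 : ℝ) ≤ (n : ℝ) - 1 := by
    have h1 : 1 ≤ n := by have := i.2; omega
    have : (1 : ℝ) ≤ n := by exact_mod_cast h1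
    linarith
  choose! t ht using hT
  set e : Eucl n := EuclideanSpace.single i (1 : ℝ) with he
  have hen : ‖e‖ = 1 := by simp [he]
  have key : ∀ y ∈ Γ, ∀ y' ∈ Γ, dist y y' ≤ (1 + L * c⁻¹) * dist (y + t y • e) (y' + t y' • e) := by
    intro y hy y' hy'
    set d := dist (y + t y • e) (y' + t y' • e) with hd
    have hyz := mem_ball.1 (hΓ hy)
    have hyz' := mem_ball.1 (hΓ hy')
    set a : ℝ := y i - y' i with ha
    set y'' := y' + a • e with hy''
    have ha' : |a| < 2 * r := by
      have h1 : |a| ≤ ‖y - y'‖ := by simpa using PiLp.norm_apply_le (y - y') i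
      rw [← dist_eq_norm] at h1
      have := dist_triangle_right y y' z
      linarith
    have hr : 0 < r := dist_nonneg.trans_lt hyz
    have hyQ : y ∈ ball z (4 * r) := ball_subset_ball (by linarith) (hΓ hy)
    have hyQ' : y' ∈ ball z (4 * r) := ball_subset_ball (by linarith) (hΓ hy')
    have hdy : dist y'' y' = |a| := by
      rw [hy'', dist_eq_norm, add_sub_cancel_left, norm_smul, hen, mul_one, Real.norm_eq_abs]
    have hyQ'' : y'' ∈ ball z (4 * r) := by
      rw [mem_ball]
      have := dist_triangle y'' y' z
      linarith
    have hyy : dist y'' y ≤ d := by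
      rw [hd, dist_comm, EuclideanSpace.dist_eq, EuclideanSpace.dist_eq]
      refine Real.sqrt_le_sqrt (Finset.sum_le_sum fun j _ => ?_)
      by_cases hj : j = i
      · subst hj
        simp only [hy'', he, ha, PiLp.add_apply, PiLp.smul_apply, PiLp.single_apply, if_true,
          smul_eq_mul, mul_one, add_sub_cancel, dist_self]
        rw [zero_pow two_ne_zero]
        exact sq_nonneg _
      · simp [hy'', he, hj]
    have h1 : c * |a| ≤ |F y'' - F y'| :=
      mul_abs_le_abs_sub_of_le_fderiv (convex_ball z (4 * r)) hF hσ h hyQ' hyQ''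
    have h2 : ‖F y'' - F y‖ ≤ L * ‖y'' - y‖ :=
      (convex_ball z (4 * r)).norm_image_sub_le_of_norm_fderiv_le (fun w _ => hF w) hL hyQ hyQ''
    rw [hΓ0 y hy, Real.norm_eq_abs, ← dist_eq_norm] at h2
    rw [hΓ0 y' hy'] at h1
    have h3 : |a| ≤ L * c⁻¹ * d := by
      have h4 : c * |a| ≤ L * d := h1.trans (h2.trans (by gcongr))
      calc |a| = c⁻¹ * (c * |a|) := by field_simp
        _ ≤ c⁻¹ * (L * d) := by gcongr
        _ = _ := by ring
    have := dist_triangle y y'' y'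
    rw [dist_comm y y''] at this
    nlinarith
  have hinj : InjOn (fun y => y + t y • e) Γ := by
    intro y hy y' hy' hyy
    have := key y hy y' hy'
    simp only at hyy
    rw [hyy, dist_self, mul_zero] at this
    exact dist_le_zero.1 this
  set φ := Function.invFunOn (fun y => y + t y • e) Γ
  have hφ : ∀ y ∈ Γ, φ (y + t y • e) = y := fun y hy => hinj.leftInvOn_invFunOn hy
  have hLip : LipschitzOnWith (1 + L * (Real.toNNReal c)⁻¹) φ ((fun y => y + t y • e) '' Γ) := by
    refine LipschitzOnWith.of_dist_le_mul ?_
    rintro _ ⟨y, hy, rfl⟩ _ ⟨y', hy', rfl⟩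
    simp only [hφ y hy, hφ y' hy']
    refine (key y hy y' hy').trans (le_of_eq ?_)
    simp [Real.coe_toNNReal c hc.le]
  calc μH[(n : ℝ) - 1] Γ ≤ μH[(n : ℝ) - 1] (φ '' ((fun y => y + t y • e) '' Γ)) :=
        measure_mono fun y hy => ⟨_, ⟨y, hy, rfl⟩, hφ y hy⟩
    _ ≤ _ * μH[(n : ℝ) - 1] ((fun y => y + t y • e) '' Γ) := hLip.hausdorffMeasure_image_le hn
    _ ≤ _ := mul_le_mul' le_rfl (measure_mono (by rintro _ ⟨y, hy, rfl⟩; exact ht y hy))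

/-- Near its zero set, a function with nonvanishing differential there is uniformly steep in some
coordinate direction. -/
theorem exists_steep {n : ℕ} {f : Eucl n → ℝ} (hf : ContDiff ℝ 1 f) (hfc : HasCompactSupport f)
    {x : Eucl n} {R : ℝ} (h : ∀ y ∈ closedBall x R, f y = 0 → fderiv ℝ f y ≠ 0) :
    ∃ c > 0, ∃ a > 0, ∃ ρ > 0, ∀ y ∈ closedBall x R, |f y| ≤ a → ∃ (i : Fin n) (σ : ℝ), |σ| = 1 ∧
      ∀ z ∈ ball y ρ, c ≤ σ * fderiv ℝ f z (EuclideanSpace.single i 1) := by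
  have hfd : Continuous (fderiv ℝ f) := hf.continuous_fderiv one_ne_zero
  obtain ⟨m, hm, hmin⟩ : ∃ m > 0, ∀ y ∈ closedBall x R, m ≤ max |f y| ‖fderiv ℝ f y‖ := by
    rcases (closedBall x R).eq_empty_or_nonempty with he | hne
    · exact ⟨1, one_pos, by simp [he]⟩
    obtain ⟨y₀, hy₀, hmin⟩ := (isCompact_closedBall x R).exists_isMinOn hne
      (f := fun y => max |f y| ‖fderiv ℝ f y‖)
      (by have := hf.continuous; exact Continuous.continuousOn (by fun_prop))
    refine ⟨_, ?_, fun y hy => hmin hy⟩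
    by_cases h0 : f y₀ = 0
    · exact lt_max_of_lt_right (norm_pos_iff.2 (h y₀ hy₀ h0))
    · exact lt_max_of_lt_left (abs_pos.2 h0)
  set c : ℝ := m / (2 * (n + 1)) with hc
  have hc0 : 0 < c := by positivity
  obtain ⟨ρ, hρ, hu⟩ := Metric.uniformContinuous_iff.1
    ((hfc.fderiv ℝ).uniformContinuous_of_continuous hfd) c hc0
  refine ⟨c, hc0, m / 2, by positivity, ρ, hρ, fun y hy hya => ?_⟩
  have hny : m ≤ ‖fderiv ℝ f y‖ := (le_max_iff.1 (hmin y hy)).resolve_left (by linarith)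
  obtain ⟨i, hi⟩ : ∃ i : Fin n, 2 * c ≤ |fderiv ℝ f y (EuclideanSpace.single i 1)| := by
    by_contra! hlt
    have hle : ‖fderiv ℝ f y‖ ≤ n * (2 * c) := by
      refine ContinuousLinearMap.opNorm_le_bound _ (by positivity) fun v => ?_
      have hv : v = ∑ i, v i • EuclideanSpace.single i (1 : ℝ) := by
        ext j
        simp [Pi.single_apply]
      conv_lhs => rw [hv, map_sum]
      calc ‖∑ i, fderiv ℝ f y (v i • EuclideanSpace.single i (1 : ℝ))‖
          ≤ ∑ i : Fin n, 2 * c * ‖v‖ := by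
            refine norm_sum_le_of_le _ fun i _ => ?_
            rw [map_smul, norm_smul, mul_comm, Real.norm_eq_abs]
            exact mul_le_mul (hlt i).le (PiLp.norm_apply_le v i) (norm_nonneg _) (by positivity)
        _ = n * (2 * c) * ‖v‖ := by simp; ring
    have : n * (2 * c) < m := by
      rw [hc]
      have : (n : ℝ) * (2 * (m / (2 * (n + 1)))) = m * (n / (n + 1)) := by field_simp
      rw [this]
      have h1 : (n : ℝ) / (n + 1) < 1 := (div_lt_one (by positivity)).2 (by linarith)
      nlinarith
    linarith
  have hclose : ∀ z ∈ ball y ρ, |fderiv ℝ f z (EuclideanSpace.single i 1) -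
      fderiv ℝ f y (EuclideanSpace.single i 1)| ≤ c := by
    intro z hz
    have h1 := (hu (mem_ball.1 hz)).le
    rw [dist_eq_norm] at h1
    have h2 := (fderiv ℝ f z - fderiv ℝ f y).le_opNorm (EuclideanSpace.single i 1)
    rw [PiLp.norm_single, norm_one, mul_one] at h2
    simpa using h2.trans h1
  rcases le_total 0 (fderiv ℝ f y (EuclideanSpace.single i 1)) with hs | hs
  · refine ⟨i, 1, by simp, fun z hz => ?_⟩
    rw [abs_of_nonneg hs] at hi
    have := (abs_le.1 (hclose z hz)).1
    linarith
  · refine ⟨i, -1, by simp, fun z hz => ?_⟩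
    rw [abs_of_nonpos hs] at hi
    have := (abs_le.1 (hclose z hz)).2
    linarith

theorem exists_deriv_smoothTransition_bound :
    ∃ M : ℝ, 0 < M ∧ ∀ u, |deriv Real.smoothTransition u| ≤ M := by
  have hS : ContDiff ℝ 1 Real.smoothTransition := Real.smoothTransition.contDiff
  obtain ⟨M, hM⟩ := isCompact_Icc.exists_bound_of_continuousOn
    (s := Icc (0 : ℝ) 1) (hS.continuous_deriv le_rfl).continuousOn
  refine ⟨max M 1, by positivity, fun u => ?_⟩
  rcases lt_or_ge u 0 with hu | hu
  · have : Real.smoothTransition =ᶠ[𝓝 u] fun _ => 0 := by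
      filter_upwards [Iio_mem_nhds hu] with w hw
      exact Real.smoothTransition.zero_of_nonpos (le_of_lt hw)
    rw [this.deriv_eq]; simp
  rcases lt_or_ge 1 u with hu1 | hu1
  · have : Real.smoothTransition =ᶠ[𝓝 u] fun _ => 1 := by
      filter_upwards [Ioi_mem_nhds hu1] with w hw
      exact Real.smoothTransition.one_of_one_le (le_of_lt hw)
    rw [this.deriv_eq]; simp
  · exact (hM u ⟨hu, hu1⟩).trans (le_max_left _ _)

/-- A smooth concave-like truncation: the identity below `1/2`, constant above `1`. -/
theorem exists_truncation : ∃ (κ : ℝ → ℝ) (K : ℝ≥0), ContDiff ℝ 2 κ ∧ (∀ u ≤ 1 / 2, κ u = u) ∧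
    (∀ u, 1 / 2 ≤ u → 1 / 2 ≤ κ u) ∧ (∀ u, κ u ≤ 1) ∧ (∀ u, 1 ≤ u → κ u = 1) ∧
    LipschitzOnWith K κ (Icc 0 1) := by
  set κ : ℝ → ℝ := fun u => u * (1 - Real.smoothTransition (2 * u - 1)) +
    Real.smoothTransition (2 * u - 1) with hκ
  have h1 : ContDiff ℝ 2 fun u : ℝ => Real.smoothTransition (2 * u - 1) :=
    Real.smoothTransition.contDiff.comp (by fun_prop)
  have hC : ContDiff ℝ 2 κ := (contDiff_id.mul (contDiff_const.sub h1)).add h1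
  obtain ⟨K, hK⟩ := (hC.contDiffOn (s := Icc (0 : ℝ) 1)).exists_lipschitzOnWith (by norm_num)
    (convex_Icc 0 1) isCompact_Icc
  have h0 : ∀ w, 0 ≤ Real.smoothTransition w := Real.smoothTransition.nonneg
  have h1 : ∀ w, Real.smoothTransition w ≤ 1 := Real.smoothTransition.le_one
  have hone : ∀ u : ℝ, 1 ≤ u → κ u = 1 := fun u hu => by
    simp only [hκ]
    rw [Real.smoothTransition.one_of_one_le (by linarith)]; ring
  refine ⟨κ, K, hC, fun u hu => ?_, fun u hu => ?_, fun u => ?_, hone, hK⟩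
  · simp only [hκ]
    rw [Real.smoothTransition.zero_of_nonpos (by linarith)]; ring
  · simp only [hκ]
    nlinarith [h0 (2 * u - 1), h1 (2 * u - 1)]
  · rcases le_total u 1 with hu | hu
    · simp only [hκ]
      nlinarith [h0 (2 * u - 1), h1 (2 * u - 1)]
    · exact (hone u hu).le

/-- Radial cutoff functions with the natural gradient bound. -/
theorem exists_cutoff : ∃ C : ℝ, 0 < C ∧ ∀ (n : ℕ) (x : Eucl n) (s δ : ℝ), 0 < δ → δ < s →
    ∃ ψ : Eucl n → ℝ, ContDiff ℝ 2 ψ ∧ (∀ y, 0 ≤ ψ y) ∧ (∀ y, ψ y ≤ 3) ∧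
      (∀ y, y ∉ ball x s → ψ y = 0) ∧ (∀ y ∈ ball x (s - δ), ψ y = 3) ∧
      ∀ y, ‖fderiv ℝ ψ y‖ ≤ C / δ := by
  obtain ⟨M, hM, hSM⟩ := exists_deriv_smoothTransition_bound
  refine ⟨6 * M, by positivity, fun n x s δ hδ hδs => ?_⟩
  have hs : 0 < s := hδ.trans hδs
  set q : Eucl n → ℝ := fun y => (s ^ 2 - ‖y - x‖ ^ 2) / (s * δ) with hq
  have hqC : ContDiff ℝ 2 q := by
    have : ContDiff ℝ 2 fun y : Eucl n => ‖y - x‖ ^ 2 := (contDiff_id.sub contDiff_const).norm_sq ℝ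
    exact (contDiff_const.sub this).div_const _
  have hqd : ∀ y, HasFDerivAt q ((-2 / (s * δ)) • innerSL ℝ (y - x)) y := by
    intro y
    have h1 : HasFDerivAt (fun y : Eucl n => ‖y - x‖ ^ 2) (2 • innerSL ℝ (y - x)) y := by
      have := ((hasFDerivAt_id y).sub_const x).norm_sq
      refine this.congr_fderiv ?_
      ext v; simp
    have h2 := (h1.const_sub (s ^ 2)).mul_const ((s * δ)⁻¹)
    refine h2.congr_fderiv ?_
    ext v
    simp
    ring
  have hqneg : ∀ y, y ∉ ball x s → q y ≤ 0 := by
    intro y hy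
    rw [mem_ball, dist_eq_norm, not_lt] at hy
    exact div_nonpos_of_nonpos_of_nonneg (by nlinarith) (by positivity)
  have hSd : Differentiable ℝ Real.smoothTransition :=
    (Real.smoothTransition.contDiff (n := 1)).differentiable one_ne_zero
  refine ⟨fun y => 3 * Real.smoothTransition (q y),
    contDiff_const.mul (Real.smoothTransition.contDiff.comp hqC),
    fun y => mul_nonneg (by norm_num) (Real.smoothTransition.nonneg _),
    fun y => by linarith [Real.smoothTransition.le_one (q y)],
    fun y hy => by simp [Real.smoothTransition.zero_of_nonpos (hqneg y hy)],
    fun y hy => ?_, fun y => ?_⟩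
  · change 3 * Real.smoothTransition (q y) = 3
    rw [Real.smoothTransition.one_of_one_le, mul_one]
    rw [mem_ball, dist_eq_norm] at hy
    rw [hq, le_div_iff₀ (by positivity)]
    nlinarith [norm_nonneg (y - x)]
  · have hd : HasFDerivAt (fun y => 3 * Real.smoothTransition (q y))
        ((3 : ℝ) • deriv Real.smoothTransition (q y) • ((-2 / (s * δ)) • innerSL ℝ (y - x))) y := by
      have := ((hSd (q y)).hasDerivAt.comp_hasFDerivAt y (hqd y)).const_mul 3
      refine this.congr_fderiv ?_
      ext v; simp
    rw [hd.fderiv]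
    by_cases hy : ‖y - x‖ ≤ s
    · rw [norm_smul, norm_smul, norm_smul, innerSL_apply_norm]
      simp only [Real.norm_eq_abs]
      have h2 : |(-2 / (s * δ))| = 2 / (s * δ) := by
        rw [neg_div, abs_neg, abs_of_pos (by positivity)]
      rw [h2]
      calc |(3 : ℝ)| * (|deriv Real.smoothTransition (q y)| * (2 / (s * δ) * ‖y - x‖))
          ≤ |(3 : ℝ)| * (M * (2 / (s * δ) * s)) := by gcongr; exact hSM _
        _ = 6 * M / δ := by
            rw [abs_of_pos (by norm_num)]
            field_simp
            norm_num
    · have hqy : q y < 0 := by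
        refine div_neg_of_neg_of_pos ?_ (by positivity)
        push Not at hy
        nlinarith
      have : Real.smoothTransition =ᶠ[𝓝 (q y)] fun _ => 0 := by
        filter_upwards [Iio_mem_nhds hqy] with w hw
        exact Real.smoothTransition.zero_of_nonpos (le_of_lt hw)
      rw [this.deriv_eq]
      simp
      positivity

/-- The constant in the gradient bound for radial cutoff functions. -/
def cutoffConst : ℝ := exists_cutoff.choose

theorem cutoffConst_pos : 0 < cutoffConst := exists_cutoff.choose_spec.1

/-- Smoothing a `C¹` function inside the region where a cutoff function is not small, keeping it
unchanged where the cutoff vanishes. -/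
theorem exists_blend {n : ℕ} {f ψ : Eucl n → ℝ} (hf : ContDiff ℝ 1 f) (hfc : HasCompactSupport f)
    (hψ : ContDiff ℝ 2 ψ) {B : ℝ} (hB : ∀ y, ‖fderiv ℝ ψ y‖ ≤ B) {σ : ℝ} (hσ : 0 < σ) :
    ∃ f₁ : Eucl n → ℝ, ContDiff ℝ 1 f₁ ∧ (∀ y, ψ y = 0 → f₁ y = f y) ∧ (∀ y, |f₁ y - f y| ≤ σ) ∧
      (∀ y, ‖fderiv ℝ f₁ y - fderiv ℝ f y‖ ≤ σ) ∧ ContDiffOn ℝ 2 f₁ {y | 1 / 8 < ψ y} := by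
  obtain ⟨M, hM, hSM⟩ := exists_deriv_smoothTransition_bound
  have hB0 : 0 ≤ B := (norm_nonneg _).trans (hB 0)
  set Θ := M * 8 * B with hΘ
  have hΘ0 : 0 ≤ Θ := by positivity
  set σ' := σ / (1 + Θ) with hσ'
  have hσ'0 : 0 < σ' := by positivity
  have hσσ : σ' * (1 + Θ) = σ := by rw [hσ']; field_simp
  obtain ⟨g, hg, hgf, hgd⟩ := exists_smooth_approx_C1 hf hfc hσ'0
  set θ : Eucl n → ℝ := fun y => Real.smoothTransition (8 * ψ y) with hθ
  have hθC : ContDiff ℝ 2 θ := Real.smoothTransition.contDiff.comp (contDiff_const.mul hψ)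
  have hθ0 : ∀ y, 0 ≤ θ y := fun y => Real.smoothTransition.nonneg _
  have hθ1 : ∀ y, θ y ≤ 1 := fun y => Real.smoothTransition.le_one _
  have hSd : Differentiable ℝ Real.smoothTransition :=
    (Real.smoothTransition.contDiff (n := 1)).differentiable one_ne_zero
  have hψd : Differentiable ℝ ψ := hψ.differentiable two_ne_zero
  have hθd : ∀ y, ‖fderiv ℝ θ y‖ ≤ Θ := by
    intro y
    have h1 : HasFDerivAt θ (deriv Real.smoothTransition (8 * ψ y) • ((8 : ℝ) • fderiv ℝ ψ y)) y :=
      HasDerivAt.comp_hasFDerivAt (f := fun y => 8 * ψ y) y (hSd (8 * ψ y)).hasDerivAt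
        ((hψd y).hasFDerivAt.const_mul 8)
    rw [h1.fderiv, norm_smul, norm_smul, Real.norm_eq_abs, Real.norm_eq_abs,
      abs_of_pos (by norm_num : (0 : ℝ) < 8), hΘ, mul_assoc]
    gcongr
    exacts [hSM _, hB y]
  have hg1 : ContDiff ℝ 1 g := hg.of_le (by norm_num)
  have hd : ∀ y, HasFDerivAt (fun y => f y + θ y * (g y - f y))
      (fderiv ℝ f y + (θ y • (fderiv ℝ g y - fderiv ℝ f y) + (g y - f y) • fderiv ℝ θ y)) y := by
    intro y
    have h1 := (hf.differentiable one_ne_zero y).hasFDerivAt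
    have h2 := (hg1.differentiable one_ne_zero y).hasFDerivAt
    have h3 := (hθC.differentiable two_ne_zero y).hasFDerivAt
    exact h1.add (h3.mul (h2.sub h1))
  refine ⟨fun y => f y + θ y * (g y - f y),
    hf.add ((hθC.of_le (by norm_num)).mul (hg1.sub hf)), fun y hy => ?_, fun y => ?_,
    fun y => ?_, ?_⟩
  · simp [hθ, hy, Real.smoothTransition.zero_of_nonpos]
  · rw [add_sub_cancel_left, abs_mul, abs_of_nonneg (hθ0 y)]
    calc θ y * |g y - f y| ≤ 1 * σ' := by gcongr; exacts [hθ1 y, hgf y]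
      _ ≤ σ := by rw [← hσσ]; nlinarith
  · rw [(hd y).fderiv, add_sub_cancel_left]
    calc _ ≤ ‖θ y • (fderiv ℝ g y - fderiv ℝ f y)‖ + ‖(g y - f y) • fderiv ℝ θ y‖ := norm_add_le _ _
      _ ≤ 1 * σ' + σ' * Θ := by
          rw [norm_smul, norm_smul, Real.norm_eq_abs, Real.norm_eq_abs, abs_of_nonneg (hθ0 y)]
          gcongr
          exacts [hθ1 y, hgd y, hgf y, hθd y]
      _ = σ := by rw [← hσσ]; ring
  · refine hg.contDiffOn.congr fun y hy => ?_
    have hy' : (1 : ℝ) / 8 < ψ y := hy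
    simp only [hθ]
    rw [Real.smoothTransition.one_of_one_le (by linarith)]
    ring

/-- Gluing a set with `C¹` boundary outside a ball with a regular sublevel set inside it. -/
theorem hasC1Boundary_glue {n : ℕ} {A : Set (Eucl n)} (hA : HasC1Boundary A) {x : Eucl n} {s : ℝ}
    {G : Eucl n → ℝ} (hG : ContDiff ℝ 1 G)
    (hGA : ∀ y ∈ ball x (s + 1), y ∉ ball x s → (y ∈ A ↔ G y ≤ 0))
    (hGA0 : ∀ y ∈ ball x (s + 1), y ∉ ball x s → G y = 0 → y ∈ frontier A)
    (hreg : ∀ y ∈ ball x (s + 1), G y = 0 → fderiv ℝ G y ≠ 0) :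
    HasC1Boundary ((A \ ball x s) ∪ {y | y ∈ ball x s ∧ G y ≤ 0}) ∧
      frontier ((A \ ball x s) ∪ {y | y ∈ ball x s ∧ G y ≤ 0}) ⊆
        (frontier A \ ball x s) ∪ {y | y ∈ ball x s ∧ G y = 0} := by
  set D := (A \ ball x s) ∪ {y | y ∈ ball x s ∧ G y ≤ 0} with hD
  have hGc := hG.continuous
  have hfd : Continuous (fderiv ℝ G) := hG.continuous_fderiv one_ne_zero
  have hDG : ∀ y ∈ ball x (s + 1), (y ∈ D ↔ G y ≤ 0) := by
    intro y hy
    by_cases hys : y ∈ ball x s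
    · simp only [hD, mem_union, Set.mem_sdiff, hys, mem_ofPred_eq]; tauto
    · rw [← hGA y hy hys]
      simp only [hD, mem_union, Set.mem_sdiff, hys, mem_ofPred_eq]; tauto
  have hDA : ∀ y ∉ ball x s, (y ∈ D ↔ y ∈ A) := by
    intro y hys
    simp only [hD, mem_union, Set.mem_sdiff, hys, mem_ofPred_eq]; tauto
  have hzero : ∀ z ∈ frontier D, z ∈ ball x (s + 1) → G z = 0 := by
    intro z hz hzb
    have hnb : ball x (s + 1) ∈ 𝓝 z := isOpen_ball.mem_nhds hzb
    by_contra hne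
    rcases lt_or_gt_of_ne hne with h | h
    · refine hz.2 (mem_interior_iff_mem_nhds.2 ?_)
      filter_upwards [hnb, hGc.continuousAt.eventually_lt_const h] with y hy hy'
      exact (hDG y hy).2 hy'.le
    · have : z ∉ closure D := by
        rw [mem_closure_iff_nhds]
        push Not
        refine ⟨_, inter_mem hnb (hGc.continuousAt.eventually_const_lt h), ?_⟩
        rw [Set.eq_empty_iff_forall_notMem]
        rintro y ⟨⟨hy, hy'⟩, hyD⟩
        exact absurd ((hDG y hy).1 hyD) (not_le.2 hy')
      exact this hz.1
  have houter : ∀ z ∈ frontier D, z ∉ ball x (s + 1) → z ∈ frontier A ∧ z ∈ (closedBall x s)ᶜ := by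
    intro z hz hzb
    have hzc : z ∈ (closedBall x s)ᶜ := by
      rw [mem_compl_iff, mem_closedBall]
      rw [mem_ball] at hzb
      linarith
    refine ⟨?_, hzc⟩
    have hnb : (closedBall x s)ᶜ ∈ 𝓝 z := isClosed_closedBall.isOpen_compl.mem_nhds hzc
    have hiff : ∀ y ∈ (closedBall x s)ᶜ, (y ∈ D ↔ y ∈ A) := fun y hy =>
      hDA y fun h => hy (ball_subset_closedBall h)
    refine ⟨?_, fun hint => hz.2 ?_⟩
    · rw [mem_closure_iff_nhds]
      intro V hV
      obtain ⟨y, ⟨hyV, hyc⟩, hyD⟩ := mem_closure_iff_nhds.1 hz.1 _ (inter_mem hV hnb)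
      exact ⟨y, hyV, (hiff y hyc).1 hyD⟩
    · rw [mem_interior_iff_mem_nhds] at hint ⊢
      filter_upwards [hint, hnb] with y hy hyc using (hiff y hyc).2 hy
  refine ⟨fun z hz => ?_, fun z hz => ?_⟩
  · by_cases hzb : z ∈ ball x (s + 1)
    · have hz0 := hzero z hz hzb
      refine ⟨ball x (s + 1) ∩ {y | fderiv ℝ G y ≠ 0}, G,
        isOpen_ball.inter (isOpen_ne_fun hfd continuous_const), ⟨hzb, hreg z hzb hz0⟩, hG,
        fun y hy => hy.2, ?_⟩
      ext y
      simp only [mem_inter_iff, mem_ofPred_eq]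
      constructor
      · rintro ⟨hy, hyb⟩; exact ⟨hyb, (hDG y hyb.1).1 hy⟩
      · rintro ⟨hyb, hy⟩; exact ⟨(hDG y hyb.1).2 hy, hyb⟩
    · obtain ⟨hzA, hzc⟩ := houter z hz hzb
      obtain ⟨U, f, hU, hzU, hf, hd, hAU⟩ := hA z hzA
      refine ⟨U ∩ (closedBall x s)ᶜ, f, hU.inter isClosed_closedBall.isOpen_compl, ⟨hzU, hzc⟩, hf,
        fun y hy => hd y hy.1, ?_⟩
      ext y
      have h1 : y ∈ A ∩ U ↔ y ∈ {y | y ∈ U ∧ f y ≤ 0} := by rw [hAU]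
      simp only [mem_inter_iff, mem_ofPred_eq] at h1 ⊢
      constructor
      · rintro ⟨hy, hyU, hyc⟩
        exact ⟨⟨hyU, hyc⟩, (h1.1 ⟨(hDA y fun h => hyc (ball_subset_closedBall h)).1 hy, hyU⟩).2⟩
      · rintro ⟨⟨hyU, hyc⟩, hy⟩
        exact ⟨(hDA y fun h => hyc (ball_subset_closedBall h)).2 (h1.2 ⟨hyU, hy⟩).1, hyU, hyc⟩
  · by_cases hzb : z ∈ ball x (s + 1)
    · have hz0 := hzero z hz hzb
      by_cases hzs : z ∈ ball x s
      · exact Or.inr ⟨hzs, hz0⟩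
      · exact Or.inl ⟨hGA0 z hzb hzs hz0, hzs⟩
    · obtain ⟨hzA, hzc⟩ := houter z hz hzb
      exact Or.inl ⟨hzA, fun h => hzc (ball_subset_closedBall h)⟩

theorem volume_near_zero_set_le {n : ℕ} {f : Eucl n → ℝ} (hf : Differentiable ℝ f) {c ρ τ : ℝ}
    (hτ : 0 < τ) (hτρ : τ < ρ) {S T : Set (Eucl n)} (hy : ∀ y ∈ S, |f y| ≤ c * τ)
    (h : ∀ y ∈ S, ∃ (i : Fin n) (σ : ℝ), |σ| = 1 ∧
      ∀ z ∈ ball y ρ, c ≤ σ * fderiv ℝ f z (EuclideanSpace.single i 1))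
    (hT : ∀ y ∈ S, ∀ z, dist z y ≤ τ → f z = 0 → z ∈ T) :
    volume S ≤ n * (ENNReal.ofReal (3 * τ) * μH[(n : ℝ) - 1] T) := by
  have hsub : S ⊆ ⋃ i : Fin n,
      {y | ∃ t ∈ Icc (-τ) τ, y + t • EuclideanSpace.single i (1 : ℝ) ∈ T} := by
    intro y hyS
    obtain ⟨i, σ, hσ, hst⟩ := h y hyS
    obtain ⟨t, ht, h0⟩ := exists_zero_on_line hf (e := EuclideanSpace.single i (1 : ℝ)) (by simp) hσ
      hτ.le hτρ hst (hy y hyS)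
    refine mem_iUnion.2 ⟨i, t, ht, hT y hyS _ ?_ h0⟩
    rw [dist_eq_norm, add_sub_cancel_left, norm_smul]
    simpa using abs_le.2 ht
  calc volume S ≤ volume (⋃ i : Fin n, _) := measure_mono hsub
    _ ≤ ∑ i : Fin n, volume {y | ∃ t ∈ Icc (-τ) τ, y + t • EuclideanSpace.single i (1 : ℝ) ∈ T} :=
        measure_iUnion_fintype_le _ _
    _ ≤ ∑ _i : Fin n, ENNReal.ofReal (3 * τ) * μH[(n : ℝ) - 1] T :=
        Finset.sum_le_sum fun i _ => volume_sweep_le T i hτ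
    _ = _ := by simp

theorem hausdorff_near_zero_set_le {n : ℕ} {f F : Eucl n → ℝ} (hf : Differentiable ℝ f)
    (hF : Differentiable ℝ F) {c ρ τ : ℝ} {L : ℝ≥0} (hc : 0 < c) (hτ : 0 < τ)
    (hτρ : τ < ρ / 2) {Γ T : Set (Eucl n)} (hΓ0 : ∀ y ∈ Γ, F y = 0)
    (hy : ∀ y ∈ Γ, |f y| ≤ c * τ)
    (h : ∀ y ∈ Γ, ∃ (i : Fin n) (σ : ℝ), |σ| = 1 ∧
      ∀ z ∈ ball y ρ, c ≤ σ * fderiv ℝ f z (EuclideanSpace.single i 1))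
    (hL : ∀ y, ‖fderiv ℝ f y‖ ≤ L)
    (hFf : ∀ y ∈ Γ, ∀ z ∈ ball y ρ, ‖fderiv ℝ F z - fderiv ℝ f z‖ ≤ c / 2)
    (hT : ∀ y ∈ Γ, ∀ z, dist z y ≤ τ → f z = 0 → z ∈ T) (Z : Finset (Eucl n))
    (hZ : Γ ⊆ ⋃ z ∈ Z, ball z (ρ / 8)) :
    μH[(n : ℝ) - 1] Γ ≤ Z.card * (((1 + (L + Real.toNNReal (c / 2)) *
      (Real.toNNReal (c / 2))⁻¹ : ℝ≥0) : ℝ≥0∞) ^ ((n : ℝ) - 1) * μH[(n : ℝ) - 1] T) := by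
  have key : ∀ z ∈ Z, μH[(n : ℝ) - 1] (Γ ∩ ball z (ρ / 8)) ≤
      (((1 + (L + Real.toNNReal (c / 2)) * (Real.toNNReal (c / 2))⁻¹ : ℝ≥0) : ℝ≥0∞) ^
        ((n : ℝ) - 1) * μH[(n : ℝ) - 1] T) := by
    intro z _
    rcases (Γ ∩ ball z (ρ / 8)).eq_empty_or_nonempty with he | ⟨y₀, hy₀, hy₀z⟩
    · rw [he]; simp
    obtain ⟨i, σ, hσ, hst⟩ := h y₀ hy₀
    rw [mem_ball] at hy₀z
    have hsub : ball z (4 * (ρ / 8)) ⊆ ball y₀ ρ := by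
      refine ball_subset_ball' ?_
      rw [dist_comm]; linarith
    refine hausdorff_graph_le hF i (half_pos hc) hσ (fun y hyz => ?_) (fun y hyz => ?_)
      inter_subset_right (fun y hyΓ => hΓ0 y hyΓ.1) fun y hyΓ => ?_
    · have h1 := hFf y₀ hy₀ y (hsub hyz)
      have h2 : fderiv ℝ F y = fderiv ℝ f y + (fderiv ℝ F y - fderiv ℝ f y) := by abel
      rw [h2, NNReal.coe_add, Real.coe_toNNReal _ (half_pos hc).le]
      exact (norm_add_le _ _).trans (add_le_add (hL y) h1)
    · have h1 := hFf y₀ hy₀ y (hsub hyz)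
      have h2 := hst y (hsub hyz)
      have h3 : |σ * ((fderiv ℝ F y - fderiv ℝ f y) (EuclideanSpace.single i (1 : ℝ)))| ≤ c / 2 := by
        rw [abs_mul, hσ, one_mul, ← Real.norm_eq_abs]
        refine (ContinuousLinearMap.le_opNorm _ _).trans ?_
        simpa using h1
      have h4 := (abs_le.1 h3).1
      rw [sub_apply] at h4
      linarith
    · have hyz := hyΓ.2
      rw [mem_ball] at hyz
      have hsub2 : ball y (ρ / 2) ⊆ ball y₀ ρ := by
        refine ball_subset_ball' ?_
        linarith [dist_triangle_right y y₀ z]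
      obtain ⟨t, ht, h0⟩ := exists_zero_on_line hf (e := EuclideanSpace.single i (1 : ℝ)) (by simp)
        hσ hτ.le hτρ (fun z hz => hst z (hsub2 hz)) (hy y hyΓ.1)
      refine ⟨t, hT y hyΓ.1 _ ?_ h0⟩
      rw [dist_eq_norm, add_sub_cancel_left, norm_smul]
      simpa using abs_le.2 ht
  calc μH[(n : ℝ) - 1] Γ ≤ μH[(n : ℝ) - 1] (⋃ z ∈ Z, Γ ∩ ball z (ρ / 8)) := by
        refine measure_mono fun y hyΓ => ?_
        obtain ⟨z, hz, hyz⟩ := mem_iUnion₂.1 (hZ hyΓ)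
        exact mem_iUnion₂.2 ⟨z, hz, hyΓ, hyz⟩
    _ ≤ ∑ z ∈ Z, μH[(n : ℝ) - 1] (Γ ∩ ball z (ρ / 8)) := measure_biUnion_finset_le _ _
    _ ≤ ∑ _z ∈ Z, _ := Finset.sum_le_sum key
    _ = _ := by rw [Finset.sum_const, nsmul_eq_mul]

/-- Choosing a value in `(1, 2)`, outside a null set, with small slices of two functions. -/
theorem exists_good_slice {n : ℕ} (hn : 1 ≤ n) {v w : Eucl n → ℝ} {S T : Set (Eucl n)} {L M : ℝ≥0}
    (hv : LipschitzOnWith L v S) (hw : LipschitzOnWith M w T) (hS : volume S ≠ ⊤)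
    (hT : volume T ≠ ⊤) {P : ℝ → Prop} (hP : ∀ᵐ t, P t) :
    ∃ t ∈ Ioo (1 : ℝ) 2, P t ∧ μH[(n : ℝ) - 1] (S ∩ v ⁻¹' {t}) + μH[(n : ℝ) - 1] (T ∩ w ⁻¹' {t}) ≤
      L * (hausConst n * volume S) + M * (hausConst n * volume T) := by
  obtain ⟨g, hg, hgs, hgi⟩ := exists_slice_bound_volume hn hv hS
  obtain ⟨k, hk, hks, hki⟩ := exists_slice_bound_volume hn hw hT
  have : IsProbabilityMeasure (volume.restrict (Ioo (1 : ℝ) 2)) := ⟨by simp; norm_num⟩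
  have h1 : ∀ᵐ t ∂(volume.restrict (Ioo (1 : ℝ) 2)), P t ∧ t ∈ Ioo (1 : ℝ) 2 :=
    (ae_restrict_of_ae hP).and (ae_restrict_mem measurableSet_Ioo)
  obtain ⟨t, ht, hle⟩ := exists_notMem_null_le_lintegral (hg.add hk).aemeasurable
    (ae_iff.1 h1)
  have ht' : P t ∧ t ∈ Ioo (1 : ℝ) 2 := by
    by_contra hc
    exact ht hc
  refine ⟨t, ht'.2, ht'.1, ?_⟩
  calc _ ≤ g t + k t := add_le_add (hgs t) (hks t)
    _ ≤ ∫⁻ t in Ioo (1 : ℝ) 2, (g t + k t) := hle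
    _ ≤ ∫⁻ t, (g t + k t) := setLIntegral_le_lintegral _ _
    _ = (∫⁻ t, g t) + ∫⁻ t, k t := lintegral_add_left hg _
    _ ≤ _ := add_le_add hgi hki

theorem lipschitzOnWith_div_sub {n : ℕ} {q ψ : Eucl n → ℝ} {S : Set (Eucl n)}
    {p : Eucl n →L[ℝ] ℝ} {a b M : ℝ} (hq : ∀ y ∈ S, ∀ z ∈ S, |q y - q z| ≤ a * dist y z)
    (hψ : ∀ y ∈ S, ∀ z ∈ S, |ψ y - ψ z| ≤ b * dist y z) (hq1 : ∀ y ∈ S, |q y| ≤ 1)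
    (hψ1 : ∀ y ∈ S, 1 / 6 ≤ ψ y) (hp : ‖p‖ ≤ 1) (hM : 6 * a + 36 * b + 1 ≤ M) :
    LipschitzOnWith (Real.toNNReal M) (fun y => q y / ψ y - p y) S := by
  refine LipschitzOnWith.of_dist_le_mul fun y hy z hz => ?_
  have hd := dist_nonneg (x := y) (y := z)
  have h1 : |p y - p z| ≤ dist y z := by
    rw [← map_sub, dist_eq_norm, ← Real.norm_eq_abs]
    exact (p.le_opNorm _).trans (mul_le_of_le_one_left (norm_nonneg _) hp)
  have hy0 := hψ1 y hy
  have hz0 := hψ1 z hz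
  have hyi : (ψ y)⁻¹ ≤ 6 := by
    rw [inv_le_comm₀ (by linarith) (by norm_num)]; linarith
  have hzi : (ψ z)⁻¹ ≤ 6 := by
    rw [inv_le_comm₀ (by linarith) (by norm_num)]; linarith
  have hyi0 : 0 ≤ (ψ y)⁻¹ := inv_nonneg.2 (by linarith)
  have hzi0 : 0 ≤ (ψ z)⁻¹ := inv_nonneg.2 (by linarith)
  have h2 : q y / ψ y - q z / ψ z =
      (ψ y)⁻¹ * (q y - q z) + q z * ((ψ y)⁻¹ * (ψ z)⁻¹) * (ψ z - ψ y) := by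
    have : ψ y ≠ 0 := by linarith
    have : ψ z ≠ 0 := by linarith
    field_simp
    ring
  have hq' := hq y hy z hz
  have hψ' := hψ z hz y hy
  rw [dist_comm z y] at hψ'
  have h3 : |q y / ψ y - q z / ψ z| ≤ 6 * (a * dist y z) + 1 * (6 * 6) * (b * dist y z) := by
    rw [h2]
    refine (abs_add_le _ _).trans (add_le_add ?_ ?_)
    · rw [abs_mul, abs_of_nonneg hyi0]
      exact mul_le_mul hyi hq' (abs_nonneg _) (by norm_num)
    · rw [abs_mul, abs_mul, abs_of_nonneg (mul_nonneg hyi0 hzi0)]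
      refine mul_le_mul ?_ hψ' (abs_nonneg _) (by norm_num)
      exact mul_le_mul (hq1 z hz) (mul_le_mul hyi hzi hzi0 (by norm_num))
        (mul_nonneg hyi0 hzi0) (by norm_num)
  rw [Real.dist_eq, show q y / ψ y - p y - (q z / ψ z - p z) =
    (q y / ψ y - q z / ψ z) - (p y - p z) by ring]
  refine (abs_sub _ _).trans ((add_le_add h3 h1).trans ?_)
  calc _ = (6 * a + 36 * b + 1) * dist y z := by ring
    _ ≤ _ := by gcongr; exact hM.trans (Real.le_coe_toNNReal M)

/-- The function whose sublevel set cuts off a ball: where the cutoff `ψ` vanishes it has the sign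
of `f`, and where `ψ` is large it is positive. -/
def cutFun {n : ℕ} (κ : ℝ → ℝ) (f ψ : Eucl n → ℝ) (ε t : ℝ) (p : Eucl n →L[ℝ] ℝ) (y : Eucl n) : ℝ :=
  -κ (-f y / ε) + ψ y * (t + p y)

theorem cutFun_eq_zero {n : ℕ} {κ : ℝ → ℝ} {f ψ : Eucl n → ℝ} {ε t : ℝ} {p : Eucl n →L[ℝ] ℝ}
    (hκ : ∀ u ≤ 1 / 2, κ u = u) (hκ2 : ∀ u, 1 / 2 ≤ u → 1 / 2 ≤ κ u) (ht : t ∈ Ioo (1 : ℝ) 2)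
    {y : Eucl n} (hψ : 0 ≤ ψ y) (hp : |p y| ≤ 1 / 2) (h0 : cutFun κ f ψ ε t p y = 0) :
    (-f y / ε < 1 / 2 ∧ 0 ≤ -f y / ε ∧ f y / ε + ψ y * (t + p y) = 0) ∨
      (1 / 2 ≤ -f y / ε ∧ 1 / 6 ≤ ψ y ∧ κ (-f y / ε) / ψ y - p y = t) := by
  have hp' := abs_le.1 hp
  simp only [cutFun] at h0
  rcases lt_or_ge (-f y / ε) (1 / 2) with h | h
  · rw [hκ _ h.le] at h0
    have : 0 ≤ ψ y * (t + p y) := mul_nonneg hψ (by linarith [ht.1])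
    refine Or.inl ⟨h, by linarith, ?_⟩
    rw [← h0]; ring
  · have h1 := hκ2 _ h
    have h2 : ψ y * (t + p y) ≤ ψ y * 3 := mul_le_mul_of_nonneg_left (by linarith [ht.2]) hψ
    have h3 : 1 / 6 ≤ ψ y := by linarith
    refine Or.inr ⟨h, h3, ?_⟩
    have : ψ y ≠ 0 := by linarith
    rw [sub_eq_iff_eq_add, div_eq_iff this]
    linarith

theorem cutFun_regular {n : ℕ} {κ : ℝ → ℝ} {f ψ : Eucl n → ℝ} {ε t : ℝ} {p : Eucl n →L[ℝ] ℝ}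
    (hκC : ContDiff ℝ 2 κ) (hf : ContDiff ℝ 1 f) (hψC : ContDiff ℝ 2 ψ)
    (hκ : ∀ u ≤ 1 / 2, κ u = u) (hκ2 : ∀ u, 1 / 2 ≤ u → 1 / 2 ≤ κ u) (hε : 0 < ε)
    (ht : t ∈ Ioo (1 : ℝ) 2) (hψ : ∀ y, 0 ≤ ψ y)
    (hv : ∀ y ∈ {y | 1 / 8 < ψ y}, κ (-f y / ε) / ψ y - p y = t →
      fderiv ℝ (fun y => κ (-f y / ε) / ψ y) y ≠ p)
    {y : Eucl n} (hp : |p y| ≤ 1 / 2) (h0 : cutFun κ f ψ ε t p y = 0)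
    (hF : 0 ≤ -f y / ε → -f y / ε < 1 / 2 →
      fderiv ℝ (fun y => f y + ε * (ψ y * (t + p y))) y ≠ 0) :
    fderiv ℝ (cutFun κ f ψ ε t p) y ≠ 0 := by
  have hψd := hψC.differentiable two_ne_zero
  have hfd := hf.differentiable one_ne_zero
  rcases cutFun_eq_zero hκ hκ2 ht (hψ y) hp h0 with ⟨h1, h2, -⟩ | ⟨h1, h2, h3⟩
  · have hev : cutFun κ f ψ ε t p =ᶠ[𝓝 y] fun y => ε⁻¹ * (f y + ε * (ψ y * (t + p y))) := by
      have hc : ContinuousAt (fun y => -f y / ε) y := (hf.continuous.neg.div_const ε).continuousAt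
      filter_upwards [hc.eventually_lt_const h1] with z hz
      simp only [cutFun]
      rw [hκ _ hz.le]
      field_simp
    have hd : DifferentiableAt ℝ (fun y => f y + ε * (ψ y * (t + p y))) y := by fun_prop
    rw [hev.fderiv_eq, fderiv_const_mul hd]
    exact smul_ne_zero (inv_ne_zero hε.ne') (hF h2 h1)
  · have hO : IsOpen {y | 1 / 8 < ψ y} := isOpen_lt continuous_const hψC.continuous
    have hyO : y ∈ {y | 1 / 8 < ψ y} := by
      change 1 / 8 < ψ y
      linarith
    have hvd : DifferentiableAt ℝ (fun y => κ (-f y / ε) / ψ y) y := by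
      have hκd := hκC.differentiable two_ne_zero
      have : ψ y ≠ 0 := by linarith
      have h4 : DifferentiableAt ℝ (fun y => κ (-f y / ε)) y :=
        DifferentiableAt.comp (f := fun y => -f y / ε) y (hκd _) (by fun_prop)
      simp only [div_eq_mul_inv] at h4 ⊢
      exact h4.fun_mul ((hψd y).fun_inv this)
    have hev : cutFun κ f ψ ε t p =ᶠ[𝓝 y]
        fun y => ψ y * (t + p y - κ (-f y / ε) / ψ y) := by
      filter_upwards [hO.mem_nhds hyO] with z hz
      have : ψ z ≠ 0 := by
        have : 1 / 8 < ψ z := hz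
        linarith
      simp only [cutFun]
      field_simp
      ring
    have hd : HasFDerivAt (fun y => ψ y * (t + p y - κ (-f y / ε) / ψ y))
        (ψ y • (p - fderiv ℝ (fun y => κ (-f y / ε) / ψ y) y) +
          (t + p y - κ (-f y / ε) / ψ y) • fderiv ℝ ψ y) y :=
      (hψd y).hasFDerivAt.mul ((p.hasFDerivAt.const_add t).sub hvd.hasFDerivAt)
    rw [hev.fderiv_eq, hd.fderiv, show t + p y - κ (-f y / ε) / ψ y = 0 by linarith, zero_smul,
      add_zero]
    refine smul_ne_zero (by linarith) fun hz => ?_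
    exact hv y hyO h3 (sub_eq_zero.1 hz).symm

theorem contDiff_cutFun {n : ℕ} {κ : ℝ → ℝ} {f ψ : Eucl n → ℝ} {ε t : ℝ} {p : Eucl n →L[ℝ] ℝ}
    (hκC : ContDiff ℝ 2 κ) (hf : ContDiff ℝ 1 f) (hψC : ContDiff ℝ 2 ψ) :
    ContDiff ℝ 1 (cutFun κ f ψ ε t p) :=
  (((hκC.of_le (by norm_num)).comp (hf.neg.div_const ε)).neg).add
    ((hψC.of_le (by norm_num)).mul (contDiff_const.add p.contDiff))

/-- Removing the ball `ball x s` from a set with `C¹` boundary, up to an error in a thin annulus. -/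
theorem exists_cut_step {n : ℕ} (hn : 1 ≤ n) {A : Set (Eucl n)} (hA : HasC1Boundary A) (x : Eucl n)
    (s : ℝ) : ∃ C : ℝ≥0, ∀ δ, 0 < δ → δ < s → δ ≤ 1 → ∃ D, HasC1Boundary D ∧
      D ∆ (A \ ball x s) ⊆ ball x s \ ball x (s - δ) ∧
      μH[(n : ℝ) - 1] (frontier D) ≤ μH[(n : ℝ) - 1] (frontier A \ ball x s) +
        ENNReal.ofReal ((36 * cutoffConst + 1) / δ) *
          (hausConst n * volume (A ∩ (ball x s \ ball x (s - δ)))) +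
        C * μH[(n : ℝ) - 1] (frontier A ∩ {y | s - 2 * δ ≤ dist y x ∧ dist y x ≤ s + δ}) := by
  obtain ⟨f, hf, hfc, hfA⟩ := hA.exists_defining x (s + 2)
  obtain ⟨c, hc, a, ha, ρ', hρ', hst'⟩ := exists_steep hf hfc fun y hy => (hfA y hy).2
  set ρ := min ρ' 1 with hρdef
  have hρ : 0 < ρ := lt_min hρ' one_pos
  have hρ1 : ρ ≤ 1 := min_le_right _ _
  have hst : ∀ y ∈ closedBall x (s + 2), |f y| ≤ a → ∃ (i : Fin n) (σ : ℝ), |σ| = 1 ∧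
      ∀ z ∈ ball y ρ, c ≤ σ * fderiv ℝ f z (EuclideanSpace.single i 1) := by
    intro y hy hya
    obtain ⟨i, σ, hσ, h⟩ := hst' y hy hya
    exact ⟨i, σ, hσ, fun z hz => h z (ball_subset_ball (min_le_left _ _) hz)⟩
  have hfd : Differentiable ℝ f := hf.differentiable one_ne_zero
  obtain ⟨L, hL⟩ : ∃ L : ℝ≥0, ∀ y, ‖fderiv ℝ f y‖ ≤ L := by
    obtain ⟨L, hL⟩ := (hf.continuous_fderiv one_ne_zero).bounded_above_of_compact_support
      (hfc.fderiv ℝ)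
    exact ⟨L.toNNReal, fun y => (hL y).trans (Real.le_coe_toNNReal L)⟩
  obtain ⟨Z, hZ⟩ : ∃ Z : Finset (Eucl n), closedBall x s ⊆ ⋃ z ∈ Z, ball z (ρ / 8) := by
    obtain ⟨Z, -, hZf, hZ⟩ := (isCompact_closedBall x s).finite_cover_balls (e := ρ / 8) (by positivity)
    exact ⟨hZf.toFinset, by simpa using hZ⟩
  obtain ⟨κ, K, hκC, hκ, hκ2, hκ1, hκ3, hκK⟩ := exists_truncation
  set N : ℝ := 6 * (K * (L + c)) + 37 with hN
  have hN0 : 0 ≤ N := by positivity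
  refine ⟨Z.card * (1 + (L + Real.toNNReal (c / 2)) * (Real.toNNReal (c / 2))⁻¹) ^ ((n : ℝ) - 1) +
    hausConst n * (n * Real.toNNReal (6 * N / c)), fun δ hδ hδs hδ1 => ?_⟩
  have hs : 0 < s := hδ.trans hδs
  have hCψ := cutoffConst_pos
  obtain ⟨ψ, hψC, hψ0, hψ3, hψout, hψin, hψd⟩ := exists_cutoff.choose_spec.2 n x s δ hδ hδs
  change ∀ y, ‖fderiv ℝ ψ y‖ ≤ cutoffConst / δ at hψd
  obtain ⟨ε, hε, hεa, hερ, hεδ, hεd, hεC, hε1⟩ : ∃ ε > 0, 2 * ε ≤ a ∧ 2 * ε / c < ρ / 2 ∧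
      2 * ε / c ≤ δ ∧ ε * (3 * (cutoffConst / δ) + 3) ≤ c / 4 ∧ ε * cutoffConst ≤ δ ∧ ε ≤ 1 := by
    have h1 : 0 < 3 * (cutoffConst / δ) + 3 := by positivity
    set ε := min (a / 2) (min (c * ρ / 8) (min (c * δ / 2)
      (min (c / 4 / (3 * (cutoffConst / δ) + 3)) (min (δ / cutoffConst) 1)))) with hε
    have e1 : ε ≤ a / 2 := min_le_left _ _
    have e2' : ε ≤ _ := min_le_right (a / 2) _
    have e2 : ε ≤ c * ρ / 8 := e2'.trans (min_le_left _ _)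
    have e3' := e2'.trans (min_le_right _ _)
    have e3 : ε ≤ c * δ / 2 := e3'.trans (min_le_left _ _)
    have e4' := e3'.trans (min_le_right _ _)
    have e4 : ε ≤ c / 4 / (3 * (cutoffConst / δ) + 3) := e4'.trans (min_le_left _ _)
    have e5' := e4'.trans (min_le_right _ _)
    have e5 : ε ≤ δ / cutoffConst := e5'.trans (min_le_left _ _)
    have e6 : ε ≤ 1 := e5'.trans (min_le_right _ _)
    refine ⟨ε, ?_, by linarith, ?_, ?_, ?_, ?_, e6⟩
    · simp only [hε, lt_min_iff]
      exact ⟨by positivity, by positivity, by positivity, by positivity, by positivity, one_pos⟩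
    · rw [div_lt_iff₀ hc]; nlinarith [mul_pos hc hρ]
    · rw [div_le_iff₀ hc]; linarith
    · rwa [le_div_iff₀ h1] at e4
    · rwa [le_div_iff₀ hCψ] at e5
  obtain ⟨g, hg, hgf, hgε, hgd, hg2⟩ := exists_blend hf hfc hψC hψd
    (lt_min (half_pos hε) (by positivity : 0 < c / 4))
  have hgε' : ∀ y, |g y - f y| ≤ ε / 2 := fun y => (hgε y).trans (min_le_left _ _)
  have hgd' : ∀ y, ‖fderiv ℝ g y - fderiv ℝ f y‖ ≤ c / 4 := fun y => (hgd y).trans (min_le_right _ _)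
  have hgdiff : Differentiable ℝ g := hg.differentiable one_ne_zero
  have hψdiff : Differentiable ℝ ψ := hψC.differentiable two_ne_zero
  have hO : IsOpen {y | 1 / 8 < ψ y} := isOpen_lt continuous_const hψC.continuous
  have hvC : ContDiffOn ℝ 2 (fun y => κ (-g y / ε) / ψ y) {y | 1 / 8 < ψ y} := by
    have h1 : ContDiffOn ℝ 2 (fun y => κ (-g y / ε)) {y | 1 / 8 < ψ y} :=
      hκC.comp_contDiffOn (hg2.neg.div_const ε)
    refine h1.div hψC.contDiffOn fun y hy => ?_
    have : 1 / 8 < ψ y := hy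
    linarith
  obtain ⟨p, hp1, hpb, hpt⟩ : ∃ p : Eucl n →L[ℝ] ℝ, ‖p‖ ≤ 1 ∧ (∀ y ∈ ball x (s + 1), |p y| ≤ 1 / 2) ∧
      ∀ᵐ t : ℝ, ∀ y ∈ {y | 1 / 8 < ψ y}, κ (-g y / ε) / ψ y - p y = t →
        fderiv ℝ (fun y => κ (-g y / ε) / ψ y) y ≠ p := by
    have hD := Measure.dense_of_ae (ae_ae_regular_value hO hvC)
    have hr : 0 < 1 / (2 * (‖x‖ + s + 1)) := by positivity
    obtain ⟨p, hp, hpr⟩ := hD.exists_dist_lt 0 (lt_min one_pos hr)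
    rw [dist_zero_left, lt_min_iff] at hpr
    refine ⟨p, hpr.1.le, fun y hy => ?_, hp⟩
    rw [mem_ball, dist_eq_norm] at hy
    have h1 : ‖y‖ ≤ ‖x‖ + s + 1 := by
      have := norm_add_le (y - x) x
      rw [sub_add_cancel] at this
      linarith
    calc |p y| ≤ ‖p‖ * ‖y‖ := by rw [← Real.norm_eq_abs]; exact p.le_opNorm y
      _ ≤ 1 / (2 * (‖x‖ + s + 1)) * (‖x‖ + s + 1) := by gcongr; exact hpr.2.le
      _ = 1 / 2 := by field_simp
  set R := ball x s \ ball x (s - δ) with hR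
  set T := frontier A ∩ {y | s - 2 * δ ≤ dist y x ∧ dist y x ≤ s + δ} with hT
  have hbs : ball x s ⊆ ball x (s + 1) := ball_subset_ball (by linarith)
  have hcb : ∀ y ∈ ball x (s + 1), y ∈ closedBall x (s + 2) := fun y hy =>
    ball_subset_closedBall (ball_subset_ball (by linarith) hy)
  have hvolR : volume R ≠ ⊤ := ((measure_mono sdiff_subset).trans_lt measure_ball_lt_top).ne
  -- the piece where `κ` is not the identity
  set S := {y | y ∈ R ∧ 1 / 6 ≤ ψ y ∧ -g y / ε ∈ Icc (1 / 2 : ℝ) 1} with hS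
  set S' := {y | y ∈ A ∧ y ∈ R ∧ 1 / 6 ≤ ψ y} with hS'
  have hψLip : ∀ y z, |ψ y - ψ z| ≤ cutoffConst / δ * dist y z := fun y z => by
    rw [dist_eq_norm, ← Real.norm_eq_abs]
    exact convex_univ.norm_image_sub_le_of_norm_fderiv_le (fun w _ => hψdiff w)
      (fun w _ => hψd w) (mem_univ z) (mem_univ y)
  have hgLip : ∀ y z, |g y - g z| ≤ (L + c) * dist y z := fun y z => by
    rw [dist_eq_norm, ← Real.norm_eq_abs]
    refine convex_univ.norm_image_sub_le_of_norm_fderiv_le (fun w _ => hgdiff w)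
      (fun w _ => ?_) (mem_univ z) (mem_univ y)
    have h2 : fderiv ℝ g w = fderiv ℝ f w + (fderiv ℝ g w - fderiv ℝ f w) := by abel
    rw [h2]
    exact (norm_add_le _ _).trans (add_le_add (hL w) ((hgd' w).trans (by linarith)))
  have hv1 : LipschitzOnWith (Real.toNNReal (N / ε)) (fun y => κ (-g y / ε) / ψ y - p y) S := by
    refine lipschitzOnWith_div_sub (a := K * (L + c) / ε) (fun y hy z hz => ?_)
      (fun y _ z _ => hψLip y z) (fun y hy => ?_) (fun y hy => hy.2.1) hp1 ?_
    · have h01 : Icc (1 / 2 : ℝ) 1 ⊆ Icc 0 1 := Icc_subset_Icc (by norm_num) le_rfl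
      have h1 := hκK.dist_le_mul _ (h01 hy.2.2) _ (h01 hz.2.2)
      rw [Real.dist_eq, Real.dist_eq] at h1
      refine h1.trans ?_
      have h2 : |-g y / ε - -g z / ε| ≤ (L + c) * dist y z / ε := by
        rw [show -g y / ε - -g z / ε = -((g y - g z) / ε) by ring, abs_neg, abs_div, abs_of_pos hε]
        gcongr
        exact hgLip y z
      calc _ ≤ K * ((L + c) * dist y z / ε) := by gcongr
        _ = _ := by ring
    · have h1 := hκ2 _ hy.2.2.1
      rw [abs_of_nonneg (by linarith)]
      exact hκ1 _
    · have h1 : cutoffConst / δ ≤ 1 / ε := by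
        rw [div_le_div_iff₀ hδ hε]; linarith
      have h2 : 1 ≤ 1 / ε := by rw [le_div_iff₀ hε]; linarith
      calc _ ≤ 6 * (K * (L + c) / ε) + 36 * (1 / ε) + 1 / ε := by gcongr
        _ = N / ε := by rw [hN]; ring
  have hv2 : LipschitzOnWith (Real.toNNReal ((36 * cutoffConst + 1) / δ))
      (fun y => 1 / ψ y - p y) S' := by
    refine lipschitzOnWith_div_sub (q := fun _ => 1) (a := 0) (fun y hy z hz => ?_)
      (fun y _ z _ => hψLip y z) (fun y hy => ?_) (fun y hy => hy.2.2) hp1 ?_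
    · simp
    · simp
    · have h2 : 1 ≤ 1 / δ := by rw [le_div_iff₀ hδ]; linarith
      calc _ ≤ 6 * 0 + 36 * (cutoffConst / δ) + 1 / δ := by gcongr
        _ = _ := by ring
  have hSR : S ⊆ R := fun y hy => hy.1
  have hS'R : S' ⊆ A ∩ R := fun y hy => ⟨hy.1, hy.2.1⟩
  obtain ⟨t, ht, hreg, hslice⟩ := exists_good_slice hn hv1 hv2
    ((measure_mono hSR).trans_lt hvolR.lt_top).ne
    ((measure_mono (hS'R.trans inter_subset_right)).trans_lt hvolR.lt_top).ne hpt
  have hsteep : ∀ y ∈ ball x (s + 1), |g y| ≤ ε → ∃ (i : Fin n) (σ : ℝ), |σ| = 1 ∧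
      ∀ z ∈ ball y ρ, c ≤ σ * fderiv ℝ f z (EuclideanSpace.single i 1) := by
    intro y hy hgy
    refine hst y (hcb y hy) ?_
    have h1 := abs_sub_abs_le_abs_sub (f y) (g y)
    rw [abs_sub_comm] at h1
    linarith [hgε' y]
  have hfτ : ∀ y, |g y| ≤ ε → |f y| ≤ c * (2 * ε / c) := by
    intro y hgy
    rw [mul_div_cancel₀ _ hc.ne']
    have h1 := abs_sub_abs_le_abs_sub (f y) (g y)
    rw [abs_sub_comm] at h1
    linarith [hgε' y]
  have hTz : ∀ y ∈ R, ∀ z, dist z y ≤ 2 * ε / c → f z = 0 → z ∈ T := by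
    intro y hy z hzy hfz
    have hd := hzy.trans hεδ
    have h1 : dist y x < s := hy.1
    have h2 : s - δ ≤ dist y x := not_lt.1 hy.2
    have h3 : dist z x ≤ s + δ := by linarith [dist_triangle z y x]
    have h4 : s - 2 * δ ≤ dist z x := by linarith [dist_triangle_left y x z, dist_comm z y]
    have hz : z ∈ ball x (s + 2) := by rw [mem_ball]; linarith
    have hzc := ball_subset_closedBall hz
    refine ⟨⟨subset_closure ((hfA z hzc).1.2 hfz.le), fun hint => ?_⟩, h4, h3⟩
    obtain ⟨w, hw, hw0⟩ := mem_closure_pos_of_fderiv_ne_zero (hfd z) hfz ((hfA z hzc).2 hfz)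
      (inter_mem (mem_interior_iff_mem_nhds.1 hint) (isOpen_ball.mem_nhds hz))
    exact absurd ((hfA w (ball_subset_closedBall hw.2)).1.1 hw.1) (not_le.2 hw0)
  set F : Eucl n → ℝ := fun y => g y + ε * (ψ y * (t + p y)) with hF
  have hFd : ∀ y, HasFDerivAt F (fderiv ℝ g y + ε • (ψ y • (p : Eucl n →L[ℝ] ℝ) +
      (t + p y) • fderiv ℝ ψ y)) y := fun y =>
    (hgdiff y).hasFDerivAt.add
      (((hψdiff y).hasFDerivAt.mul (p.hasFDerivAt.const_add t)).const_mul ε)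
  have hFf : ∀ y ∈ ball x (s + 1), ‖fderiv ℝ F y - fderiv ℝ f y‖ ≤ c / 2 := by
    intro y hy
    have hpy := abs_le.1 (hpb y hy)
    have h3 : |t + p y| ≤ 3 := abs_le.2 ⟨by linarith [ht.1], by linarith [ht.2]⟩
    have h1 : ‖ε • (ψ y • (p : Eucl n →L[ℝ] ℝ) + (t + p y) • fderiv ℝ ψ y)‖ ≤ c / 4 := by
      rw [norm_smul, Real.norm_eq_abs, abs_of_pos hε]
      refine (mul_le_mul_of_nonneg_left ((norm_add_le _ _).trans ?_) hε.le).trans hεd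
      rw [norm_smul, norm_smul, Real.norm_eq_abs, Real.norm_eq_abs, abs_of_nonneg (hψ0 y), add_comm]
      have h4 : ψ y * ‖p‖ ≤ 3 * 1 := mul_le_mul (hψ3 y) hp1 (norm_nonneg _) (by norm_num)
      have h5 : |t + p y| * ‖fderiv ℝ ψ y‖ ≤ 3 * (cutoffConst / δ) :=
        mul_le_mul h3 (hψd y) (norm_nonneg _) (by norm_num)
      linarith
    rw [(hFd y).fderiv, add_sub_right_comm]
    linarith [norm_add_le (fderiv ℝ g y - fderiv ℝ f y)
      (ε • (ψ y • (p : Eucl n →L[ℝ] ℝ) + (t + p y) • fderiv ℝ ψ y)), hgd' y]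
  have hgu : ∀ y, 0 ≤ -g y / ε → -g y / ε ≤ 1 → |g y| ≤ ε := by
    intro y h0 h1
    rw [le_div_iff₀ hε] at h0
    rw [div_le_iff₀ hε] at h1
    exact abs_le.2 ⟨by linarith, by linarith⟩
  set G := cutFun κ g ψ ε t p with hG
  have hGreg : ∀ y ∈ ball x (s + 1), G y = 0 → fderiv ℝ G y ≠ 0 := by
    intro y hy h0
    refine cutFun_regular hκC hg hψC hκ hκ2 hε ht hψ0 hreg (hpb y hy) h0 fun h1 h2 hz => ?_
    obtain ⟨i, σ, hσ, hsty⟩ := hsteep y hy (hgu y h1 (by linarith))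
    have h3 := hsty y (mem_ball_self hρ)
    have h4 := hFf y hy
    rw [show fderiv ℝ F y = 0 from hz, zero_sub, norm_neg] at h4
    have h5 : |σ * fderiv ℝ f y (EuclideanSpace.single i (1 : ℝ))| ≤ c / 2 := by
      rw [abs_mul, hσ, one_mul, ← Real.norm_eq_abs]
      refine (ContinuousLinearMap.le_opNorm _ _).trans ?_
      simpa using h4
    linarith [le_abs_self (σ * fderiv ℝ f y (EuclideanSpace.single i (1 : ℝ)))]
  have hκsign : ∀ y, y ∉ ball x s → (G y = -κ (-f y / ε)) := by
    intro y hy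
    simp only [hG, cutFun]
    rw [hψout y hy, hgf y (hψout y hy)]
    ring
  have hκ0 : ∀ u, (0 ≤ κ u ↔ 0 ≤ u) := by
    intro u
    rcases le_or_gt u (1 / 2) with h | h
    · rw [hκ u h]
    · exact ⟨fun _ => by linarith, fun _ => by linarith [hκ2 u h.le]⟩
  have hGA : ∀ y ∈ ball x (s + 1), y ∉ ball x s → (y ∈ A ↔ G y ≤ 0) := by
    intro y hy hys
    rw [hκsign y hys, neg_nonpos, hκ0, (hfA y (hcb y hy)).1, le_div_iff₀ hε]
    constructor <;> intro h <;> linarith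
  have hGA0 : ∀ y ∈ ball x (s + 1), y ∉ ball x s → G y = 0 → y ∈ frontier A := by
    intro y hy hys h0
    rw [hκsign y hys, neg_eq_zero] at h0
    have hlt : -f y / ε ≤ 1 / 2 := by
      by_contra! h
      linarith [hκ2 _ h.le]
    rw [hκ _ hlt, div_eq_zero_iff, neg_eq_zero] at h0
    have hfy : f y = 0 := h0.resolve_right hε.ne'
    have hyb : y ∈ ball x (s + 2) := ball_subset_ball (by linarith) hy
    refine ⟨subset_closure ((hfA y (hcb y hy)).1.2 hfy.le), fun hint => ?_⟩
    obtain ⟨w, hw, hw0⟩ := mem_closure_pos_of_fderiv_ne_zero (hfd y) hfy ((hfA y (hcb y hy)).2 hfy)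
      (inter_mem (mem_interior_iff_mem_nhds.1 hint) (isOpen_ball.mem_nhds hyb))
    exact absurd ((hfA w (ball_subset_closedBall hw.2)).1.1 hw.1) (not_le.2 hw0)
  have hGin : ∀ y ∈ ball x (s - δ), 0 < G y := by
    intro y hy
    have hys : y ∈ ball x (s + 1) := ball_subset_ball (by linarith) hy
    have := (abs_le.1 (hpb y hys)).1
    simp only [hG, cutFun]
    rw [hψin y hy]
    linarith [hκ1 (-g y / ε), ht.1]
  obtain ⟨hDC, hDf⟩ := hasC1Boundary_glue hA (contDiff_cutFun hκC hg hψC) hGA hGA0 hGreg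
  refine ⟨_, hDC, ?_, ?_⟩
  · rintro y (⟨h1, h2⟩ | ⟨h1, h2⟩)
    · rcases h1 with h1 | h1
      · exact absurd h1 h2
      · exact ⟨h1.1, fun h => absurd h1.2 (not_le.2 (hGin y h))⟩
    · exact absurd (Or.inl h1) h2
  set Γ := {y | y ∈ R ∧ 0 ≤ -g y / ε ∧ -g y / ε ≤ 1 ∧ F y = 0} with hΓ
  have hcover : frontier ((A \ ball x s) ∪ {y | y ∈ ball x s ∧ G y ≤ 0}) ⊆
      (frontier A \ ball x s) ∪ (Γ ∪ (S ∩ (fun y => κ (-g y / ε) / ψ y - p y) ⁻¹' {t} ∪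
        S' ∩ (fun y => 1 / ψ y - p y) ⁻¹' {t})) := by
    intro y hy
    rcases hDf hy with h | ⟨h, h0⟩
    · exact Or.inl h
    right
    have hyR : y ∈ R := ⟨h, fun h' => (hGin y h').ne' h0⟩
    rcases cutFun_eq_zero hκ hκ2 ht (hψ0 y) (hpb y (hbs h)) h0 with ⟨h1, h2, h3⟩ | ⟨h1, h2, h3⟩
    · refine Or.inl ⟨hyR, h2, by linarith, ?_⟩
      have : F y = ε * (g y / ε + ψ y * (t + p y)) := by simp only [hF]; field_simp
      rw [this, h3, mul_zero]
    · rcases le_or_gt (-g y / ε) 1 with h4 | h4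
      · exact Or.inr (Or.inl ⟨⟨hyR, h2, h1, h4⟩, h3⟩)
      · refine Or.inr (Or.inr ⟨⟨?_, hyR, h2⟩, ?_⟩)
        · rw [(hfA y (hcb y (hbs h))).1]
          rw [lt_div_iff₀ hε] at h4
          linarith [(abs_le.1 (hgε' y)).1]
        · rw [hκ3 _ h4.le] at h3
          exact h3
  have hΓle := hausdorff_near_zero_set_le (Γ := Γ) (T := T) hfd (fun y => (hFd y).differentiableAt)
    hc (by positivity) hερ (fun y hy => hy.2.2.2) (fun y hy => hfτ y (hgu y hy.2.1 hy.2.2.1))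
    (fun y hy => hsteep y (hbs hy.1.1) (hgu y hy.2.1 hy.2.2.1)) hL
    (fun y hy z hz => hFf z (by
      have h1 : dist y x < s := hy.1.1
      rw [mem_ball] at hz ⊢
      linarith [dist_triangle z y x])) (fun y hy => hTz y hy.1) Z
    (fun y hy => hZ (ball_subset_closedBall hy.1.1))
  have hSle := volume_near_zero_set_le (S := S) (T := T) hfd (c := c) (ρ := ρ) (τ := 2 * ε / c)
    (by positivity) (by linarith)
    (fun y hy => hfτ y (hgu y (by linarith [hy.2.2.1]) hy.2.2.2))
    (fun y hy => hsteep y (hbs hy.1.1) (hgu y (by linarith [hy.2.2.1]) hy.2.2.2))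
    (fun y hy => hTz y hy.1)
  have hScalc : ((Real.toNNReal (N / ε) : ℝ≥0) : ℝ≥0∞) * (hausConst n * volume S) ≤
      (hausConst n * (n * Real.toNNReal (6 * N / c)) : ℝ≥0) * μH[(n : ℝ) - 1] T := by
    have h1 : ENNReal.ofReal (N / ε) * ENNReal.ofReal (3 * (2 * ε / c)) =
        ENNReal.ofReal (6 * N / c) := by
      rw [← ENNReal.ofReal_mul (by positivity)]
      congr 1
      field_simp
      ring
    calc _ ≤ ENNReal.ofReal (N / ε) * (hausConst n *
          (n * (ENNReal.ofReal (3 * (2 * ε / c)) * μH[(n : ℝ) - 1] T))) := by gcongr; exact le_rfl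
      _ = (hausConst n * (n * (ENNReal.ofReal (N / ε) * ENNReal.ofReal (3 * (2 * ε / c))))) *
          μH[(n : ℝ) - 1] T := by ring
      _ = _ := by rw [h1]; push_cast; rfl
  have hnn : (0 : ℝ) ≤ (n : ℝ) - 1 := by
    have : (1 : ℝ) ≤ n := by exact_mod_cast hn
    linarith
  generalize 1 + (L + (c / 2).toNNReal) * (c / 2).toNNReal⁻¹ = Q at hΓle ⊢
  generalize hausConst n * (n * Real.toNNReal (6 * N / c)) = Q' at hScalc ⊢
  calc _ ≤ _ := measure_mono hcover
    _ ≤ μH[(n : ℝ) - 1] (frontier A \ ball x s) + (μH[(n : ℝ) - 1] Γ +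
        (μH[(n : ℝ) - 1] (S ∩ (fun y => κ (-g y / ε) / ψ y - p y) ⁻¹' {t}) +
          μH[(n : ℝ) - 1] (S' ∩ (fun y => 1 / ψ y - p y) ⁻¹' {t}))) :=
        (measure_union_le _ _).trans (add_le_add le_rfl ((measure_union_le _ _).trans
          (add_le_add le_rfl (measure_union_le _ _))))
    _ ≤ _ := by
        refine (add_le_add le_rfl (add_le_add hΓle (hslice.trans (add_le_add hScalc
          (mul_le_mul_right (mul_le_mul_right (measure_mono hS'R) _) _))))).trans ?_
        refine le_of_eq ?_
        rw [ENNReal.coe_add, ENNReal.coe_mul, ENNReal.coe_natCast,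
          ENNReal.coe_rpow_of_nonneg _ hnn, ENNReal.ofReal]
        ring

/-- The constant in front of the slice term when cutting a ball out of a set. -/
def cutConst (n : ℕ) : ℝ≥0 := Real.toNNReal (36 * cutoffConst + 1) * hausConst n

/-- The lower density at radius `s` of the volume of `A` in thin annuli around `x`. -/
def annulusDensity {n : ℕ} (A : Set (Eucl n)) (x : Eucl n) (s : ℝ) : ℝ≥0∞ :=
  liminf (fun k : ℕ => ENNReal.ofReal (k + 1) *
    volume (A ∩ (ball x s \ ball x (s - 1 / ((k : ℝ) + 1))))) atTop

theorem tendsto_measure_thin_annulus {n : ℕ} (μ : Measure (Eucl n)) {F : Set (Eucl n)}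
    (hF : MeasurableSet F) (hFm : μ F ≠ ⊤) (x : Eucl n) (s : ℝ) :
    Tendsto (fun k : ℕ => μ (F ∩ {y | s - 2 * (1 / ((k : ℝ) + 1)) ≤ dist y x ∧
      dist y x ≤ s + 1 / ((k : ℝ) + 1)})) atTop (𝓝 (μ (F ∩ sphere x s))) := by
  have hlim : Tendsto (fun k : ℕ => 1 / ((k : ℝ) + 1)) atTop (𝓝 0) :=
    tendsto_one_div_add_atTop_nhds_zero_nat
  have hInter : (⋂ k : ℕ, F ∩ {y | s - 2 * (1 / ((k : ℝ) + 1)) ≤ dist y x ∧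
      dist y x ≤ s + 1 / ((k : ℝ) + 1)}) = F ∩ sphere x s := by
    ext y
    simp only [mem_iInter, mem_inter_iff, mem_ofPred_eq, mem_sphere]
    constructor
    · intro h
      refine ⟨(h 0).1, le_antisymm ?_ ?_⟩
      · have h1 := hlim.const_add s
        rw [add_zero] at h1
        exact ge_of_tendsto' h1 fun k => (h k).2.2
      · have h1 := (hlim.const_mul 2).const_sub s
        rw [mul_zero, sub_zero] at h1
        exact le_of_tendsto' h1 fun k => (h k).2.1
    · rintro ⟨h, h2⟩ k
      have : 0 < 1 / ((k : ℝ) + 1) := by positivity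
      exact ⟨h, by linarith, by linarith⟩
  rw [← hInter]
  refine tendsto_measure_iInter_atTop (fun k => ?_) ?_ ⟨0, ?_⟩
  · refine (hF.inter (IsClosed.measurableSet ?_)).nullMeasurableSet
    exact (isClosed_le continuous_const (continuous_id.dist continuous_const)).inter
      (isClosed_le (continuous_id.dist continuous_const) continuous_const)
  · intro k l hkl y hy
    have h1 : 1 / ((l : ℝ) + 1) ≤ 1 / ((k : ℝ) + 1) := by gcongr
    obtain ⟨hy1, hy2, hy3⟩ := hy
    exact ⟨hy1, by linarith, by linarith⟩
  · exact ((measure_mono inter_subset_left).trans_lt hFm.lt_top).ne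

theorem PeT_sdiff_ball_le {n : ℕ} (hn : 1 ≤ n) {A : Set (Eucl n)} (hA : HasC1Boundary A)
    (hAm : μH[(n : ℝ) - 1] (frontier A) ≠ ⊤) {x : Eucl n} {s : ℝ} (hs : 0 < s)
    (hsph : μH[(n : ℝ) - 1] (frontier A ∩ sphere x s) = 0) :
    PeT (A \ ball x s) ≤ μH[(n : ℝ) - 1] (frontier A \ ball x s) +
      cutConst n * annulusDensity A x s := by
  obtain ⟨C, hC⟩ := exists_cut_step hn hA x s
  refine ENNReal.le_of_forall_pos_le_add fun e he htop => ?_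
  have hdens : cutConst n * annulusDensity A x s ≠ ⊤ :=
    (le_add_self.trans_lt htop).ne
  have he0 : (0 : ℝ≥0∞) < e := by exact_mod_cast he
  have hhalf : (0 : ℝ≥0∞) < e / 2 := ENNReal.half_pos he0.ne'
  -- the density term
  have hcast : ENNReal.ofReal (36 * cutoffConst + 1) * hausConst n = cutConst n := by
    rw [cutConst, ENNReal.coe_mul]; rfl
  have hfreq : ∃ᶠ k : ℕ in atTop, (cutConst n : ℝ≥0∞) * (ENNReal.ofReal (k + 1) *
      volume (A ∩ (ball x s \ ball x (s - 1 / ((k : ℝ) + 1))))) <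
        cutConst n * annulusDensity A x s + e / 2 := by
    refine frequently_lt_of_liminf_lt (by isBoundedDefault) ?_
    have h1 : liminf (fun k : ℕ => (cutConst n : ℝ≥0∞) * (ENNReal.ofReal (k + 1) *
      volume (A ∩ (ball x s \ ball x (s - 1 / ((k : ℝ) + 1)))))) atTop =
        cutConst n * annulusDensity A x s := by
      rw [annulusDensity, ENNReal.liminf_const_mul_of_ne_top ENNReal.coe_ne_top]
    rw [h1]
    exact ENNReal.lt_add_right hdens hhalf.ne'
  have hT0 : Tendsto (fun k : ℕ => (C : ℝ≥0∞) * μH[(n : ℝ) - 1] (frontier A ∩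
      {y | s - 2 * (1 / ((k : ℝ) + 1)) ≤ dist y x ∧ dist y x ≤ s + 1 / ((k : ℝ) + 1)}))
      atTop (𝓝 0) := by
    have h1 := tendsto_measure_thin_annulus μH[(n : ℝ) - 1] isClosed_frontier.measurableSet hAm x s
    rw [hsph] at h1
    simpa using ENNReal.Tendsto.const_mul h1 (Or.inr ENNReal.coe_ne_top)
  have hR0 : Tendsto (fun k : ℕ => volume (ball x s \ ball x (s - 1 / ((k : ℝ) + 1))))
      atTop (𝓝 0) := by
    have h1 := tendsto_measure_thin_annulus volume (measurableSet_ball (x := x) (ε := s))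
      measure_ball_lt_top.ne x s
    have h2 : ball x s ∩ sphere x s = ∅ := by
      ext y; simp only [mem_inter_iff, mem_ball, mem_sphere, mem_empty_iff_false, iff_false]
      rintro ⟨h1, h2⟩; linarith
    rw [h2, measure_empty] at h1
    refine tendsto_of_tendsto_of_tendsto_of_le_of_le tendsto_const_nhds h1 (fun _ => bot_le)
      fun k => measure_mono fun y hy => ⟨hy.1, ?_⟩
    have h3 : dist y x < s := hy.1
    have h4 : s - 1 / ((k : ℝ) + 1) ≤ dist y x := not_lt.1 hy.2
    have : 0 < 1 / ((k : ℝ) + 1) := by positivity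
    exact ⟨by linarith, by linarith⟩
  have hδ0 : ∀ᶠ k : ℕ in atTop, 1 / ((k : ℝ) + 1) < s :=
    tendsto_one_div_add_atTop_nhds_zero_nat.eventually_lt_const hs
  refine PeT_le_of_approx fun η hη => ?_
  obtain ⟨k, h1, h2, h3, h4⟩ := (hfreq.and_eventually ((hT0.eventually_lt_const hhalf).and
    ((hR0.eventually_lt_const hη).and hδ0))).exists
  have hk : 0 < 1 / ((k : ℝ) + 1) := by positivity
  have hk1 : 1 / ((k : ℝ) + 1) ≤ 1 := by
    rw [div_le_one (by positivity)]; linarith [(Nat.cast_nonneg k : (0 : ℝ) ≤ k)]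
  obtain ⟨D, hD, hDs, hDH⟩ := hC _ hk h4 hk1
  refine ⟨D, hD, (measure_mono hDs).trans h3.le, hDH.trans ?_⟩
  have h5 : ENNReal.ofReal ((36 * cutoffConst + 1) / (1 / ((k : ℝ) + 1))) *
      (hausConst n * volume (A ∩ (ball x s \ ball x (s - 1 / ((k : ℝ) + 1))))) =
      (cutConst n : ℝ≥0∞) * (ENNReal.ofReal (k + 1) *
      volume (A ∩ (ball x s \ ball x (s - 1 / ((k : ℝ) + 1))))) := by
    rw [← hcast, div_div_eq_mul_div, div_one, ENNReal.ofReal_mul (by linarith [cutoffConst_pos])]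
    ring
  rw [h5]
  calc _ ≤ μH[(n : ℝ) - 1] (frontier A \ ball x s) +
        (cutConst n * annulusDensity A x s + e / 2) + e / 2 :=
        add_le_add (add_le_add le_rfl h1.le) h2.le
    _ = _ := by rw [add_assoc, add_assoc, ENNReal.add_halves, ← add_assoc]

theorem measurableSet_annulus_prod {n : ℕ} {A : Set (Eucl n)} (hA : MeasurableSet A) (x : Eucl n)
    (δ : ℝ) : MeasurableSet {q : ℝ × Eucl n | q.2 ∈ A ∧ dist q.2 x < q.1 ∧ q.1 - δ ≤ dist q.2 x} := by
  have h1 : Measurable fun q : ℝ × Eucl n => dist q.2 x := measurable_snd.dist measurable_const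
  exact (measurable_snd hA).inter ((measurableSet_lt h1 measurable_fst).inter
    (measurableSet_le (measurable_fst.sub measurable_const) h1))

theorem measurable_volume_annulus {n : ℕ} {A : Set (Eucl n)} (hA : MeasurableSet A) (x : Eucl n)
    (δ : ℝ) : Measurable fun s : ℝ => volume (A ∩ (ball x s \ ball x (s - δ))) := by
  have h := measurable_measure_prodMk_left (ν := (volume : Measure (Eucl n)))
    (measurableSet_annulus_prod hA x δ)
  convert h using 3 with s
  ext y
  simp [not_lt]
  tauto

theorem lintegral_volume_annulus_le {n : ℕ} {A : Set (Eucl n)} (hA : MeasurableSet A) (x : Eucl n)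
    (δ : ℝ) (a b : ℝ) : ∫⁻ s in Ioo a b, volume (A ∩ (ball x s \ ball x (s - δ))) ≤
      ENNReal.ofReal δ * volume (A ∩ ball x b) := by
  set W := {q : ℝ × Eucl n | q.2 ∈ A ∧ dist q.2 x < q.1 ∧ q.1 - δ ≤ dist q.2 x} with hW
  have hWm : MeasurableSet W := measurableSet_annulus_prod hA x δ
  set μ : Measure ℝ := volume.restrict (Ioo a b) with hμ
  have h1 : ∫⁻ s in Ioo a b, volume (A ∩ (ball x s \ ball x (s - δ))) =
      (μ.prod (volume : Measure (Eucl n))) W := by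
    rw [Measure.prod_apply hWm]
    refine lintegral_congr fun s => ?_
    congr 1
    ext y
    simp [hW, not_lt]
    tauto
  rw [h1, Measure.prod_apply_symm hWm]
  have hm : MeasurableSet (A ∩ ball x b) := hA.inter measurableSet_ball
  calc ∫⁻ y, μ ((fun s => (s, y)) ⁻¹' W)
      ≤ ∫⁻ y, (A ∩ ball x b).indicator (fun _ => ENNReal.ofReal δ) y := by
        refine lintegral_mono fun y => ?_
        by_cases hy : y ∈ A ∩ ball x b
        · rw [indicator_of_mem hy]
          calc μ ((fun s => (s, y)) ⁻¹' W) ≤ volume ((fun s => (s, y)) ⁻¹' W) :=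
                Measure.restrict_apply_le _ _
            _ ≤ volume (Icc (dist y x) (dist y x + δ)) := by
                refine measure_mono fun s hs => ?_
                have h2 : dist y x < s := hs.2.1
                have h3 : s - δ ≤ dist y x := hs.2.2
                exact ⟨h2.le, by linarith⟩
            _ = ENNReal.ofReal δ := by simp
        · rw [indicator_of_notMem hy, nonpos_iff_eq_zero, hμ,
            Measure.restrict_apply (measurable_prodMk_right hWm)]
          have : (fun s => (s, y)) ⁻¹' W ∩ Ioo a b = ∅ := by
            rw [Set.eq_empty_iff_forall_notMem]
            rintro s ⟨hs, hs'⟩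
            have h2 : dist y x < s := hs.2.1
            exact hy ⟨hs.1, by rw [mem_ball]; linarith [hs'.2]⟩
          rw [this, measure_empty]
    _ = ENNReal.ofReal δ * volume (A ∩ ball x b) := by
        rw [lintegral_indicator hm, setLIntegral_const]

theorem measurable_annulusDensity {n : ℕ} {A : Set (Eucl n)} (hA : MeasurableSet A) (x : Eucl n) :
    Measurable (annulusDensity A x) :=
  Measurable.liminf fun _ => (measurable_volume_annulus hA x _).const_mul _

theorem lintegral_annulusDensity_le {n : ℕ} {A : Set (Eucl n)} (hA : MeasurableSet A) (x : Eucl n)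
    (a b : ℝ) : ∫⁻ s in Ioo a b, annulusDensity A x s ≤ volume (A ∩ ball x b) := by
  refine (lintegral_liminf_le fun _ => (measurable_volume_annulus hA x _).const_mul _).trans ?_
  refine liminf_le_of_le (by isBoundedDefault) fun c hc => ?_
  obtain ⟨k, hk⟩ := hc.exists
  refine hk.trans ?_
  rw [lintegral_const_mul _ (measurable_volume_annulus hA x _)]
  refine (mul_le_mul_right (lintegral_volume_annulus_le hA x _ a b) _).trans ?_
  rw [← mul_assoc, ← ENNReal.ofReal_mul (by positivity), mul_one_div_cancel (by positivity)]
  simp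

theorem ae_hausdorff_inter_sphere_eq_zero {n : ℕ} {F : Set (Eucl n)}
    (hm : μH[(n : ℝ) - 1] F ≠ ⊤) (x : Eucl n) :
    ∀ᵐ s : ℝ, μH[(n : ℝ) - 1] (F ∩ sphere x s) = 0 := by
  set μ : Measure (Eucl n) := (μH[(n : ℝ) - 1] : Measure (Eucl n)).restrict F with hμ
  have : IsFiniteMeasure μ := ⟨by rw [hμ, Measure.restrict_apply_univ]; exact hm.lt_top⟩
  have hd : Measurable fun y : Eucl n => dist y x := measurable_id.dist measurable_const
  have hc := Measure.countable_meas_level_set_pos (μ := μ) hd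
  filter_upwards [hc.ae_notMem volume] with s hs
  have h1 : μ {y | dist y x = s} = 0 := by
    by_contra h
    exact hs (pos_iff_ne_zero.2 h)
  rw [hμ, Measure.restrict_apply (measurableSet_eq_fun hd measurable_const)] at h1
  rw [inter_comm]
  exact h1

theorem frontier_inter_ball_subset {n : ℕ} {A : Set (Eucl n)} (hA : IsClosed A) (x : Eucl n)
    (s : ℝ) : frontier (A ∩ ball x s) ⊆ (frontier A ∩ ball x s) ∪ (A ∩ sphere x s) := by
  intro y hy
  have hy' := frontier_inter_subset A (ball x s) hy
  rcases hy' with ⟨h1, h2⟩ | ⟨h1, h2⟩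
  · have h3 : dist y x ≤ s := closure_ball_subset_closedBall h2
    rcases h3.lt_or_eq with h | h
    · exact Or.inl ⟨h1, h⟩
    · exact Or.inr ⟨hA.frontier_subset h1, h⟩
  · exact Or.inr ⟨hA.closure_eq ▸ h1, frontier_ball_subset_sphere h2⟩

theorem measure_inter_le_add_symmDiff {n : ℕ} (A E B : Set (Eucl n)) :
    volume (A ∩ B) ≤ volume (E ∩ B) + volume (A ∆ E) := by
  refine (measure_mono ?_).trans (measure_union_le _ _)
  rintro y ⟨hA, hB⟩
  by_cases hE : y ∈ E
  · exact Or.inl ⟨hE, hB⟩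
  · exact Or.inr (Or.inl ⟨hA, hE⟩)

theorem eventually_hausdorff_inter_ball_le {n : ℕ} (hn : 1 ≤ n) {E : Set (Eucl n)}
    (hE : PeT E ≠ ⊤) {x : Eucl n} {s : ℝ} (hs : 0 < s) {Λ : ℝ≥0}
    (hm : volume (E ∩ ball x s) ≠ ⊤)
    (hmin : PeT E + Λ * volume (E ∩ ball x s) ≤ PeT (E \ ball x s))
    {A : ℕ → Set (Eucl n)} (hA : ∀ j, HasC1Boundary (A j)) {η : ℕ → ℝ≥0∞}
    (hη : Tendsto η atTop (𝓝 0)) (hvol : ∀ j, volume (A j ∆ E) ≤ η j)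
    (hfin : ∀ j, μH[(n : ℝ) - 1] (frontier (A j)) ≠ ⊤)
    (hper : ∀ j, μH[(n : ℝ) - 1] (frontier (A j)) ≤ PeT E + η j)
    (hsph : ∀ j, μH[(n : ℝ) - 1] (frontier (A j) ∩ sphere x s) = 0) {ε : ℝ≥0∞} (hε : 0 < ε)
    (hε' : ε ≠ ⊤) :
    ∀ᶠ j in atTop, Λ * volume (E ∩ ball x s) + μH[(n : ℝ) - 1] (frontier (A j) ∩ ball x s) ≤
      cutConst n * annulusDensity (A j) x s + ε := by
  by_contra hcon
  have hfr := Filter.not_eventually.1 hcon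
  set X := PeT E + Λ * volume (E ∩ ball x s) with hX
  have hXt : X ≠ ⊤ := ENNReal.add_ne_top.2 ⟨hE, ENNReal.mul_ne_top ENNReal.coe_ne_top hm⟩
  have hε2 : 0 < ε / 2 := ENNReal.half_pos hε.ne'
  have key : ∃ᶠ j in atTop, PeT (A j \ ball x s) + ε / 2 ≤ X := by
    refine (hfr.and_eventually (hη.eventually (ge_mem_nhds hε2))).mono ?_
    rintro j ⟨hj, hj2⟩
    have hj := (not_le.1 hj).le
    have h1 := PeT_sdiff_ball_le hn (hA j) (hfin j) hs (hsph j)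
    have h2 := measure_inter_add_sdiff (μ := μH[(n : ℝ) - 1]) (frontier (A j))
      (measurableSet_ball (x := x) (ε := s))
    have h3 : PeT (A j \ ball x s) + ε / 2 + ε / 2 ≤ X + ε / 2 := by
      rw [add_assoc, ENNReal.add_halves]
      calc PeT (A j \ ball x s) + ε
          ≤ μH[(n : ℝ) - 1] (frontier (A j) \ ball x s) +
            cutConst n * annulusDensity (A j) x s + ε := by gcongr
        _ = μH[(n : ℝ) - 1] (frontier (A j) \ ball x s) +
            (cutConst n * annulusDensity (A j) x s + ε) := by rw [add_assoc]
        _ ≤ μH[(n : ℝ) - 1] (frontier (A j) \ ball x s) + (Λ * volume (E ∩ ball x s) +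
            μH[(n : ℝ) - 1] (frontier (A j) ∩ ball x s)) := by gcongr
        _ = Λ * volume (E ∩ ball x s) + μH[(n : ℝ) - 1] (frontier (A j)) := by
            rw [← h2]; ring
        _ ≤ Λ * volume (E ∩ ball x s) + (PeT E + η j) := by gcongr; exact hper j
        _ ≤ Λ * volume (E ∩ ball x s) + (PeT E + ε / 2) := by gcongr
        _ = X + ε / 2 := by rw [hX]; ring
    exact (ENNReal.add_le_add_iff_right (ENNReal.div_ne_top hε' (by simp))).1 h3
  obtain ⟨j₀, hj₀⟩ := key.exists
  have hX2 : ε / 2 ≤ X := le_add_self.trans hj₀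
  have hle : PeT (E \ ball x s) ≤ X - ε / 2 := by
    refine PeT_le_of_approx_PeT fun δ hδ => ?_
    obtain ⟨j, hj, hj2⟩ := (key.and_eventually (hη.eventually (ge_mem_nhds hδ))).exists
    refine ⟨A j \ ball x s, ?_, ENNReal.le_sub_of_add_le_right
      (ENNReal.div_ne_top hε' (by simp)) hj⟩
    refine (measure_mono ?_).trans ((hvol j).trans hj2)
    rintro y (⟨⟨h1, h2⟩, h3⟩ | ⟨⟨h1, h2⟩, h3⟩)
    · exact Or.inl ⟨h1, fun h => h3 ⟨h, h2⟩⟩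
    · exact Or.inr ⟨h1, fun h => h3 ⟨h, h2⟩⟩
  have := (hmin.trans hle).trans_lt
    (ENNReal.sub_lt_self hXt (hε2.trans_le hX2).ne' hε2.ne')
  exact lt_irrefl _ this

theorem le_liminf_cut_and_isoperimetric {n : ℕ} (hn : 1 ≤ n) {M P : ℝ≥0∞} (hM : M ≠ ⊤)
    {V F q ℓ : ℕ → ℝ≥0∞} {K : ℝ≥0∞} (hK0 : K ≠ 0) (hK : K ≠ ⊤)
    (h1 : ∀ ε : ℝ≥0∞, 0 < ε → ε ≠ ⊤ → ∀ᶠ j in atTop, P + F j ≤ ℓ j + ε)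
    (h2 : ∀ ε : ℝ≥0∞, 0 < ε → ∀ᶠ j in atTop, M ≤ V j + ε)
    (h3 : ∀ j, 0 < V j → V j ^ (n - 1) ≤ K * (F j + q j) ^ n) (hM0 : 0 < M) :
    P ≤ liminf (fun j => ℓ j + q j) atTop ∧
      M ^ (n - 1) ≤ K * liminf (fun j => ℓ j + q j) atTop ^ n := by
  set Φ := liminf (fun j => ℓ j + q j) atTop with hΦ
  by_cases hΦt : Φ = ⊤
  · rw [hΦt, ENNReal.top_pow (by omega), ENNReal.mul_top hK0]
    exact ⟨le_top, le_top⟩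
  have key : ∀ ε : ℝ≥0∞, 0 < ε → ε < M → P ≤ Φ + (ε + ε) ∧
      (M - ε) ^ (n - 1) ≤ K * (Φ + (ε + ε)) ^ n := by
    intro ε hε hεM
    have hεt : ε ≠ ⊤ := hεM.ne_top
    have h4 := frequently_lt_of_liminf_lt (by isBoundedDefault)
      (ENNReal.lt_add_right hΦt hε.ne' : Φ < Φ + ε)
    obtain ⟨j, hj, hj1, hj2⟩ := (h4.and_eventually ((h1 ε hε hεt).and (h2 ε hε))).exists
    have hV : M - ε ≤ V j := tsub_le_iff_right.2 hj2
    refine ⟨?_, (pow_le_pow_left' hV _).trans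
      ((h3 j ((tsub_pos_of_lt hεM).trans_le hV)).trans ?_)⟩
    · calc P ≤ P + F j := le_self_add
        _ ≤ ℓ j + ε := hj1
        _ ≤ ℓ j + q j + ε := by gcongr; exact le_self_add
        _ ≤ Φ + ε + ε := by gcongr
        _ = _ := add_assoc _ _ _
    · refine mul_le_mul' le_rfl (pow_le_pow_left' ?_ _)
      calc F j + q j ≤ (P + F j) + q j := by gcongr; exact le_add_self
        _ ≤ (ℓ j + ε) + q j := by gcongr
        _ = (ℓ j + q j) + ε := by ring
        _ ≤ Φ + ε + ε := by gcongr
        _ = _ := add_assoc _ _ _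
  have hev : ∀ᶠ k : ℕ in atTop, 0 < ((k : ℝ≥0∞))⁻¹ ∧ ((k : ℝ≥0∞))⁻¹ < M :=
    (Eventually.of_forall fun k => by simp).and
      (ENNReal.tendsto_inv_nat_nhds_zero.eventually (gt_mem_nhds hM0))
  have ht : Tendsto (fun k : ℕ => Φ + (((k : ℝ≥0∞))⁻¹ + ((k : ℝ≥0∞))⁻¹)) atTop (𝓝 Φ) := by
    simpa using tendsto_const_nhds.add
      (ENNReal.tendsto_inv_nat_nhds_zero.add ENNReal.tendsto_inv_nat_nhds_zero)
  refine ⟨ge_of_tendsto ht (hev.mono fun k hk => (key _ hk.1 hk.2).1), ?_⟩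
  have hl : Tendsto (fun k : ℕ => (M - ((k : ℝ≥0∞))⁻¹) ^ (n - 1)) atTop (𝓝 (M ^ (n - 1))) := by
    have := ENNReal.Tendsto.sub (tendsto_const_nhds (x := M) (f := atTop))
      ENNReal.tendsto_inv_nat_nhds_zero (Or.inl hM)
    simpa using ENNReal.Tendsto.pow (n := n - 1) this
  have hr := ENNReal.Tendsto.const_mul (a := K) (ENNReal.Tendsto.pow (n := n) ht) (Or.inr hK)
  exact le_of_tendsto_of_tendsto hl hr (hev.mono fun k hk => (key _ hk.1 hk.2).2)

theorem exists_radial_bound {n : ℕ} (hn : 1 ≤ n) {E : Set (Eucl n)}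
    (hE : PeT E ≠ ⊤) {x : Eucl n} {R : ℝ} {Λ : ℝ≥0}
    (hpos : ∀ s ∈ Ioo 0 R, 0 < volume (E ∩ ball x s))
    (hmin : ∀ s ∈ Ioo 0 R, PeT E + Λ * volume (E ∩ ball x s) ≤ PeT (E \ ball x s))
    {a b : ℝ} (ha : 0 < a) (hb : b < R) :
    ∃ Φ : ℝ → ℝ≥0∞, ∫⁻ s in Ioo a b, Φ s ≤
        (cutConst n + hausConst n : ℝ≥0) * volume (E ∩ ball x b) ∧
      ∀ᵐ s ∂(volume.restrict (Ioo a b)), Λ * volume (E ∩ ball x s) ≤ Φ s ∧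
        volume (E ∩ ball x s) ^ (n - 1) ≤ (3 * n : ℝ≥0∞) ^ n * Φ s ^ n := by
  have hfinb : ∀ s, volume (E ∩ ball x s) ≠ ⊤ := fun s =>
    ((measure_mono inter_subset_right).trans_lt measure_ball_lt_top).ne
  set η : ℕ → ℝ≥0∞ := fun j => ((j : ℝ≥0∞) + 1)⁻¹ with hηdef
  have hη0 : ∀ j, 0 < η j := fun j => by simp [hηdef]
  have hη : Tendsto η atTop (𝓝 0) := by
    have := (tendsto_add_atTop_iff_nat (f := fun j : ℕ => ((j : ℝ≥0∞))⁻¹) 1).2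
      ENNReal.tendsto_inv_nat_nhds_zero
    simpa [hηdef] using this
  choose A hA hAE hAP using fun j : ℕ =>
    exists_approx_of_PeT_lt (ENNReal.lt_add_right hE (hη0 j).ne') (hη0 j)
  have hAm : ∀ j, MeasurableSet (A j) := fun j => (hA j).isClosed.measurableSet
  have hV : ∀ j s, volume (A j ∩ ball x s) ≠ ⊤ := fun j s =>
    ((measure_mono inter_subset_right).trans_lt measure_ball_lt_top).ne
  have hlip : LipschitzWith 1 (fun y : Eucl n => dist y x) := LipschitzWith.dist_left x
  choose g hg hgs hgi using fun j : ℕ =>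
    exists_slice_bound_volume hn (hlip.lipschitzOnWith (s := A j ∩ ball x b)) (hV j b)
  refine ⟨fun s => liminf (fun j => cutConst n * annulusDensity (A j) x s + g j s) atTop, ?_, ?_⟩
  · have hmeas : ∀ j, Measurable fun s => (cutConst n : ℝ≥0∞) * annulusDensity (A j) x s :=
      fun j => (measurable_annulusDensity (hAm j) x).const_mul _
    refine (lintegral_liminf_le fun j => (hmeas j).add (hg j)).trans ?_
    have hlim : Tendsto (fun j => ((cutConst n + hausConst n : ℝ≥0) : ℝ≥0∞) *
        (volume (E ∩ ball x b) + η j)) atTop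
        (𝓝 (((cutConst n + hausConst n : ℝ≥0) : ℝ≥0∞) * volume (E ∩ ball x b))) := by
      have h := ENNReal.Tendsto.const_mul (a := ((cutConst n + hausConst n : ℝ≥0) : ℝ≥0∞))
        (tendsto_const_nhds (x := volume (E ∩ ball x b)).add hη) (Or.inr ENNReal.coe_ne_top)
      simpa using h
    refine le_trans (liminf_le_liminf (Eventually.of_forall fun j => ?_)) hlim.liminf_eq.le
    simp only [Pi.add_apply]
    rw [lintegral_add_left (hmeas j), lintegral_const_mul _ (measurable_annulusDensity (hAm j) x)]
    have h1 : volume (A j ∩ ball x b) ≤ volume (E ∩ ball x b) + η j :=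
      (measure_inter_le_add_symmDiff _ _ _).trans (by gcongr; exact (hAE j).le)
    calc (cutConst n : ℝ≥0∞) * (∫⁻ s in Ioo a b, annulusDensity (A j) x s) + ∫⁻ s in Ioo a b, g j s
        ≤ cutConst n * volume (A j ∩ ball x b) + hausConst n * volume (A j ∩ ball x b) := by
          gcongr
          · exact lintegral_annulusDensity_le (hAm j) x a b
          · refine (setLIntegral_le_lintegral _ _).trans ((hgi j).trans ?_)
            simp
      _ = ((cutConst n + hausConst n : ℝ≥0) : ℝ≥0∞) * volume (A j ∩ ball x b) := by
          push_cast; ring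
      _ ≤ _ := by gcongr
  · have hsph : ∀ᵐ s : ℝ, ∀ j, μH[(n : ℝ) - 1] (frontier (A j) ∩ sphere x s) = 0 :=
      ae_all_iff.2 fun j => ae_hausdorff_inter_sphere_eq_zero ((hAP j).ne_top) x
    filter_upwards [ae_restrict_of_ae hsph, ae_restrict_mem measurableSet_Ioo] with s hs hsI
    have hs0 : 0 < s := ha.trans hsI.1
    have hsR : s ∈ Ioo 0 R := ⟨hs0, hsI.2.trans hb⟩
    have hn0 : (3 * n : ℝ≥0∞) ^ n ≠ 0 := by
      refine pow_ne_zero _ ?_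
      simp; omega
    refine le_liminf_cut_and_isoperimetric hn (hfinb s)
      (V := fun j => volume (A j ∩ ball x s))
      (F := fun j => μH[(n : ℝ) - 1] (frontier (A j) ∩ ball x s)) hn0
      (ENNReal.pow_ne_top (ENNReal.mul_ne_top (by simp) (by simp))) ?_ ?_ ?_ (hpos s hsR)
    · intro ε hε hεt
      exact eventually_hausdorff_inter_ball_le hn hE hs0 (hfinb s) (hmin s hsR) hA hη
        (fun j => (hAE j).le) (fun j => (hAP j).ne_top) (fun j => (hAP j).le) hs hε hεt
    · intro ε hε
      filter_upwards [hη.eventually (ge_mem_nhds hε)] with j hj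
      refine (measure_inter_le_add_symmDiff E (A j) _).trans ?_
      rw [symmDiff_comm]
      gcongr
      exact (hAE j).le.trans hj
    · intro j hj
      refine (isoperimetric hn ((hAm j).inter measurableSet_ball)
        (isBounded_ball.subset inter_subset_right) hj).trans ?_
      gcongr
      refine (measure_mono (frontier_inter_ball_subset (hA j).isClosed x s)).trans
        ((measure_union_le _ _).trans ?_)
      gcongr
      refine le_trans (measure_mono ?_) (hgs j s)
      rintro y ⟨h1, h2⟩
      have h2 : dist y x = s := h2
      exact ⟨⟨h1, by rw [mem_ball, h2]; exact hsI.2⟩, h2⟩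

theorem radial_growth {n : ℕ} (hn : 1 ≤ n) {E : Set (Eucl n)}
    (hE : PeT E ≠ ⊤) {x : Eucl n} {R : ℝ} {Λ : ℝ≥0}
    (hpos : ∀ s ∈ Ioo 0 R, 0 < volume (E ∩ ball x s))
    (hmin : ∀ s ∈ Ioo 0 R, PeT E + Λ * volume (E ∩ ball x s) ≤ PeT (E \ ball x s))
    {a b : ℝ} (ha : 0 < a) (hb : b < R) :
    ENNReal.ofReal (b - a) * (Λ * volume (E ∩ ball x a)) ≤
        (cutConst n + hausConst n : ℝ≥0) * volume (E ∩ ball x b) ∧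
      ENNReal.ofReal (b - a) ^ n * volume (E ∩ ball x a) ^ (n - 1) ≤
        (3 * n * (cutConst n + hausConst n : ℝ≥0) : ℝ≥0∞) ^ n * volume (E ∩ ball x b) ^ n := by
  obtain ⟨Φ, hΦ, hae⟩ := exists_radial_bound hn hE hpos hmin ha hb
  have hconst : ∀ w : ℝ≥0∞, (∀ᵐ s ∂(volume.restrict (Ioo a b)), w ≤ Φ s) →
      ENNReal.ofReal (b - a) * w ≤ (cutConst n + hausConst n : ℝ≥0) * volume (E ∩ ball x b) := by
    intro w hw
    refine le_trans (le_of_eq ?_) ((lintegral_mono_ae hw).trans hΦ)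
    rw [setLIntegral_const, Real.volume_Ioo, mul_comm]
  have hI := ae_restrict_mem (μ := (volume : Measure ℝ)) (measurableSet_Ioo (a := a) (b := b))
  have hmono : ∀ s ∈ Ioo a b, volume (E ∩ ball x a) ≤ volume (E ∩ ball x s) := fun s hs =>
    measure_mono (inter_subset_inter_right _ (ball_subset_ball hs.1.le))
  refine ⟨hconst _ ?_, ?_⟩
  · filter_upwards [hae, hI] with s hs hsI
    exact (mul_le_mul' le_rfl (hmono s hsI)).trans hs.1
  · have hn0 : n ≠ 0 := by omega
    set w : ℝ≥0∞ := (volume (E ∩ ball x a) ^ (n - 1)) ^ ((n : ℝ)⁻¹) with hw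
    have hwn : w ^ n = volume (E ∩ ball x a) ^ (n - 1) := by
      rw [hw, ← ENNReal.rpow_natCast, ← ENNReal.rpow_mul,
        inv_mul_cancel₀ (by exact_mod_cast hn0), ENNReal.rpow_one]
    have h3 : (3 * n : ℝ≥0∞) ≠ 0 := by simp; omega
    have h3t : (3 * n : ℝ≥0∞) ≠ ⊤ := ENNReal.mul_ne_top (by simp) (by simp)
    have key := hconst (w / (3 * n)) (by
      filter_upwards [hae, hI] with s hs hsI
      rw [ENNReal.div_le_iff h3 h3t, mul_comm]
      refine (ENNReal.pow_right_strictMono hn0).le_iff_le.1 ?_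
      rw [mul_pow, hwn]
      exact (pow_le_pow_left' (hmono s hsI) _).trans hs.2)
    rw [← mul_div_assoc, ENNReal.div_le_iff h3 h3t] at key
    rw [← hwn, ← mul_pow, ← mul_pow]
    refine pow_le_pow_left' (key.trans (le_of_eq ?_)) n
    ring

theorem exists_growth_lower_bound (n : ℕ) (hn : 1 ≤ n) {K : ℝ} (hK : 0 < K) :
    ∃ θ : ℝ, 0 < θ ∧ ∀ (m : ℝ → ℝ) (R : ℝ), 0 < R → (∀ s ∈ Ioo 0 R, 0 < m s) →
      (∀ a b, 0 < a → a ≤ b → b < R → m a ≤ m b) →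
      (∀ a b, 0 < a → a < b → b < R → (b - a) ^ n * m a ^ (n - 1) ≤ K * m b ^ n) →
      θ * R ^ n ≤ m (R / 2) := by
  obtain ⟨p, rfl⟩ : ∃ p, n = p + 1 := ⟨n - 1, by omega⟩
  simp only [add_tsub_cancel_right]
  rcases Nat.eq_zero_or_pos p with rfl | hp
  · refine ⟨1 / (4 * K), by positivity, fun m R hR _ _ h => ?_⟩
    have := h (R / 4) (R / 2) (by linarith) (by linarith) (by linarith)
    simp only [zero_add, pow_one, pow_zero, mul_one] at this ⊢
    rw [div_mul_eq_mul_div, div_le_iff₀ (by positivity)]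
    nlinarith
  set u : ℝ := 1 / 2 with hu
  have hu0 : 0 < u := by norm_num [hu]
  set μ : ℝ := u ^ (p + 1) with hμ
  have hμ0 : 0 < μ := by positivity
  have hμ1 : μ < 1 := pow_lt_one₀ hu0.le (by norm_num [hu]) (by omega)
  set θ : ℝ := μ ^ p * u ^ (3 * (p + 1)) / K with hθ
  have hθ0 : 0 < θ := by positivity
  have hKθ : K * θ = μ ^ p * u ^ (3 * (p + 1)) := by rw [hθ]; field_simp
  refine ⟨θ, hθ0, fun m R hR hpos hmono h => ?_⟩
  by_contra hcon
  have hcon := not_le.1 hcon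
  set b : ℕ → ℝ := fun k => R / 4 * (1 + u ^ k) with hb
  have hb0 : ∀ k, R / 4 < b k := fun k => by
    have : 0 < u ^ k := by positivity
    simp only [hb]; nlinarith
  have hbR : ∀ k, b k < R := fun k => by
    have : u ^ k ≤ 1 := pow_le_one₀ hu0.le (by norm_num [hu])
    simp only [hb]; nlinarith
  have hstep : ∀ k, b k - b (k + 1) = R * u ^ (k + 3) := fun k => by
    simp only [hb, pow_succ, hu]; ring
  have hind : ∀ k, m (b k) ≤ θ * μ ^ k * R ^ (p + 1) := by
    intro k
    induction k with
    | zero =>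
      have : b 0 = R / 2 := by simp only [hb, pow_zero]; ring
      rw [this, pow_zero, mul_one]
      exact hcon.le
    | succ k ih =>
      have h1 := h (b (k + 1)) (b k) (by linarith [hb0 (k + 1)])
        (by have := hstep k; have : 0 < R * u ^ (k + 3) := by positivity
            linarith) (hbR k)
      rw [hstep] at h1
      have h2 : m (b k) ^ (p + 1) ≤ (θ * μ ^ k * R ^ (p + 1)) ^ (p + 1) :=
        pow_le_pow_left₀ (hpos _ ⟨by linarith [hb0 k], hbR k⟩).le ih _
      have h3 : K * (θ * μ ^ k * R ^ (p + 1)) ^ (p + 1) =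
          (R * u ^ (k + 3)) ^ (p + 1) * (θ * μ ^ (k + 1) * R ^ (p + 1)) ^ p := by
        calc K * (θ * μ ^ k * R ^ (p + 1)) ^ (p + 1)
            = (K * θ) * (θ ^ p * μ ^ (k * p) * μ ^ k * (R ^ (p + 1)) ^ p * R ^ (p + 1)) := by
              ring
          _ = (μ ^ p * u ^ (3 * (p + 1))) *
              (θ ^ p * μ ^ (k * p) * u ^ ((p + 1) * k) * (R ^ (p + 1)) ^ p * R ^ (p + 1)) := by
              rw [hKθ]; congr 2; rw [pow_mul u, ← hμ]
          _ = _ := by ring_nf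
      have h4 : m (b (k + 1)) ^ p ≤ (θ * μ ^ (k + 1) * R ^ (p + 1)) ^ p := by
        have h5 : 0 < (R * u ^ (k + 3)) ^ (p + 1) := by positivity
        refine le_of_mul_le_mul_left (h1.trans ?_) h5
        rw [← h3]
        exact mul_le_mul_of_nonneg_left h2 hK.le
      exact le_of_pow_le_pow_left₀ (by omega) (by positivity) h4
  have hlim : Tendsto (fun k => θ * μ ^ k * R ^ (p + 1)) atTop (𝓝 (θ * 0 * R ^ (p + 1))) :=
    ((tendsto_pow_atTop_nhds_zero_of_lt_one hμ0.le hμ1).const_mul θ).mul_const _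
  have hle : m (R / 4) ≤ θ * 0 * R ^ (p + 1) := ge_of_tendsto hlim <|
    Eventually.of_forall fun k => (hmono _ _ (by linarith) (hb0 k).le (hbR k)).trans (hind k)
  have := hpos (R / 4) ⟨by linarith, by linarith⟩
  simp only [mul_zero, zero_mul] at hle
  linarith

/-- Density bound: if removing small balls around `x` never decreases the perimeter by less than
`Λ` times the removed volume, then the radius is at most a dimensional multiple of `Λ⁻¹`. -/
theorem exists_density_bound (n : ℕ) (hn : 1 ≤ n) :
    ∃ C : ℝ, 0 < C ∧ ∀ (E : Set (Eucl n)) (x : Eucl n) (R : ℝ) (Λ : ℝ≥0), 0 < R → PeT E ≠ ⊤ →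
      (∀ s ∈ Ioo 0 R, 0 < volume (E ∩ ball x s)) →
      (∀ s ∈ Ioo 0 R, PeT E + Λ * volume (E ∩ ball x s) ≤ PeT (E \ ball x s)) →
      Λ * R ≤ C := by
  set c : ℝ := ((cutConst n + hausConst n : ℝ≥0) : ℝ) with hc
  have hc0 : 0 ≤ c := NNReal.coe_nonneg _
  have hn0 : (0 : ℝ) < n := by exact_mod_cast hn
  obtain ⟨θ, hθ, hgrowth⟩ := exists_growth_lower_bound n hn
    (K := (3 * n * (c + 1)) ^ n) (by positivity)
  set ω : ℝ := (volume (ball (0 : Eucl n) 1)).toReal with hω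
  refine ⟨4 * c * ω / θ + 1, by positivity, fun E x R Λ hR hE hpos hmin => ?_⟩
  have hfin : ∀ s, volume (E ∩ ball x s) ≠ ⊤ := fun s =>
    ((measure_mono inter_subset_right).trans_lt measure_ball_lt_top).ne
  set m : ℝ → ℝ := fun s => (volume (E ∩ ball x s)).toReal with hm
  have hrg := fun a b (ha : 0 < a) (hb : b < R) =>
    radial_growth hn hE hpos hmin (a := a) (b := b) ha hb
  have h1 := hgrowth m R hR (fun s hs => ENNReal.toReal_pos (hpos s hs).ne' (hfin s))
    (fun a b _ hab _ => ENNReal.toReal_mono (hfin b)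
      (measure_mono (inter_subset_inter_right _ (ball_subset_ball hab))))
    (fun a b ha hab hb => by
      have := ENNReal.toReal_mono (by
        refine ENNReal.mul_ne_top (ENNReal.pow_ne_top ?_) (ENNReal.pow_ne_top (hfin b))
        exact ENNReal.mul_ne_top (ENNReal.mul_ne_top (by simp) (by simp)) ENNReal.coe_ne_top)
        (hrg a b ha hb).2
      simp only [ENNReal.toReal_mul, ENNReal.toReal_pow,
        ENNReal.toReal_ofReal (sub_nonneg.2 hab.le), ENNReal.toReal_natCast,
        ENNReal.coe_toReal, ENNReal.toReal_ofNat] at this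
      refine this.trans (mul_le_mul_of_nonneg_right ?_ (by positivity))
      rw [← hc]
      gcongr
      linarith)
  have h2 := ENNReal.toReal_mono (ENNReal.mul_ne_top ENNReal.coe_ne_top (hfin _))
    (hrg (R / 2) (3 * R / 4) (by linarith) (by linarith)).1
  simp only [ENNReal.toReal_mul, ENNReal.coe_toReal] at h2
  rw [ENNReal.toReal_ofReal (by linarith), ← hc] at h2
  have h3 : m (3 * R / 4) ≤ R ^ n * ω := by
    have h4 : volume (E ∩ ball x (3 * R / 4)) ≤
        ENNReal.ofReal (R ^ n) * volume (ball (0 : Eucl n) 1) := by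
      refine (measure_mono (inter_subset_right.trans
        (ball_subset_ball (show 3 * R / 4 ≤ R by linarith)))).trans (le_of_eq ?_)
      rw [Measure.addHaar_ball_of_pos _ x hR, finrank_euclideanSpace_fin]
    have := ENNReal.toReal_mono (ENNReal.mul_ne_top ENNReal.ofReal_ne_top measure_ball_lt_top.ne) h4
    rwa [ENNReal.toReal_mul, ENNReal.toReal_ofReal (by positivity)] at this
  have hRn : 0 < R ^ n := by positivity
  have h5 : (3 * R / 4 - R / 2) * (Λ * (θ * R ^ n)) ≤ c * (R ^ n * ω) :=
    calc (3 * R / 4 - R / 2) * (Λ * (θ * R ^ n)) ≤ (3 * R / 4 - R / 2) * (Λ * m (R / 2)) := by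
          have : 0 ≤ 3 * R / 4 - R / 2 := by linarith
          gcongr
      _ ≤ c * m (3 * R / 4) := h2
      _ ≤ _ := by gcongr
  have h6 : Λ * R * θ ≤ 4 * c * ω := by
    refine le_of_mul_le_mul_right ?_ hRn
    nlinarith
  have h7 : Λ * R ≤ 4 * c * ω / θ := (le_div_iff₀ hθ).2 h6
  linarith

theorem IsPreconnected.inter_frontier_nonempty {X : Type*} [TopologicalSpace X]
    {t s : Set X} (ht : IsPreconnected t) (h1 : (t ∩ s).Nonempty) (h2 : (t ∩ sᶜ).Nonempty) :
    (t ∩ frontier s).Nonempty := by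
  by_contra hcon
  rw [Set.not_nonempty_iff_eq_empty, Set.eq_empty_iff_forall_notMem] at hcon
  have hin : ∀ y ∈ t, y ∈ closure s → y ∈ interior s := fun y hy hys => by
    by_contra h
    exact hcon y ⟨hy, hys, h⟩
  obtain ⟨y, -, hy1, hy2⟩ := ht (interior s) (closure s)ᶜ isOpen_interior
    isClosed_closure.isOpen_compl
    (fun y hy => (em (y ∈ closure s)).imp (hin y hy) id)
    (h1.imp fun y hy => ⟨hy.1, hin y hy.1 (subset_closure hy.2)⟩)
    (h2.imp fun y hy => ⟨hy.1, fun h => hy.2 (interior_subset (hin y hy.1 h))⟩)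
  exact hy2 (interior_subset_closure hy1)

theorem volume_symmDiff_preimage_add_le {n : ℕ} (A : Set (Eucl n)) (i : Fin n) (t : ℝ) :
    volume (A ∆ ((fun y => y + t • EuclideanSpace.single i (1 : ℝ)) ⁻¹' A)) ≤
      ENNReal.ofReal (3 * (|t| + 1)) * μH[(n : ℝ) - 1] (frontier A) := by
  refine (measure_mono ?_).trans (volume_sweep_le (frontier A) i (by positivity : 0 < |t| + 1))
  intro y hy
  set f : ℝ → Eucl n := fun τ => y + τ • EuclideanSpace.single i (1 : ℝ) with hf
  have hc : Continuous f := by fun_prop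
  have hpre : IsPreconnected (f '' Icc (-(|t| + 1)) (|t| + 1)) :=
    isPreconnected_Icc.image f hc.continuousOn
  have h0 : f 0 = y := by simp [hf]
  have hm0 : f 0 ∈ f '' Icc (-(|t| + 1)) (|t| + 1) :=
    mem_image_of_mem f ⟨by linarith [abs_nonneg t], by linarith [abs_nonneg t]⟩
  have hmt : f t ∈ f '' Icc (-(|t| + 1)) (|t| + 1) :=
    mem_image_of_mem f ⟨by linarith [neg_abs_le t], by linarith [le_abs_self t]⟩
  rw [h0] at hm0
  have hne : (f '' Icc (-(|t| + 1)) (|t| + 1) ∩ frontier A).Nonempty := by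
    rcases hy with ⟨h1, h2⟩ | ⟨h1, h2⟩
    · exact hpre.inter_frontier_nonempty ⟨y, hm0, h1⟩ ⟨f t, hmt, h2⟩
    · exact hpre.inter_frontier_nonempty ⟨f t, hmt, h1⟩ ⟨y, hm0, h2⟩
  obtain ⟨_, ⟨τ, hτ, rfl⟩, hτA⟩ := hne
  exact ⟨τ, hτ, hτA⟩

theorem volume_symmDiff_preimage_add_eq_zero {n : ℕ} {E : Set (Eucl n)}
    (hP : PeT E = 0) (i : Fin n) (t : ℝ) :
    volume (E ∆ ((fun y => y + t • EuclideanSpace.single i (1 : ℝ)) ⁻¹' E)) = 0 := by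
  set φ : Eucl n → Eucl n := fun y => y + t • EuclideanSpace.single i (1 : ℝ) with hφ
  have hle : ∀ η : ℝ≥0∞, 0 < η → volume (E ∆ (φ ⁻¹' E)) ≤
      η + ENNReal.ofReal (3 * (|t| + 1)) * η + η := by
    intro η hη
    obtain ⟨A, _, hAE, hAP⟩ := exists_approx_of_PeT_lt (hP ▸ hη : PeT E < η) hη
    have h1 := volume_symmDiff_preimage_add_le A i t
    have h2 : volume ((φ ⁻¹' A) ∆ (φ ⁻¹' E)) = volume (A ∆ E) := by
      rw [← Set.preimage_symmDiff]
      exact measure_preimage_add_right volume _ _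
    calc volume (E ∆ (φ ⁻¹' E)) ≤ volume (E ∆ A) + volume (A ∆ (φ ⁻¹' E)) :=
          measure_symmDiff_triangle _ _ _
      _ ≤ volume (E ∆ A) + (volume (A ∆ (φ ⁻¹' A)) + volume ((φ ⁻¹' A) ∆ (φ ⁻¹' E))) := by
          gcongr; exact measure_symmDiff_triangle _ _ _
      _ ≤ η + (ENNReal.ofReal (3 * (|t| + 1)) * η + η) := by
          rw [h2, symmDiff_comm E A]
          refine add_le_add hAE.le (add_le_add (h1.trans ?_) hAE.le)
          exact mul_le_mul' le_rfl hAP.le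
      _ = _ := (add_assoc _ _ _).symm
  have ht := ENNReal.tendsto_inv_nat_nhds_zero
  have hlim : Tendsto (fun k : ℕ => ((k : ℝ≥0∞))⁻¹ + ENNReal.ofReal (3 * (|t| + 1)) *
      ((k : ℝ≥0∞))⁻¹ + ((k : ℝ≥0∞))⁻¹) atTop (𝓝 0) := by
    simpa using (ht.add (ENNReal.Tendsto.const_mul (a := ENNReal.ofReal (3 * (|t| + 1))) ht
      (Or.inr ENNReal.ofReal_ne_top))).add ht
  exact nonpos_iff_eq_zero.1 (ge_of_tendsto' hlim fun k => hle _ (by simp))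

theorem volume_symmDiff_preimage_vadd_eq_zero {n : ℕ} {E : Set (Eucl n)}
    (hP : PeT E = 0) (z : Eucl n) : volume (E ∆ ((fun y => y + z) ⁻¹' E)) = 0 := by
  have hz : z = ∑ i, z i • EuclideanSpace.single i (1 : ℝ) := by
    ext j
    simp [Finset.sum_apply, Pi.single_apply]
  rw [hz]
  refine Finset.sum_induction _ (fun w => volume (E ∆ ((fun y => y + w) ⁻¹' E)) = 0) ?_ ?_
    fun i _ => volume_symmDiff_preimage_add_eq_zero hP i _
  · intro v w hv hw
    refine nonpos_iff_eq_zero.1 ((measure_symmDiff_triangle E ((fun y => y + w) ⁻¹' E) _).trans ?_)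
    have h1 : ((fun y => y + w) ⁻¹' E) ∆ ((fun y => y + (v + w)) ⁻¹' E) ⊆
        (fun y => y + w) ⁻¹' (E ∆ ((fun y => y + v) ⁻¹' E)) := by
      intro y hy
      simp only [mem_symmDiff, mem_preimage] at hy ⊢
      rwa [add_assoc, add_comm w v]
    have h2 := (measure_mono (μ := volume) h1).trans_eq (measure_preimage_add_right volume w _)
    rw [hv] at h2
    rw [hw, zero_add]
    exact h2
  · simp

theorem volume_eq_zero_or_compl_of_PeT_eq_zero {n : ℕ} {E : Set (Eucl n)} (hE : MeasurableSet E)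
    (hP : PeT E = 0) : volume E = 0 ∨ volume Eᶜ = 0 := by
  set W : Set (Eucl n × Eucl n) := {q | q.2 ∈ E ∧ q.2 + q.1 ∈ Eᶜ} with hW
  have hWm : MeasurableSet W :=
    (measurable_snd hE).inter ((measurable_snd.add measurable_fst) hE.compl)
  have h1 : (volume.prod volume) W = 0 := by
    rw [Measure.prod_apply hWm, lintegral_eq_zero_iff (measurable_measure_prodMk_left hWm)]
    refine Eventually.of_forall fun z => measure_mono_null ?_
      (volume_symmDiff_preimage_vadd_eq_zero hP z)
    intro y hy
    exact Or.inl hy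
  rw [Measure.prod_apply_symm hWm] at h1
  have h2 : ∀ y, volume ((fun z => (z, y)) ⁻¹' W) = E.indicator (fun _ => volume Eᶜ) y := by
    intro y
    by_cases hy : y ∈ E
    · rw [indicator_of_mem hy, ← measure_preimage_add volume y Eᶜ]
      congr 1
      ext z
      simp [hW, hy]
    · rw [indicator_of_notMem hy]
      convert measure_empty (μ := (volume : Measure (Eucl n)))
      ext z
      simp [hW, hy]
  simp only [h2] at h1
  rw [lintegral_indicator hE, setLIntegral_const, mul_eq_zero] at h1
  exact h1.symm

theorem PeT_univ (n : ℕ) : PeT (univ : Set (Eucl n)) = 0 := by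
  refine nonpos_iff_eq_zero.1 (PeT_le_of_approx fun η _ => ⟨univ, ?_, ?_, ?_⟩)
  · simp [HasC1Boundary]
  · simp
  · simp

theorem measurable_sdist {n : ℕ} {F : Set (Eucl n)} (hF : MeasurableSet F) :
    Measurable (sdist F) := by
  have h : Measurable fun x : Eucl n => infDist x (frontier F) := measurable_infDist
  classical
  have : sdist F = fun x => if x ∈ F then -infDist x (frontier F) else infDist x (frontier F) := by
    funext x
    simp only [sdist]
  rw [this]
  exact Measurable.ite hF h.neg h

theorem abs_sdist {n : ℕ} (F : Set (Eucl n)) (y : Eucl n) :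
    |sdist F y| = infDist y (frontier F) := by
  unfold sdist
  split_ifs <;> simp [abs_of_nonneg infDist_nonneg]

theorem integrableOn_sdist_ball {n : ℕ} {F : Set (Eucl n)} (hF : MeasurableSet F) (x : Eucl n)
    (s : ℝ) : IntegrableOn (sdist F) (ball x s) := by
  refine Measure.integrableOn_of_bounded (M := infDist x (frontier F) + s)
    measure_ball_lt_top.ne (measurable_sdist hF).aestronglyMeasurable ?_
  filter_upwards [ae_restrict_mem measurableSet_ball] with y hy
  rw [Real.norm_eq_abs, abs_sdist]
  have := infDist_le_infDist_add_dist (x := y) (y := x) (s := frontier F)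
  have hy : dist y x < s := hy
  linarith

theorem IsGMin.PeT_add_le {n : ℕ} {Ω F E E' : Set (Eucl n)} {h : ℝ} (hE : IsGMin Ω h F E)
    (hE'm : MeasurableSet E') (hΩ : volume (Ω \ E') = 0) {Λ : ℝ≥0} {V : ℝ≥0∞} (hV : V ≠ ⊤)
    (hint : h⁻¹ * ∫ y in E', sdist F y ≤ h⁻¹ * (∫ y in E, sdist F y) - Λ * V.toReal) :
    PeT E + Λ * V ≤ PeT E' := by
  by_cases hE' : PeT E' = ⊤
  · rw [hE']; exact le_top
  have h1 := hE.2.2 E' ⟨hE'm, lt_top_iff_ne_top.2 hE'⟩ hΩ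
  have hEt : PeT E ≠ ⊤ := hE.1.2.ne
  unfold Gfun at h1
  rw [← EReal.coe_ennreal_toReal hEt, ← EReal.coe_ennreal_toReal hE', ← EReal.coe_add,
    ← EReal.coe_add, EReal.coe_le_coe_iff] at h1
  have hΛV : Λ * V ≠ ⊤ := ENNReal.mul_ne_top ENNReal.coe_ne_top hV
  rw [← ENNReal.toReal_le_toReal (ENNReal.add_ne_top.2 ⟨hEt, hΛV⟩) hE',
    ENNReal.toReal_add hEt hΛV, ENNReal.toReal_mul, ENNReal.coe_toReal]
  linarith

theorem IsGMin.integrableOn_sdist {n : ℕ} {Ω F E : Set (Eucl n)} {h : ℝ} (hE : IsGMin Ω h F E)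
    (h0 : volume E ≠ 0) (h0c : volume Eᶜ ≠ 0) : IntegrableOn (sdist F) E := by
  by_contra hcon
  have hle := hE.PeT_add_le (E' := univ) MeasurableSet.univ (by simp) (Λ := 0) (V := 0) (by simp)
    (by
      rw [integral_undef hcon, integral_undef fun hu =>
        hcon (IntegrableOn.mono_set hu (subset_univ E))]
      simp)
  rw [PeT_univ] at hle
  have hP : PeT E = 0 := by simpa using hle
  exact (volume_eq_zero_or_compl_of_PeT_eq_zero hE.1.1 hP).elim h0 h0c

theorem mul_volume_le_setIntegral {n : ℕ} {S : Set (Eucl n)} (hS : MeasurableSet S)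
    (hSt : volume S ≠ ⊤) {f : Eucl n → ℝ} (hf : IntegrableOn f S) {R : ℝ}
    (hR : ∀ y ∈ S, R ≤ f y) : R * (volume S).toReal ≤ ∫ y in S, f y := by
  have h1 := setIntegral_mono_on (integrableOn_const hSt) hf hS hR
  rw [setIntegral_const, smul_eq_mul, mul_comm] at h1
  exact h1

theorem IsGMin.PeT_add_le_sdiff_ball {n : ℕ} {Ω F E : Set (Eucl n)} {h : ℝ} (hh : 0 < h)
    (hE : IsGMin Ω h F E) (hint : IntegrableOn (sdist F) E) {x : Eucl n} {s R : ℝ}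
    (hΩ : volume (Ω ∩ ball x s) = 0) (hR0 : 0 ≤ R)
    (hR : ∀ y ∈ ball x s, R ≤ sdist F y) :
    PeT E + (R / h).toNNReal * volume (E ∩ ball x s) ≤ PeT (E \ ball x s) := by
  have hfin : volume (E ∩ ball x s) ≠ ⊤ :=
    ((measure_mono inter_subset_right).trans_lt measure_ball_lt_top).ne
  have hΛ : ((R / h).toNNReal : ℝ) * (volume (E ∩ ball x s)).toReal ≤
      h⁻¹ * ∫ y in E ∩ ball x s, sdist F y := by
    rw [Real.coe_toNNReal _ (by positivity), div_eq_inv_mul, mul_assoc]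
    refine mul_le_mul_of_nonneg_left ?_ (by positivity)
    exact mul_volume_le_setIntegral (hE.1.1.inter measurableSet_ball) hfin
      (hint.mono_set inter_subset_left) fun y hy => hR y hy.2
  refine hE.PeT_add_le (hE.1.1.diff measurableSet_ball) ?_ hfin ?_
  · refine measure_mono_null ?_ (measure_union_null hE.2.1 hΩ)
    rintro y ⟨h1, h2⟩
    by_cases hy : y ∈ ball x s
    · exact Or.inr ⟨h1, hy⟩
    · exact Or.inl ⟨h1, fun h => h2 ⟨h, hy⟩⟩
  · have := integral_inter_add_sdiff (measurableSet_ball (x := x) (ε := s)) hint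
    rw [← this]
    linarith

theorem IsGMin.PeT_add_le_union_ball {n : ℕ} {Ω F E : Set (Eucl n)} {h : ℝ} (hh : 0 < h)
    (hE : IsGMin Ω h F E) (hF : MeasurableSet F) (hint : IntegrableOn (sdist F) E) {x : Eucl n}
    {s R : ℝ} (hR0 : 0 ≤ R) (hR : ∀ y ∈ ball x s, sdist F y ≤ -R) :
    PeT Eᶜ + (R / h).toNNReal * volume (Eᶜ ∩ ball x s) ≤ PeT (Eᶜ \ ball x s) := by
  have hfin : volume (Eᶜ ∩ ball x s) ≠ ⊤ :=
    ((measure_mono inter_subset_right).trans_lt measure_ball_lt_top).ne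
  have hm : MeasurableSet (Eᶜ ∩ ball x s) := hE.1.1.compl.inter measurableSet_ball
  have hint' : IntegrableOn (sdist F) (Eᶜ ∩ ball x s) :=
    (integrableOn_sdist_ball hF x s).mono_set inter_subset_right
  have hΛ : ((R / h).toNNReal : ℝ) * (volume (Eᶜ ∩ ball x s)).toReal ≤
      -(h⁻¹ * ∫ y in Eᶜ ∩ ball x s, sdist F y) := by
    rw [Real.coe_toNNReal _ (by positivity), div_eq_inv_mul, mul_assoc, ← mul_neg,
      ← integral_neg]
    refine mul_le_mul_of_nonneg_left ?_ (by positivity)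
    exact mul_volume_le_setIntegral hm hfin hint'.neg fun y hy => le_neg.2 (hR y hy.2)
  have hEq : Eᶜ \ ball x s = (E ∪ (Eᶜ ∩ ball x s))ᶜ := by
    ext y
    simp only [Set.mem_sdiff, mem_compl_iff, mem_union, mem_inter_iff]
    tauto
  rw [hEq, PeT_compl, PeT_compl]
  refine hE.PeT_add_le (hE.1.1.union hm) ?_ hfin ?_
  · exact measure_mono_null (sdiff_subset_sdiff_right subset_union_left) hE.2.1
  · rw [setIntegral_union (disjoint_compl_right.mono_right inter_subset_left) hm hint hint']
    linarith

theorem mem_iff_of_dist_lt_infDist {n : ℕ} {F : Set (Eucl n)} {x y : Eucl n}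
    (h : dist y x < infDist x (frontier F)) : y ∈ F ↔ x ∈ F := by
  have hx : x ∈ ball x (infDist x (frontier F)) := mem_ball_self (dist_nonneg.trans_lt h)
  have hpre : IsPreconnected (ball x (infDist x (frontier F))) :=
    (convex_ball x _).isPreconnected
  by_contra hcon
  have hne : (ball x (infDist x (frontier F)) ∩ frontier F).Nonempty := by
    by_cases hxF : x ∈ F
    · exact hpre.inter_frontier_nonempty ⟨x, hx, hxF⟩ ⟨y, h, fun hy => hcon (by simp [hy, hxF])⟩
    · exact hpre.inter_frontier_nonempty
        ⟨y, h, by_contra fun hy => hcon (by simp [hy, hxF])⟩ ⟨x, hx, hxF⟩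
  obtain ⟨z, hz, hzF⟩ := hne
  exact absurd (infDist_le_dist_of_mem (x := x) hzF) (by rw [dist_comm]; exact not_le.2 hz)

theorem IsNormalized.volume_pos {n : ℕ} {E : Set (Eucl n)} (hE : MeasurableSet E)
    (hN : IsNormalized E) {x : Eucl n} (hx : x ∈ frontier E) {s : ℝ} (hs : 0 < s) :
    0 < volume (E ∩ ball x s) ∧ 0 < volume (Eᶜ ∩ ball x s) := by
  obtain ⟨h1, h2⟩ := (hN x).1 hx s hs
  refine ⟨h1, pos_iff_ne_zero.2 fun h => ?_⟩
  have h3 := measure_inter_add_sdiff (μ := volume) (ball x s) hE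
  have h4 : ball x s \ E = Eᶜ ∩ ball x s := by rw [sdiff_eq, inter_comm]
  rw [h4, h, add_zero, inter_comm] at h3
  exact h2.ne h3

/-- One step of the discrete flow moves the boundary by at most a multiple of `√h`. -/
theorem IsGMin.infDist_sq_le {n : ℕ} {C : ℝ}
    (hC : ∀ (E : Set (Eucl n)) (x : Eucl n) (R : ℝ) (Λ : ℝ≥0), 0 < R → PeT E ≠ ⊤ →
      (∀ s ∈ Ioo 0 R, 0 < volume (E ∩ ball x s)) →
      (∀ s ∈ Ioo 0 R, PeT E + Λ * volume (E ∩ ball x s) ≤ PeT (E \ ball x s)) →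
      Λ * R ≤ C)
    {Ω F E : Set (Eucl n)} {h : ℝ} (hh : 0 < h) (hE : IsGMin Ω h F E) (hF : MeasurableSet F)
    (hΩF : volume (Ω \ F) = 0) (hN : IsNormalized E) {x : Eucl n} (hx : x ∈ frontier E)
    (hpos : 0 < infDist x (frontier F)) : infDist x (frontier F) ^ 2 ≤ 4 * C * h := by
  set R : ℝ := infDist x (frontier F) / 2 with hR
  have hR0 : 0 < R := by positivity
  have hvol := fun s (hs : 0 < s) => hN.volume_pos hE.1.1 hx hs
  have hint : IntegrableOn (sdist F) E := hE.integrableOn_sdist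
    (fun h0 => (hvol 1 one_pos).1.ne' (measure_mono_null inter_subset_left h0))
    (fun h0 => (hvol 1 one_pos).2.ne' (measure_mono_null inter_subset_left h0))
  have hdist : ∀ s ∈ Ioo 0 R, ∀ y ∈ ball x s,
      (y ∈ F ↔ x ∈ F) ∧ R ≤ infDist y (frontier F) := by
    intro s hs y hy
    have hy : dist y x < s := hy
    refine ⟨mem_iff_of_dist_lt_infDist (by linarith [hs.2]), ?_⟩
    have := infDist_le_infDist_add_dist (x := x) (y := y) (s := frontier F)
    rw [dist_comm] at this
    linarith [hs.2]
  have key : ((R / h).toNNReal : ℝ) * R ≤ C := by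
    by_cases hxF : x ∈ F
    · refine hC Eᶜ x R _ hR0 (by rw [PeT_compl]; exact hE.1.2.ne) (fun s hs => (hvol s hs.1).2)
        fun s hs => hE.PeT_add_le_union_ball hh hF hint hR0.le fun y hy => ?_
      obtain ⟨h1, h2⟩ := hdist s hs y hy
      rw [sdist, if_pos (h1.2 hxF)]
      linarith
    · refine hC E x R _ hR0 hE.1.2.ne (fun s hs => (hvol s hs.1).1)
        fun s hs => hE.PeT_add_le_sdiff_ball hh hint ?_ hR0.le fun y hy => ?_
      · refine measure_mono_null ?_ hΩF
        exact fun y hy => ⟨hy.1, fun hyF => hxF ((hdist s hs y hy.2).1.1 hyF)⟩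
      · obtain ⟨h1, h2⟩ := hdist s hs y hy
        rw [sdist, if_neg fun hyF => hxF (h1.1 hyF)]
        exact h2
  rw [Real.coe_toNNReal _ (by positivity), div_mul_eq_mul_div, div_le_iff₀ hh] at key
  have h2 : infDist x (frontier F) = 2 * R := by rw [hR]; ring
  rw [h2]
  nlinarith

/-- **Proposition 3.2 (uniform distance estimate).** There is a dimensional constant
`γ(n) > 0` such that consecutive boundaries of any discrete flow with obstacle are at
distance at most `γ √h`. -/
theorem discrete_flow_distance_estimate (n : ℕ) :
    ∃ γ : ℝ, 0 < γ ∧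
      ∀ Ω E₀ : Set (Eucl n), IsClosed Ω → IsBounded Ω → HasC11Boundary Ω →
        IsClosed E₀ → IsBounded E₀ → Ω ⊆ E₀ → volume (frontier E₀) = 0 →
        ∀ h : ℝ, 0 < h → ∀ E : ℕ → Set (Eucl n), IsDiscreteFlow Ω E₀ h E →
          (∀ i : ℕ, IsNormalized (E i)) →
          ∀ i : ℕ, ∀ x ∈ frontier (E (i + 1)),
            infDist x (frontier (E i)) ≤ γ * Real.sqrt h := by
  rcases Nat.eq_zero_or_pos n with rfl | hn
  · refine ⟨1, one_pos, ?_⟩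
    intro Ω E₀ _ _ _ _ _ _ _ h _ E _ _ i x hx
    rw [(isClopen_discrete _).frontier_eq] at hx
    exact hx.elim
  obtain ⟨C, hC0, hC⟩ := exists_density_bound n hn
  refine ⟨2 * Real.sqrt C, by positivity, ?_⟩
  intro Ω E₀ _ _ _ hE₀ _ hΩE₀ _ h hh E hflow hN i x hx
  have hi : MeasurableSet (E i) ∧ volume (Ω \ E i) = 0 := by
    cases i with
    | zero =>
      rw [hflow.1]
      exact ⟨hE₀.measurableSet, by simp [sdiff_eq_empty.2 hΩE₀]⟩
    | succ k => exact ⟨(hflow.2 k).1.1, (hflow.2 k).2.1⟩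
  rcases (infDist_nonneg (x := x) (s := frontier (E i))).eq_or_lt with h0 | hpos
  · rw [← h0]; positivity
  have h1 := (hflow.2 i).infDist_sq_le hC hh hi.1 hi.2 (hN (i + 1)) hx hpos
  refine le_of_sq_le_sq ?_ (by positivity)
  rw [mul_pow, mul_pow, Real.sq_sqrt hC0.le, Real.sq_sqrt hh.le]
  linarith
end
end

section
/- Let n ≥ 2, c > 0, R > 0, and let f : [0,R] → [0,∞) be nondecreasing with f(r) > 0 for every r > 0. Assume that at almost every r ∈ (0,R) the derivative f′(r) exists and f(r)^{(n−1)/n} ≤ c·f′(r). Then f(r) ≥ (r/(n c))ⁿ for every r ∈ [0,R]. -/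
open MeasureTheory Metric Filter Set Bornology
open scoped ENNReal NNReal symmDiff Topology RealInnerProductSpace

noncomputable section

/-- If `f` is positive at `r` and satisfies `f^{(p-1)/p} ≤ c f'` there, then `f^{1/p}` has
derivative at least `1 / (p c)` at `r`. -/
lemma inv_mul_le_deriv_rpow_inv {f : ℝ → ℝ} {p c r : ℝ} (hp : 0 < p) (hc : 0 < c)
    (hf : 0 < f r) (hd : DifferentiableAt ℝ f r) (h : f r ^ ((p - 1) / p) ≤ c * deriv f r) :
    (p * c)⁻¹ ≤ deriv (fun x => f x ^ p⁻¹) r := by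
  rw [(hd.hasDerivAt.rpow_const (p := p⁻¹) (Or.inl hf.ne')).deriv]
  have hexp : p⁻¹ - 1 = -((p - 1) / p) := by field_simp; ring
  rw [hexp, Real.rpow_neg hf.le]
  have hq : 0 < f r ^ ((p - 1) / p) := Real.rpow_pos_of_pos hf _
  set q := f r ^ ((p - 1) / p)
  calc (p * c)⁻¹ = q * (p⁻¹ * c⁻¹ * q⁻¹) := by field_simp
    _ ≤ c * deriv f r * (p⁻¹ * c⁻¹ * q⁻¹) := by gcongr
    _ = deriv f r * p⁻¹ * q⁻¹ := by field_simp

/-- A monotone function on `[a, b]` whose derivative is almost everywhere at least `m`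
grows by at least `m (b - a)`. -/
lemma MonotoneOn.mul_sub_le_sub_of_ae_le_deriv {g : ℝ → ℝ} {a b m : ℝ} (hab : a ≤ b)
    (hg : MonotoneOn g (Icc a b)) (h : ∀ᵐ x ∂(volume.restrict (Ioo a b)), m ≤ deriv g x) :
    m * (b - a) ≤ g b - g a := by
  rw [← uIcc_of_le hab] at hg
  have hint := hg.intervalIntegrable_deriv
  have hmem := hg.intervalIntegral_deriv_mem_uIcc
  have hga : g a ≤ g b := hg left_mem_uIcc right_mem_uIcc hab
  rw [uIcc_of_le (sub_nonneg.2 hga)] at hmem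
  refine le_trans ?_ hmem.2
  rw [restrict_Ioo_eq_restrict_Icc] at h
  have := intervalIntegral.integral_mono_ae_restrict hab intervalIntegrable_const hint h
  simpa [mul_comm] using this

/-- Integration of the differential inequality `f^{(n-1)/n} ≤ c f'` for a nondecreasing
function yields `f(r) ≥ (r/(nc))ⁿ`. -/
theorem integrate_differential_inequality (n : ℕ) (hn : 2 ≤ n) (c R : ℝ) (hc : 0 < c)
    (hR : 0 < R) (f : ℝ → ℝ)
    (hnonneg : ∀ r ∈ Icc (0 : ℝ) R, 0 ≤ f r)
    (hmono : MonotoneOn f (Icc (0 : ℝ) R))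
    (hpos : ∀ r ∈ Ioc (0 : ℝ) R, 0 < f r)
    (hineq : ∀ᵐ r ∂(volume.restrict (Ioo (0 : ℝ) R)),
      DifferentiableAt ℝ f r ∧ f r ^ (((n : ℝ) - 1) / (n : ℝ)) ≤ c * deriv f r) :
    ∀ r ∈ Icc (0 : ℝ) R, (r / (n * c)) ^ n ≤ f r := by
  rintro r ⟨hr0, hrR⟩
  have hn0 : (0 : ℝ) < n := by positivity
  have hsub : Icc 0 r ⊆ Icc 0 R := Icc_subset_Icc_right hrR
  have hg : MonotoneOn (fun x => f x ^ (n : ℝ)⁻¹) (Icc 0 r) := fun x hx y hy hxy =>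
    Real.rpow_le_rpow (hnonneg x (hsub hx)) (hmono (hsub hx) (hsub hy) hxy) (by positivity)
  have hder : ∀ᵐ x ∂(volume.restrict (Ioo 0 r)),
      ((n : ℝ) * c)⁻¹ ≤ deriv (fun x => f x ^ (n : ℝ)⁻¹) x := by
    filter_upwards [ae_restrict_of_ae_restrict_of_subset (Ioo_subset_Ioo_right hrR) hineq,
      ae_restrict_mem measurableSet_Ioo] with x hx hxr
    exact inv_mul_le_deriv_rpow_inv hn0 hc (hpos x ⟨hxr.1, hxr.2.le.trans hrR⟩) hx.1 hx.2
  have hgrow := hg.mul_sub_le_sub_of_ae_le_deriv hr0 hder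
  have h0 : 0 ≤ f 0 ^ (n : ℝ)⁻¹ := Real.rpow_nonneg (hnonneg 0 ⟨le_rfl, hR.le⟩) _
  have hle : r / (n * c) ≤ f r ^ (n : ℝ)⁻¹ := by
    rw [div_eq_inv_mul]
    linarith
  calc (r / (n * c)) ^ n ≤ (f r ^ (n : ℝ)⁻¹) ^ n := by gcongr
    _ = f r := Real.rpow_inv_natCast_pow (hnonneg r ⟨hr0, hrR⟩) (by omega)
end
end
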